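/- arXiv:1507.03843 — 3 statements merged into one kernel-verified Lean document; each statement's English description precedes it below -/
import Mathlib

section
/- Consider the r-antenna no-CSI SIMO Rayleigh-fading channel in its equivalent exponential form. Fix E > 0, ε ∈ (0,1), N ∈ ℕ with N ≥ 1, and τ ∈ (0,ε). Let G_N have the Gamma(rN,1) distribution and let ξ ≥ 0 be the unique number with P[G_N ≤ ξ] = ε − τ. Then for every integer M ≥ 1 satisfying (M−1)·P[G_N ≥ (1 + E/N)·ξ] ≤ τ, there exists an (E, M, ε)-code for this channel. -/
open MeasureTheory ProbabilityTheory

/-- `μ` is the countable product of the probability measures `ν i`: it is a probability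
measure giving every finite-dimensional cylinder set the product of the coordinate
probabilities. -/
def IsPiNat {Y : Type*} [MeasurableSpace Y] (ν : ℕ → Measure Y) (μ : Measure (ℕ → Y)) : Prop :=
  IsProbabilityMeasure μ ∧
    ∀ (s : Finset ℕ) (A : ℕ → Set Y), (∀ i, MeasurableSet (A i)) →
      μ {y | ∀ i ∈ s, y i ∈ A i} = ∏ i ∈ s, ν i (A i)

/-- The output law of the `r`-antenna no-CSI SIMO Rayleigh-fading channel in its equivalent
exponential form: given input symbol `x`, the `r` output coordinates are independent, each
distributed as `(1 + x) · S` with `S` exponential of mean `1`. -/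
noncomputable def simoLaw (r : ℕ) (x : ℝ) : Measure (Fin r → ℝ) :=
  Measure.pi fun _ => (expMeasure 1).map (fun s => (1 + x) * s)

/-- An `(E, M, ε)` code for the `r`-antenna no-CSI SIMO Rayleigh-fading channel in its
equivalent exponential form: `M` codewords (sequences of nonnegative input symbols), each of
total cost (= sum of entries) at most `E`, and a measurable decoder whose error probability
under the output distribution induced by each codeword is at most `ε`. -/
structure SimoCode (r : ℕ) (E : ℝ) (M : ℕ) (ε : ℝ) where
  enc : Fin M → ℕ → ℝ
  enc_nonneg : ∀ j i, 0 ≤ enc j i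
  dec : (ℕ → Fin r → ℝ) → Fin M
  meas_dec : Measurable dec
  cost : ∀ j, (∑' i, ENNReal.ofReal (enc j i)) ≤ ENNReal.ofReal E
  err : ∀ (j : Fin M) (μ : Measure (ℕ → Fin r → ℝ)),
      IsPiNat (fun i => simoLaw r (enc j i)) μ → μ {y | dec y ≠ j} ≤ ENNReal.ofReal ε

lemma simo_integrable_aux (n : ℕ) (t : ℝ) :
    IntegrableOn (fun x : ℝ => (x : ℂ) ^ n * Complex.exp (-(1 - t * Complex.I) * x))
      (Set.Ioi 0) := by
  have h := Real.GammaIntegral_convergent (s := (n : ℝ) + 1) (by positivity)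
  refine h.mono' (by fun_prop) ?_
  refine (ae_restrict_iff' measurableSet_Ioi).2 (Filter.Eventually.of_forall fun x hx => ?_)
  have hx : 0 < x := hx
  simp [Complex.norm_exp, abs_of_pos hx]
  linarith [mul_comm (Real.exp (-x)) (x ^ n)]

lemma simo_tendsto_aux (n : ℕ) (t : ℝ) :
    Filter.Tendsto (fun x : ℝ => (x : ℂ) ^ n * Complex.exp (-(1 - t * Complex.I) * x))
      Filter.atTop (nhds 0) := by
  rw [tendsto_zero_iff_norm_tendsto_zero]
  refine (Real.tendsto_pow_mul_exp_neg_atTop_nhds_zero n).congr' ?_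
  filter_upwards [Filter.eventually_gt_atTop 0] with x hx
  simp [Complex.norm_exp, abs_of_pos hx]

lemma simo_ne_aux (t : ℝ) : (1 - t * Complex.I : ℂ) ≠ 0 := by
  intro h
  have := congrArg Complex.re h
  simp at this

lemma simo_integral_aux (n : ℕ) (t : ℝ) :
    ∫ x in Set.Ioi (0 : ℝ), (x : ℂ) ^ n * Complex.exp (-(1 - t * Complex.I) * x)
      = (n.factorial : ℂ) / (1 - t * Complex.I) ^ (n + 1) := by
  have hz := simo_ne_aux t
  induction n with
  | zero =>
    have := integral_exp_mul_complex_Ioi (a := -(1 - t * Complex.I)) (by simp) 0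
    simp only [pow_zero, one_mul, this]
    simp
    rw [← neg_sub, div_neg, neg_div, neg_neg, one_div]
  | succ n ih =>
    have h1 := simo_integrable_aux n t
    have h2 := simo_integrable_aux (n + 1) t
    have key := integral_Ioi_of_hasDerivAt_of_tendsto' (a := (0 : ℝ))
      (f := fun x : ℝ => (x : ℂ) ^ (n + 1) * Complex.exp (-(1 - t * Complex.I) * x))
      (f' := fun x : ℝ => ((n : ℂ) + 1) * ((x : ℂ) ^ n * Complex.exp (-(1 - t * Complex.I) * x))
        - (1 - t * Complex.I) * ((x : ℂ) ^ (n + 1) * Complex.exp (-(1 - t * Complex.I) * x)))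
      (m := 0) (fun x _ => ?_) ((h1.const_mul _).sub (h2.const_mul _))
      (simo_tendsto_aux (n + 1) t)
    · rw [integral_sub (h1.const_mul _) (h2.const_mul _), integral_const_mul,
        integral_const_mul, ih] at key
      simp only [Complex.ofReal_zero, ne_eq, Nat.add_eq_zero_iff, one_ne_zero, and_false,
        not_false_eq_true, zero_pow, zero_mul, sub_zero] at key
      rw [eq_div_iff (pow_ne_zero _ hz), Nat.factorial_succ]
      push_cast
      rw [sub_eq_zero] at key
      rw [pow_succ' _ (n + 1), ← mul_assoc, mul_comm _ (1 - (t : ℂ) * Complex.I), ← key]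
      field_simp
    · have hd : HasDerivAt (fun x : ℝ => (x : ℂ)) 1 x := Complex.ofRealCLM.hasDerivAt
      have := (hd.pow (n + 1)).mul ((hd.const_mul (-(1 - t * Complex.I))).cexp)
      refine HasDerivAt.congr_deriv this ?_
      simp only [Pi.pow_apply, Nat.add_sub_cancel]
      push_cast
      ring

lemma simo_charFun_gamma (n : ℕ) (hn : 0 < n) (t : ℝ) :
    charFun (gammaMeasure (n : ℝ) 1) t = (1 / (1 - t * Complex.I)) ^ n := by
  obtain ⟨m, rfl⟩ : ∃ m, n = m + 1 := ⟨n - 1, by omega⟩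
  have hpos : (0 : ℝ) < ((m + 1 : ℕ) : ℝ) := by positivity
  rw [charFun_apply_real, gammaMeasure, integral_withDensity_eq_integral_toReal_smul
    (by unfold gammaPDF; fun_prop) (by simp [gammaPDF])]
  have : ∀ x : ℝ, (gammaPDF ((m + 1 : ℕ) : ℝ) 1 x).toReal • Complex.exp (t * x * Complex.I)
      = (Set.Ici (0 : ℝ)).indicator (fun x : ℝ => (1 / (m.factorial : ℂ)) *
        ((x : ℂ) ^ m * Complex.exp (-(1 - t * Complex.I) * x))) x := by
    intro x
    rw [gammaPDF, ENNReal.toReal_ofReal (gammaPDFReal_nonneg hpos one_pos x), gammaPDFReal]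
    by_cases hx : 0 ≤ x
    · rw [Set.indicator_of_mem (by exact hx), if_pos hx]
      have hG : Real.Gamma ((m + 1 : ℕ) : ℝ) = m.factorial := by
        push_cast; exact Real.Gamma_nat_eq_factorial m
      rw [hG]
      have he : -(1 - t * Complex.I) * x = ((-x : ℝ) : ℂ) + t * x * Complex.I := by
        push_cast; ring
      rw [he, Complex.exp_add, ← Complex.ofReal_exp]
      simp
      ring
    · rw [Set.indicator_of_notMem (by exact hx), if_neg hx, zero_smul]
  simp_rw [this]
  rw [integral_indicator measurableSet_Ici, integral_Ici_eq_integral_Ioi, integral_const_mul,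
    simo_integral_aux]
  have : (m.factorial : ℂ) ≠ 0 := by exact_mod_cast m.factorial_ne_zero
  have hz := simo_ne_aux t
  rw [div_pow, one_pow]
  field_simp

lemma simo_block_law (r N : ℕ) (hr : 0 < r) (hN : 0 < N) (x : ℕ → ℝ)
    (μ : Measure (ℕ → Fin r → ℝ)) (hμ : IsPiNat (fun i => simoLaw r (x i)) μ)
    (s : Finset ℕ) (hs : s.card = N) (c : ℝ) (hx : ∀ i ∈ s, 1 + x i = c) :
    μ.map (fun y => ∑ p ∈ s ×ˢ (Finset.univ : Finset (Fin r)), y p.1 p.2)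
      = (gammaMeasure ((r * N : ℕ) : ℝ) 1).map (fun s => c * s) := by
  have := hμ.1
  have he : IsProbabilityMeasure (expMeasure 1) := isProbabilityMeasure_expMeasure one_pos
  have hg : IsProbabilityMeasure (gammaMeasure ((r * N : ℕ) : ℝ) 1) :=
    isProbabilityMeasure_gammaMeasure (by positivity) one_pos
  have hp : ∀ a : ℝ, IsProbabilityMeasure ((expMeasure 1).map (fun s => (1 + a) * s)) :=
    fun a => Measure.isProbabilityMeasure_map (by fun_prop)
  have hq : ∀ i, IsProbabilityMeasure (simoLaw r (x i)) := fun i => by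
    unfold simoLaw; infer_instance
  have hinf : μ = Measure.infinitePi (fun i => simoLaw r (x i)) :=
    Measure.eq_infinitePi _ (fun s t ht => hμ.2 s t ht)
  have hind : iIndepFun (fun (p : ℕ × Fin r) (y : ℕ → Fin r → ℝ) => y p.1 p.2) μ := by
    have h := iIndepFun_uncurry_infinitePi' (ι := ℕ) (κ := Fin r)
      (X := fun _ _ => (id : ℝ → ℝ))
      (fun i (_ : Fin r) => (expMeasure 1).map (fun s => (1 + x i) * s)) (fun _ _ => measurable_id)
    rw [hinf]
    simp only [Measure.infinitePi_eq_pi] at h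
    exact h
  have hmarg : ∀ p : ℕ × Fin r, μ.map (fun y => y p.1 p.2)
      = (expMeasure 1).map (fun s => (1 + x p.1) * s) := by
    intro p
    have h1 : μ.map (fun y => y p.1) = simoLaw r (x p.1) := by
      rw [hinf]; exact Measure.infinitePi_map_eval _ p.1
    have h2 : (simoLaw r (x p.1)).map (fun z => z p.2)
        = (expMeasure 1).map (fun s => (1 + x p.1) * s) :=
      (measurePreserving_eval _ p.2).map_eq
    rw [← h2, ← h1, Measure.map_map (by fun_prop) (by fun_prop)]
    rfl
  have hm1 : IsProbabilityMeasure
      (μ.map (fun y => ∑ p ∈ s ×ˢ (Finset.univ : Finset (Fin r)), y p.1 p.2)) :=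
    Measure.isProbabilityMeasure_map (Measurable.aemeasurable (by fun_prop))
  have hm2 : IsProbabilityMeasure ((gammaMeasure ((r * N : ℕ) : ℝ) 1).map (fun s => c * s)) :=
    Measure.isProbabilityMeasure_map (by fun_prop)
  apply Measure.ext_of_charFun
  ext t
  rw [iIndepFun.charFun_map_fun_finsetSum_eq_prod
    (X := fun (p : ℕ × Fin r) (y : ℕ → Fin r → ℝ) => y p.1 p.2) (fun _ _ => Measurable.aemeasurable (by fun_prop))
    (hind.restrict _), Finset.prod_apply, charFun_map_mul, simo_charFun_gamma _ (by positivity)]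
  rw [Finset.prod_congr rfl (g := fun _ => 1 / (1 - ((c * t : ℝ) : ℂ) * Complex.I))]
  · simp [hs, mul_comm r N]
  · intro p hp
    rw [hmarg, charFun_map_mul, hx _ (Finset.mem_product.1 hp).1]
    have := simo_charFun_gamma 1 one_pos (c * t)
    simpa [expMeasure] using this

theorem simo_achievability_kappa_beta
    (r : ℕ) (hr : 0 < r) (E : ℝ) (hE : 0 < E)
    (ε τ : ℝ) (hε : ε ∈ Set.Ioo (0 : ℝ) 1) (hτ : τ ∈ Set.Ioo (0 : ℝ) ε)
    (N : ℕ) (hN : 1 ≤ N)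
    (ξ : ℝ) (hξ : 0 ≤ ξ)
    (hcdf : gammaMeasure ((r * N : ℕ) : ℝ) 1 (Set.Iic ξ) = ENNReal.ofReal (ε - τ))
    (M : ℕ) (hM : 1 ≤ M)
    (hMbound : ((M : ℝ) - 1) *
        (gammaMeasure ((r * N : ℕ) : ℝ) 1 (Set.Ici ((1 + E / N) * ξ))).toReal ≤ τ) :
    Nonempty (SimoCode r E M ε) := by
  classical
  obtain ⟨hτ0, hτε⟩ := hτ
  have hNpos : (0 : ℝ) < N := by exact_mod_cast hN
  set c : ℝ := 1 + E / N with hc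
  have hc0 : 0 < c := by positivity
  have hg : IsProbabilityMeasure (gammaMeasure ((r * N : ℕ) : ℝ) 1) :=
    isProbabilityMeasure_gammaMeasure (by positivity) one_pos
  let B : ℕ → Finset ℕ := fun j => Finset.Ico (j * N) ((j + 1) * N)
  have hBcard : ∀ j, (B j).card = N := fun j => by simp [B, add_mul]
  have hBdisj : ∀ j k i, i ∈ B j → i ∈ B k → j = k := by
    intro j k i hj hk
    simp only [B, Finset.mem_Ico] at hj hk
    have h1 : j < k + 1 := lt_of_mul_lt_mul_right (hj.1.trans_lt hk.2) (Nat.zero_le N)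
    have h2 : k < j + 1 := lt_of_mul_lt_mul_right (hk.1.trans_lt hj.2) (Nat.zero_le N)
    omega
  let T : Fin M → (ℕ → Fin r → ℝ) → ℝ :=
    fun k y => ∑ p ∈ B k ×ˢ (Finset.univ : Finset (Fin r)), y p.1 p.2
  have hT : ∀ k, Measurable (T k) := fun k => by simp only [T]; fun_prop
  let acc : (ℕ → Fin r → ℝ) → Fin M → Prop := fun y k => c * ξ ≤ T k y
  have hacc : Measurable acc := by
    refine measurable_pi_iff.2 fun k => measurableSet_setOfPred.1 ?_
    exact measurableSet_le measurable_const (hT k)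
  let pick : (Fin M → Prop) → Fin M := fun a => if h : ∃ k, a k then h.choose else ⟨0, hM⟩
  let enc : Fin M → ℕ → ℝ := fun j i => if i ∈ B j then E / N else 0
  refine ⟨⟨enc, ?_, fun y => pick (acc y), ?_, ?_, ?_⟩⟩
  · intro j i
    simp only [enc]
    split_ifs <;> positivity
  · exact (Measurable.of_discrete (f := pick)).comp hacc
  · intro j
    rw [tsum_eq_sum (s := B j) (fun i hi => by simp [enc, hi]),
      Finset.sum_congr rfl (g := fun _ => ENNReal.ofReal (E / N)) (fun i hi => by simp [enc, hi]),
      Finset.sum_const, hBcard, nsmul_eq_mul, ← ENNReal.ofReal_natCast,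
      ← ENNReal.ofReal_mul hNpos.le, mul_div_cancel₀ _ hNpos.ne']
  · intro j μ hμ
    have hsub : {y | pick (acc y) ≠ j} ⊆ {y | T j y < c * ξ} ∪
        ⋃ k ∈ (Finset.univ.erase j : Finset (Fin M)), {y | c * ξ ≤ T k y} := by
      intro y hy
      by_cases hj : T j y < c * ξ
      · exact Or.inl hj
      · right
        have hex : ∃ k, acc y k := ⟨j, not_lt.1 hj⟩
        have hspec : acc y (pick (acc y)) := by
          simp only [pick, dif_pos hex]; exact hex.choose_spec
        simp only [Set.mem_iUnion]
        exact ⟨pick (acc y), Finset.mem_erase.2 ⟨hy, Finset.mem_univ _⟩, hspec⟩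
    have h1 : μ {y | T j y < c * ξ} ≤ ENNReal.ofReal (ε - τ) := by
      have hl := simo_block_law r N hr hN (enc j) μ hμ (B j) (hBcard j) c
        (fun i hi => by simp [enc, hi, hc])
      have : μ {y | T j y < c * ξ} = μ.map (T j) (Set.Iio (c * ξ)) := by
        rw [Measure.map_apply (hT j) measurableSet_Iio]; rfl
      rw [this, hl, Measure.map_apply (by fun_prop) measurableSet_Iio, ← hcdf]
      refine measure_mono fun z hz => ?_
      exact (lt_of_mul_lt_mul_left hz hc0.le).le
    have h2 : ∀ k ∈ (Finset.univ.erase j : Finset (Fin M)), μ {y | c * ξ ≤ T k y} ≤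
        gammaMeasure ((r * N : ℕ) : ℝ) 1 (Set.Ici (c * ξ)) := by
      intro k hk
      have hkj := (Finset.mem_erase.1 hk).1
      have hl := simo_block_law r N hr hN (enc j) μ hμ (B k) (hBcard k) 1
        (fun i hi => by
          have : i ∉ B j := fun h => hkj (Fin.ext (hBdisj _ _ i hi h))
          simp [enc, this])
      have : μ {y | c * ξ ≤ T k y} = μ.map (T k) (Set.Ici (c * ξ)) := by
        rw [Measure.map_apply (hT k) measurableSet_Ici]; rfl
      rw [this, hl]
      simp
    set β := gammaMeasure ((r * N : ℕ) : ℝ) 1 (Set.Ici (c * ξ)) with hβ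
    have hβt : β ≠ ⊤ := measure_ne_top _ _
    calc μ {y | pick (acc y) ≠ j} ≤ μ {y | T j y < c * ξ} +
          μ (⋃ k ∈ (Finset.univ.erase j : Finset (Fin M)), {y | c * ξ ≤ T k y}) :=
          (measure_mono hsub).trans (measure_union_le _ _)
      _ ≤ ENNReal.ofReal (ε - τ) + ∑ k ∈ (Finset.univ.erase j : Finset (Fin M)), β :=
          add_le_add h1 ((measure_biUnion_finset_le _ _).trans (Finset.sum_le_sum h2))
      _ ≤ ENNReal.ofReal (ε - τ) + ENNReal.ofReal τ := by
          gcongr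
          rw [Finset.sum_const, Finset.card_erase_of_mem (Finset.mem_univ _), Finset.card_univ,
            Fintype.card_fin, nsmul_eq_mul, ← ENNReal.ofReal_toReal hβt,
            ← ENNReal.ofReal_natCast, ← ENNReal.ofReal_mul (by positivity)]
          apply ENNReal.ofReal_le_ofReal
          rw [Nat.cast_sub hM, Nat.cast_one]
          exact hMbound
      _ = ENNReal.ofReal ε := by
          rw [← ENNReal.ofReal_add (by linarith) hτ0.le]; congr 1; ring
end

section
/- Consider the r-antenna no-CSI SIMO Rayleigh-fading channel in its equivalent exponential form, and for E > 0 and ε ∈ (0,1/2) let M*(E,ε) denote the maximum integer M such that an (E, M, ε)-code exists for this channel. Then there exist constants C > 0 and E₀ > 0 such that for all E ≥ E₀: | ln M*(E,ε) − r·E + (12^{−1/3} + (2/3)^{1/3}) · ( r·E·Q^{−1}(ε) )^{2/3} · ( ln(r·E) )^{1/3} | ≤ C · E^{2/3} · ln(ln E) / (ln E)^{2/3}. -/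
open MeasureTheory ProbabilityTheory

/-- The maximum number of messages transmittable with energy `E` and maximal error
probability `ε` over the `r`-antenna no-CSI SIMO channel. -/
noncomputable def Mstar (r : ℕ) (E ε : ℝ) : ℕ :=
  sSup {M | Nonempty (SimoCode r E M ε)}

/-- The Gaussian Q-function `Q(y) = P[Z > y]` for `Z` standard normal. -/
noncomputable def gaussianQ (y : ℝ) : ℝ :=
  (gaussianReal 0 1 (Set.Ioi y)).toReal

/-! ## Part 1: Gaussian distribution function -/

noncomputable def gphi (u : ℝ) : ℝ := (√(2 * Real.pi))⁻¹ * Real.exp (-u ^ 2 / 2)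

noncomputable def gPhi (x : ℝ) : ℝ := 1 / 2 + ∫ u in (0 : ℝ)..x, gphi u

lemma gphi_eq_pdf (u : ℝ) : gphi u = gaussianPDFReal 0 1 u := by
  simp [gphi, gaussianPDFReal]

lemma gphi_pos (u : ℝ) : 0 < gphi u := by unfold gphi; positivity

lemma gphi_cont : Continuous gphi := by unfold gphi; fun_prop

lemma gphi_neg (u : ℝ) : gphi (-u) = gphi u := by simp [gphi]

lemma gphi_le {u v : ℝ} (h : u ^ 2 ≤ v ^ 2) : gphi v ≤ gphi u := by
  unfold gphi; gcongr

lemma gphi_integrable : Integrable gphi := by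
  have := integrable_gaussianPDFReal 0 1
  simpa [funext gphi_eq_pdf] using this

lemma gPhi_hasDerivAt (x : ℝ) : HasDerivAt gPhi (gphi x) x := by
  have := intervalIntegral.integral_hasDerivAt_right (gphi_cont.intervalIntegrable 0 x)
    (gphi_cont.stronglyMeasurableAtFilter _ _) gphi_cont.continuousAt
  exact this.const_add _

lemma gPhi_cont : Continuous gPhi :=
  continuous_iff_continuousAt.2 fun x => (gPhi_hasDerivAt x).continuousAt

lemma gphi_hasDerivAt (x : ℝ) : HasDerivAt gphi (-x * gphi x) x := by
  have h1 : HasDerivAt (fun u : ℝ => -u ^ 2 / 2) (-x) x := by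
    exact ((hasDerivAt_pow 2 x).neg.div_const 2).congr_deriv (by push_cast; ring)
  have := (h1.exp).const_mul ((√(2 * Real.pi))⁻¹)
  exact this.congr_deriv (by unfold gphi; ring)

lemma gPhi_mono : Monotone gPhi :=
  monotone_of_hasDerivAt_nonneg (fun x => gPhi_hasDerivAt x) (fun x => (gphi_pos x).le)

lemma gPhi_zero : gPhi 0 = 1 / 2 := by simp [gPhi]

lemma gPhi_neg (x : ℝ) : gPhi (-x) = 1 - gPhi x := by
  unfold gPhi
  have := intervalIntegral.integral_comp_neg (f := gphi) (a := 0) (b := x)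
  simp only [gphi_neg, neg_zero] at this
  rw [this, intervalIntegral.integral_symm (-x) 0]; ring

lemma gphi_integral_Ioi : ∫ u in Set.Ioi (0 : ℝ), gphi u = 1 / 2 := by
  have h := integral_gaussian_Ioi (1 / 2)
  have h2 : ∀ u : ℝ, gphi u = (√(2 * Real.pi))⁻¹ * Real.exp (-(1 / 2) * u ^ 2) := by
    intro u; unfold gphi; congr 2; ring
  simp_rw [h2, integral_const_mul, h]
  rw [show Real.pi / (1 / 2) = 2 * Real.pi by ring]
  have : √(2 * Real.pi) ≠ 0 := by positivity
  field_simp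

lemma gaussianQ_eq (y : ℝ) : gaussianQ y = gPhi (-y) := by
  rw [gPhi_neg]
  unfold gaussianQ gPhi
  rw [gaussianReal_apply_eq_integral 0 one_ne_zero]
  rw [ENNReal.toReal_ofReal (integral_nonneg (fun u => gaussianPDFReal_nonneg 0 1 u))]
  simp_rw [← gphi_eq_pdf]
  have := intervalIntegral.integral_interval_add_Ioi (f := gphi) (a := 0) (b := y) (μ := volume)
    gphi_integrable.integrableOn gphi_integrable.integrableOn
  rw [gphi_integral_Ioi] at this
  linarith

lemma gPhi_nonneg (x : ℝ) : 0 ≤ gPhi x := by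
  have := gaussianQ_eq (-x)
  rw [neg_neg] at this
  rw [← this]; exact ENNReal.toReal_nonneg

lemma gPhi_le_one (x : ℝ) : gPhi x ≤ 1 := by
  have := gPhi_nonneg (-x)
  rw [gPhi_neg] at this; linarith

lemma gPhi_tail {x : ℝ} (hx : 0 < x) : gPhi (-x) ≤ 1 / x ^ 2 := by
  rw [← gaussianQ_eq]
  unfold gaussianQ
  have h := meas_ge_le_variance_div_sq (μ := gaussianReal 0 1) (X := id)
    (memLp_id_gaussianReal 2) hx
  have h2 : gaussianReal 0 1 (Set.Ioi x) ≤ gaussianReal 0 1 {ω | x ≤ |id ω - ∫ y, id y ∂(gaussianReal 0 1)|} := by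
    apply measure_mono
    intro u hu
    simp only [Set.mem_Ioi] at hu
    simp only [id, integral_id_gaussianReal, Set.mem_ofPred_eq, sub_zero]
    exact hu.le.trans (le_abs_self u)
  have h3 := h2.trans h
  rw [variance_id_gaussianReal] at h3
  apply ENNReal.toReal_le_of_le_ofReal (by positivity)
  simpa using h3

/-- tangent inequality for the Gaussian isoperimetric profile -/
lemma gphi_tangent (a b : ℝ) : gphi a ≤ gphi b - b * (gPhi a - gPhi b) := by
  have hd : ∀ u, HasDerivAt (fun u => gphi b - b * (gPhi u - gPhi b) - gphi u)
      ((u - b) * gphi u) u := by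
    intro u
    have := (((gPhi_hasDerivAt u).sub_const (gPhi b)).const_mul b).const_sub (gphi b) |>.sub
      (gphi_hasDerivAt u)
    exact this.congr_deriv (by ring)
  rcases le_total a b with h | h
  · have hanti : AntitoneOn (fun u => gphi b - b * (gPhi u - gPhi b) - gphi u) (Set.Iic b) := by
      apply antitoneOn_of_deriv_nonpos (convex_Iic b)
        (fun u _ => (hd u).continuousAt.continuousWithinAt)
        (fun u _ => (hd u).differentiableAt.differentiableWithinAt)
      intro u hu
      rw [(hd u).deriv]
      rw [interior_Iic] at hu
      have : u - b ≤ 0 := by simp only [Set.mem_Iio] at hu; linarith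
      exact mul_nonpos_of_nonpos_of_nonneg this (gphi_pos u).le
    have := hanti (Set.mem_Iic.2 h) (Set.mem_Iic.2 le_rfl) h
    simp only at this
    linarith
  · have hm : MonotoneOn (fun u => gphi b - b * (gPhi u - gPhi b) - gphi u) (Set.Ici b) := by
      apply monotoneOn_of_deriv_nonneg (convex_Ici b)
        (fun u _ => (hd u).continuousAt.continuousWithinAt)
        (fun u _ => (hd u).differentiableAt.differentiableWithinAt)
      intro u hu
      rw [(hd u).deriv]
      rw [interior_Ici] at hu
      have : 0 ≤ u - b := by simp only [Set.mem_Ioi] at hu; linarith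
      exact mul_nonneg this (gphi_pos u).le
    have := hm (Set.mem_Ici.2 le_rfl) (Set.mem_Ici.2 h) h
    simp only at this
    linarith

/-- pointwise comparison -/
lemma gPhi_shift {q : ℝ} (hq : 0 ≤ q) (x : ℝ) :
    Real.exp (-q ^ 2 / 2) * (gPhi (-x) - 1 / 2) ≤ gPhi (-q - x) - gPhi (-q) := by
  have hd : ∀ u, HasDerivAt (fun u => Real.exp (u ^ 2 / 2) * (gPhi (-u - x) - gPhi (-u)))
      (Real.exp (u ^ 2 / 2) * (u * (gPhi (-u - x) - gPhi (-u)) - gphi (-u - x) + gphi (-u))) u := by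
    intro u
    have h1 : HasDerivAt (fun u : ℝ => u ^ 2 / 2) u u := by
      exact ((hasDerivAt_pow 2 u).div_const 2).congr_deriv (by push_cast; ring)
    have h2 : HasDerivAt (fun u => gPhi (-u - x)) (gphi (-u - x) * (-1)) u :=
      HasDerivAt.comp (h₂ := gPhi) u (gPhi_hasDerivAt (-u - x)) ((hasDerivAt_neg u).sub_const x)
    have h3 : HasDerivAt (fun u => gPhi (-u)) (gphi (-u) * (-1)) u :=
      HasDerivAt.comp (h₂ := gPhi) u (gPhi_hasDerivAt (-u)) (hasDerivAt_neg u)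
    have := h1.exp.mul (h2.sub h3)
    exact this.congr_deriv (by simp only [Pi.sub_apply]; ring)
  have hm : Monotone (fun u => Real.exp (u ^ 2 / 2) * (gPhi (-u - x) - gPhi (-u))) := by
    apply monotone_of_hasDerivAt_nonneg hd
    intro u
    have := gphi_tangent (-u - x) (-u)
    apply mul_nonneg (Real.exp_pos _).le
    nlinarith
  have := hm hq
  simp only [neg_zero, zero_sub, gPhi_zero] at this
  norm_num at this
  rw [show -q ^ 2 / 2 = -(q ^ 2 / 2) by ring, Real.exp_neg]
  rw [inv_mul_le_iff₀ (Real.exp_pos _)]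
  linarith

/-- increments of gPhi -/
lemma gPhi_incr {a b m : ℝ} (hab : a ≤ b) (ha : -m ≤ a) (hb : b ≤ m) :
    gphi m * (b - a) ≤ gPhi b - gPhi a := by
  have h := (convex_Icc a b).mul_sub_le_image_sub_of_le_deriv (f := gPhi) (C := gphi m)
    gPhi_cont.continuousOn (fun u _ => (gPhi_hasDerivAt u).differentiableAt.differentiableWithinAt)
    (fun u hu => by
      rw [(gPhi_hasDerivAt u).deriv]
      rw [interior_Icc] at hu
      apply gphi_le
      have : |u| ≤ |m| := by
        rw [abs_of_nonneg (by linarith : (0:ℝ) ≤ m), abs_le]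
        exact ⟨by linarith [hu.1], by linarith [hu.2]⟩
      exact sq_le_sq.2 this)
  exact h a (Set.left_mem_Icc.2 hab) b (Set.right_mem_Icc.2 hab) hab


/-! ## Part 2: Gil-Pelaez formula with Gaussian smoothing -/

lemma cexp_integrable (μ : Measure ℝ) [IsProbabilityMeasure μ] (t : ℝ) :
    Integrable (fun x : ℝ => Complex.exp (t * x * Complex.I)) μ := by
  refine Integrable.of_bound (C := 1) (by apply Measurable.aestronglyMeasurable; fun_prop) ?_
  filter_upwards with x
  have := Complex.norm_exp_ofReal_mul_I (t * x)
  push_cast at this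
  rw [this]

lemma charFun_re (μ : Measure ℝ) [IsProbabilityMeasure μ] (t : ℝ) :
    (charFun μ t).re = ∫ x, Real.cos (t * x) ∂μ := by
  rw [charFun_apply_real]
  have := integral_re (cexp_integrable μ t)
  simp only [RCLike.re_eq_complex_re] at this
  rw [← this]
  congr 1; ext x
  have := Complex.exp_ofReal_mul_I_re (t * x)
  push_cast at this
  rw [this]

lemma charFun_shift_im (μ : Measure ℝ) [IsProbabilityMeasure μ] (t m : ℝ) :
    (Complex.exp (-(t * m) * Complex.I) * charFun μ t).im = ∫ x, Real.sin (t * (x - m)) ∂μ := by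
  rw [charFun_apply_real, ← integral_const_mul]
  have := integral_im ((cexp_integrable μ t).const_mul (Complex.exp (-(t * m) * Complex.I)))
  simp only [RCLike.im_eq_complex_im] at this
  rw [← this]
  congr 1; ext x
  have := Complex.exp_ofReal_mul_I_im (t * (x - m))
  push_cast at this
  rw [← this, ← Complex.exp_add]
  congr 2; ring

lemma gphi_cos (u : ℝ) : ∫ t in Set.Ioi (0 : ℝ), Real.cos (t * u) * gphi t
    = Real.exp (-u ^ 2 / 2) / 2 := by
  have h1 : ∫ t, Real.cos (t * u) * gphi t = Real.exp (-u ^ 2 / 2) := by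
    have hc := charFun_re (gaussianReal 0 1) u
    rw [charFun_gaussianReal, integral_gaussianReal_eq_integral_smul one_ne_zero] at hc
    have e : ∀ t, Real.cos (t * u) * gphi t = gaussianPDFReal 0 1 t • Real.cos (u * t) := by
      intro t; rw [gphi_eq_pdf, smul_eq_mul, mul_comm u t, mul_comm]
    simp_rw [e]
    rw [← hc]
    have : ((u : ℂ) * (0 : ℝ) * Complex.I - ((1 : NNReal) : ℝ) * (u : ℂ) ^ 2 / 2) = ((-u ^ 2 / 2 : ℝ) : ℂ) := by
      push_cast; simp; ring
    rw [this, Complex.exp_ofReal_re]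
  have h2 := integral_comp_abs (f := fun t => Real.cos (t * u) * gphi t)
  have h3 : ∀ t : ℝ, Real.cos (|t| * u) * gphi |t| = Real.cos (t * u) * gphi t := by
    intro t
    rcases abs_choice t with h | h <;> rw [h]
    rw [gphi_neg, neg_mul, Real.cos_neg]
  simp_rw [h3] at h2
  linarith

lemma abs_sin_div_le (t y : ℝ) : |Real.sin (t * y) / t| ≤ |y| := by
  rcases eq_or_ne t 0 with h | h
  · simp [h]
  · rw [abs_div, div_le_iff₀ (abs_pos.2 h), ← abs_mul, mul_comm y t]
    exact Real.abs_sin_le_abs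

lemma exp_sq_integrable {w : ℝ} (hw : 0 < w) :
    Integrable (fun t : ℝ => Real.exp (-(w ^ 2 * t ^ 2) / 2)) := by
  have := integrable_exp_neg_mul_sq (b := w ^ 2 / 2) (by positivity)
  refine this.congr (Filter.Eventually.of_forall fun t => ?_)
  simp only; congr 1; ring

lemma sin_div_integrable {w : ℝ} (hw : 0 < w) (y : ℝ) :
    Integrable (fun t : ℝ => Real.sin (t * y) / t * Real.exp (-(w ^ 2 * t ^ 2) / 2)) := by
  refine ((exp_sq_integrable hw).const_mul |y|).mono' (by fun_prop) ?_
  filter_upwards with t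
  rw [Real.norm_eq_abs, abs_mul, Real.abs_exp]
  exact mul_le_mul_of_nonneg_right (abs_sin_div_le t y) (Real.exp_pos _).le

lemma gPhi_fourier_one (y : ℝ) : gPhi y = 1 / 2 + Real.pi⁻¹ *
    ∫ t in Set.Ioi (0 : ℝ), Real.sin (t * y) / t * Real.exp (-(1 ^ 2 * t ^ 2) / 2) := by
  set D : ℝ → ℝ := fun y => ∫ t in Set.Ioi (0 : ℝ), Real.sin (t * y) / t * Real.exp (-(1 ^ 2 * t ^ 2) / 2)
    with hD
  have hder : ∀ y, HasDerivAt D (Real.pi * gphi y) y := by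
    intro y
    have := (hasDerivAt_integral_of_dominated_loc_of_deriv_le (μ := volume.restrict (Set.Ioi (0:ℝ)))
      (F := fun y t => Real.sin (t * y) / t * Real.exp (-(1 ^ 2 * t ^ 2) / 2))
      (F' := fun y t => Real.cos (t * y) * Real.exp (-(1 ^ 2 * t ^ 2) / 2))
      (bound := fun t => Real.exp (-(1 ^ 2 * t ^ 2) / 2)) (x₀ := y) (s := Set.univ) Filter.univ_mem
      (Filter.Eventually.of_forall fun z => (sin_div_integrable one_pos z).aestronglyMeasurable.restrict)
      (sin_div_integrable one_pos y).integrableOn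
      (by apply Continuous.aestronglyMeasurable; fun_prop)
      (by
        filter_upwards with t z _
        rw [Real.norm_eq_abs, abs_mul, Real.abs_exp]
        exact mul_le_of_le_one_left (Real.exp_pos _).le (Real.abs_cos_le_one _))
      (exp_sq_integrable one_pos).integrableOn
      (by
        filter_upwards [ae_restrict_mem measurableSet_Ioi] with t ht z _
        have ht' : t ≠ 0 := ne_of_gt ht
        have h1 : HasDerivAt (fun z : ℝ => t * z) t z := by
          simpa using (hasDerivAt_id z).const_mul t
        have := ((h1.sin).div_const t).mul_const (Real.exp (-(1 ^ 2 * t ^ 2) / 2))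
        exact this.congr_deriv (by field_simp))).2
    refine this.congr_deriv ?_
    have h2 := gphi_cos y
    have e : ∀ t, Real.cos (t * y) * Real.exp (-(1 ^ 2 * t ^ 2) / 2) = √(2 * Real.pi) * (Real.cos (t * y) * gphi t) := by
      intro t; unfold gphi
      have : √(2 * Real.pi) ≠ 0 := by positivity
      field_simp
    simp_rw [e, integral_const_mul, h2]
    unfold gphi
    have h3 : √(2 * Real.pi) * √(2 * Real.pi) = 2 * Real.pi := Real.mul_self_sqrt (by positivity)
    have : √(2 * Real.pi) ≠ 0 := by positivity
    field_simp
    rw [pow_two, h3]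
  have hdd : ∀ y, HasDerivAt (fun y => gPhi y - Real.pi⁻¹ * D y) 0 y := fun y =>
    ((gPhi_hasDerivAt y).sub ((hder y).const_mul _)).congr_deriv (by field_simp; simp)
  have hc := is_const_of_deriv_eq_zero (f := fun y => gPhi y - Real.pi⁻¹ * D y)
    (fun y => (hdd y).differentiableAt) (fun y => (hdd y).deriv) y 0
  simp only [gPhi_zero] at hc
  have hD0 : D 0 = 0 := by simp [hD]
  rw [hD0] at hc
  change gPhi y = 1 / 2 + Real.pi⁻¹ * D y
  linarith

lemma gPhi_fourier {w : ℝ} (hw : 0 < w) (y : ℝ) : gPhi (y / w) = 1 / 2 + Real.pi⁻¹ *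
    ∫ t in Set.Ioi (0 : ℝ), Real.sin (t * y) / t * Real.exp (-(w ^ 2 * t ^ 2) / 2) := by
  rw [gPhi_fourier_one]
  congr 2
  have := integral_comp_mul_left_Ioi
    (fun t => Real.sin (t * (y / w)) / t * Real.exp (-(1 ^ 2 * t ^ 2) / 2)) 0 hw
  rw [mul_zero, smul_eq_mul, eq_comm, inv_mul_eq_iff_eq_mul₀ hw.ne'] at this
  rw [this, ← integral_const_mul]
  refine setIntegral_congr_fun measurableSet_Ioi fun t ht => ?_
  have ht' : t ≠ 0 := ne_of_gt ht
  rw [show w * t * (y / w) = t * y by field_simp]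
  rw [show -(1 ^ 2 * (w * t) ^ 2) / 2 = -(w ^ 2 * t ^ 2) / 2 by ring]
  field_simp

/-- smoothed distribution function -/
noncomputable def sF (μ : Measure ℝ) (w m : ℝ) : ℝ := ∫ x, gPhi ((m - x) / w) ∂μ

noncomputable def gpH (μ : Measure ℝ) (w m t : ℝ) : ℝ :=
  (Complex.exp (-(t * m) * Complex.I) * charFun μ t).im / t * Real.exp (-(w ^ 2 * t ^ 2) / 2)

lemma gp_prod_integrable (μ : Measure ℝ) [IsProbabilityMeasure μ] (hμ : Integrable (fun x => x) μ)
    {w : ℝ} (hw : 0 < w) (m : ℝ) : Integrable (Function.uncurry fun (t x : ℝ) =>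
      Real.sin (t * (x - m)) / t * Real.exp (-(w ^ 2 * t ^ 2) / 2))
      ((volume.restrict (Set.Ioi (0:ℝ))).prod μ) := by
  have h1 : Integrable (fun z : ℝ × ℝ => Real.exp (-(w ^ 2 * z.1 ^ 2) / 2) * |z.2 - m|)
      ((volume.restrict (Set.Ioi (0:ℝ))).prod μ) :=
    ((exp_sq_integrable hw).integrableOn (s := Set.Ioi 0)).mul_prod
      (f := fun t => Real.exp (-(w ^ 2 * t ^ 2) / 2)) (g := fun x => |x - m|)
      ((hμ.sub (integrable_const m)).abs)
  refine h1.mono' (by apply Measurable.aestronglyMeasurable; unfold Function.uncurry; fun_prop) ?_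
  filter_upwards with z
  simp only [Function.uncurry]
  rw [Real.norm_eq_abs, abs_mul, Real.abs_exp, mul_comm]
  exact mul_le_mul_of_nonneg_left (abs_sin_div_le _ _) (Real.exp_pos _).le

lemma gpH_eq (μ : Measure ℝ) [IsProbabilityMeasure μ] (w m t : ℝ) :
    gpH μ w m t = ∫ x, Real.sin (t * (x - m)) / t * Real.exp (-(w ^ 2 * t ^ 2) / 2) ∂μ := by
  unfold gpH
  rw [charFun_shift_im, integral_mul_const, integral_div]

lemma gpH_integrable (μ : Measure ℝ) [IsProbabilityMeasure μ] (hμ : Integrable (fun x => x) μ)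
    {w : ℝ} (hw : 0 < w) (m : ℝ) : IntegrableOn (gpH μ w m) (Set.Ioi 0) := by
  have := (gp_prod_integrable μ hμ hw m).integral_prod_left
  refine this.congr (Filter.Eventually.of_forall fun t => ?_)
  rw [gpH_eq]; rfl

lemma gil_pelaez (μ : Measure ℝ) [IsProbabilityMeasure μ] (hμ : Integrable (fun x => x) μ)
    {w : ℝ} (hw : 0 < w) (m : ℝ) :
    sF μ w m = 1 / 2 - Real.pi⁻¹ * ∫ t in Set.Ioi (0 : ℝ), gpH μ w m t := by
  simp_rw [gpH_eq]
  rw [integral_integral_swap (gp_prod_integrable μ hμ hw m)]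
  unfold sF
  have e : ∀ x, gPhi ((m - x) / w) = 1 / 2 - Real.pi⁻¹ * ∫ t in Set.Ioi (0 : ℝ),
      Real.sin (t * (x - m)) / t * Real.exp (-(w ^ 2 * t ^ 2) / 2) := by
    intro x
    rw [gPhi_fourier hw, sub_eq_add_neg (1/2 : ℝ), ← mul_neg, ← integral_neg]
    congr 3; ext t
    rw [show t * (x - m) = -(t * (m - x)) by ring, Real.sin_neg]; ring
  simp_rw [e]
  have hi := (gp_prod_integrable μ hμ hw m).integral_prod_right
  rw [integral_sub (integrable_const _), integral_const, integral_const_mul]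
  · simp
  · exact hi.const_mul _

lemma sF_integrable (μ : Measure ℝ) [IsProbabilityMeasure μ] (w m : ℝ) :
    Integrable (fun x => gPhi ((m - x) / w)) μ := by
  refine Integrable.of_bound (C := 1) (Continuous.aestronglyMeasurable ?_) ?_
  · exact gPhi_cont.comp (by fun_prop)
  · filter_upwards with x
    rw [Real.norm_eq_abs, abs_of_nonneg (gPhi_nonneg _)]
    exact gPhi_le_one _

/-- from smoothed to unsmoothed -/
lemma sF_le (μ : Measure ℝ) [IsProbabilityMeasure μ] {w h : ℝ} (hw : 0 < w) (m : ℝ) :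
    sF μ w (m - h) ≤ μ.real (Set.Iic m) + gPhi (-(h / w)) := by
  unfold sF
  have : ∀ x, gPhi ((m - h - x) / w) ≤ (Set.Iic m).indicator 1 x + gPhi (-(h / w)) := by
    intro x
    by_cases hx : x ≤ m
    · rw [Set.indicator_of_mem (Set.mem_Iic.2 hx)]
      have := gPhi_le_one ((m - h - x) / w)
      have := gPhi_nonneg (-(h / w))
      simp only [Pi.one_apply]; linarith
    · rw [Set.indicator_of_notMem (by simpa using hx), zero_add]
      apply gPhi_mono
      rw [← neg_div]
      gcongr
      linarith
  calc _ ≤ ∫ x, ((Set.Iic m).indicator (1 : ℝ → ℝ) x + gPhi (-(h / w))) ∂μ :=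
        integral_mono (sF_integrable μ w _)
          (((integrable_const 1).indicator measurableSet_Iic).add (integrable_const _)) this
    _ = _ := by
        rw [integral_add ((integrable_const 1).indicator measurableSet_Iic) (integrable_const _),
          integral_indicator_one measurableSet_Iic]
        simp

lemma le_sF (μ : Measure ℝ) [IsProbabilityMeasure μ] {w h : ℝ} (hw : 0 < w) (m : ℝ) :
    μ.real (Set.Iic m) ≤ sF μ w (m + h) + gPhi (-(h / w)) := by
  unfold sF
  have : ∀ x, (Set.Iic m).indicator 1 x - gPhi (-(h / w)) ≤ gPhi ((m + h - x) / w) := by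
    intro x
    by_cases hx : x ≤ m
    · rw [Set.indicator_of_mem (Set.mem_Iic.2 hx)]
      rw [gPhi_neg]
      have : gPhi (h / w) ≤ gPhi ((m + h - x) / w) := by
        apply gPhi_mono; gcongr; linarith
      simp only [Pi.one_apply]; linarith
    · rw [Set.indicator_of_notMem (by simpa using hx)]
      have := gPhi_nonneg ((m + h - x) / w)
      have := gPhi_nonneg (-(h / w))
      linarith
  have h2 : ∫ x, ((Set.Iic m).indicator (1 : ℝ → ℝ) x - gPhi (-(h / w))) ∂μ ≤ _ :=
        integral_mono (((integrable_const 1).indicator measurableSet_Iic).sub (integrable_const _))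
          (sF_integrable μ w (m + h)) this
  rw [integral_sub ((integrable_const 1).indicator measurableSet_Iic) (integrable_const _),
          integral_indicator_one measurableSet_Iic] at h2
  simp at h2 ⊢
  linarith

/-- lower tails from the median -/
lemma sF_tail (μ : Measure ℝ) [IsProbabilityMeasure μ] {w q : ℝ} (hw : 0 < w) (hq : 0 ≤ q)
    (hmed : 1 / 2 ≤ sF μ w 0) : gPhi (-q) ≤ sF μ w (-q * w) := by
  have h : ∀ x, Real.exp (-q ^ 2 / 2) * (gPhi ((0 - x) / w) - 1 / 2) + gPhi (-q)
      ≤ gPhi ((-q * w - x) / w) := by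
    intro x
    have := gPhi_shift hq (x / w)
    rw [show (-q * w - x) / w = -q - x / w by field_simp, zero_sub, neg_div w x]
    linarith
  have hi : Integrable (fun x => Real.exp (-q ^ 2 / 2) * (gPhi ((0 - x) / w) - 1 / 2)) μ :=
    ((sF_integrable μ w 0).sub (integrable_const (1/2))).const_mul (Real.exp (-q ^ 2 / 2))
  have h2 := integral_mono (hi.add (integrable_const (gPhi (-q)))) (sF_integrable μ w (-q * w)) h
  simp only [Pi.add_apply] at h2
  rw [integral_add hi (integrable_const _),
    integral_const_mul, integral_sub (sF_integrable μ w 0) (integrable_const _)] at h2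
  change _ ≤ sF μ w (-q * w) at h2
  change _ * (sF μ w 0 - _) + _ ≤ _ at h2
  simp only [integral_const, probReal_univ, one_smul] at h2
  have : 0 ≤ Real.exp (-q ^ 2 / 2) * (sF μ w 0 - 1 / 2) :=
    mul_nonneg (Real.exp_pos _).le (by linarith)
  linarith

lemma sF_mono (μ : Measure ℝ) [IsProbabilityMeasure μ] {w : ℝ} (hw : 0 < w) : Monotone (sF μ w) := by
  intro a b hab
  refine integral_mono (sF_integrable μ w a) (sF_integrable μ w b) fun x => ?_
  apply gPhi_mono; gcongr


/-! ## Part 3: weighted sums of centred exponentials, via characteristic functions -/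

noncomputable def ephi (u : ℝ) : ℂ := Complex.exp (-(u * Complex.I)) / (1 - u * Complex.I)

structure IsExpSum {ι : Type*} (s : Finset ι) (a : ι → ℝ) (μ : Measure ℝ) : Prop where
  prob : IsProbabilityMeasure μ
  int : Integrable (fun x => x) μ
  cf : ∀ t, charFun μ t = ∏ i ∈ s, ephi (a i * t)

lemma norm_one_sub (u : ℝ) : ‖(1 : ℂ) - u * Complex.I‖ = √(1 + u ^ 2) := by
  rw [Complex.norm_eq_sqrt_sq_add_sq]; simp

lemma one_sub_ne (u : ℝ) : (1 : ℂ) - u * Complex.I ≠ 0 := by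
  rw [← norm_ne_zero_iff, norm_one_sub]; positivity

lemma norm_ephi (u : ℝ) : ‖ephi u‖ = (√(1 + u ^ 2))⁻¹ := by
  unfold ephi
  rw [norm_div, norm_one_sub, ← neg_mul]
  have := Complex.norm_exp_ofReal_mul_I (-u)
  push_cast at this
  rw [this, one_div]

lemma norm_ephi_le (u : ℝ) : ‖ephi u‖ ≤ 1 := by
  rw [norm_ephi]
  apply inv_le_one_of_one_le₀
  rw [Real.one_le_sqrt]; nlinarith [sq_nonneg u]

lemma ephi_sub_le (u : ℝ) : ‖ephi u - (Real.exp (-u ^ 2 / 2) : ℝ)‖ ≤ 3 * |u| ^ 3 := by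
  rcases le_total |u| 1 with hu | hu
  · have h1 : ‖Complex.exp (-(u * Complex.I)) - (1 - u * Complex.I - u ^ 2 / 2)‖ ≤ |u| ^ 3 := by
      have hn : ‖(-((u:ℂ) * Complex.I))‖ = |u| := by simp
      have := Complex.exp_bound (x := -(u * Complex.I)) (by rw [hn]; exact hu) (n := 3) (by norm_num)
      rw [hn] at this
      have e : ∑ m ∈ Finset.range 3, (-((u:ℂ) * Complex.I)) ^ m / (m.factorial : ℂ)
          = 1 - u * Complex.I - u ^ 2 / 2 := by
        simp [Finset.sum_range_succ, Nat.factorial, mul_pow]; ring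
      rw [e] at this
      refine this.trans ?_
      norm_num [Nat.factorial]
      have : 0 ≤ |u| ^ 3 := by positivity
      nlinarith
    have h2 : |Real.exp (-u ^ 2 / 2) - (1 - u ^ 2 / 2)| ≤ |u| ^ 3 := by
      have hx : |(-u ^ 2 / 2)| ≤ 1 := by
        rw [abs_div, abs_neg, abs_pow]; norm_num
        nlinarith [abs_nonneg u, sq_abs u]
      have := Real.abs_exp_sub_one_sub_id_le hx
      rw [show Real.exp (-u ^ 2 / 2) - (1 - u ^ 2 / 2) = Real.exp (-u ^ 2 / 2) - 1 - (-u ^ 2 / 2) by ring]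
      refine this.trans ?_
      rw [← sq_abs u] 
      have h0 := abs_nonneg u
      have : |u| ^ 4 ≤ |u| ^ 3 := pow_le_pow_of_le_one h0 hu (by norm_num)
      nlinarith [pow_nonneg h0 3]
    have h3 : ephi u - (Real.exp (-u ^ 2 / 2) : ℝ) =
        ((Complex.exp (-(u * Complex.I)) - (1 - u * Complex.I - u ^ 2 / 2))
          - (1 - u * Complex.I) * ((Real.exp (-u ^ 2 / 2) - (1 - u ^ 2 / 2) : ℝ) : ℂ)
          - u ^ 3 / 2 * Complex.I) / (1 - u * Complex.I) := by
      unfold ephi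
      have := one_sub_ne u
      field_simp
      push_cast
      ring
    have hN : 1 ≤ ‖(1 : ℂ) - u * Complex.I‖ := by
      rw [norm_one_sub, Real.one_le_sqrt]; nlinarith [sq_nonneg u]
    rw [h3, norm_div, div_le_iff₀ (by linarith)]
    have h4 : ‖((1 : ℂ) - u * Complex.I) * ((Real.exp (-u ^ 2 / 2) - (1 - u ^ 2 / 2) : ℝ) : ℂ)‖
        ≤ ‖(1 : ℂ) - u * Complex.I‖ * |u| ^ 3 := by
      rw [norm_mul, Complex.norm_real, Real.norm_eq_abs]
      gcongr
    have h5 : ‖(u : ℂ) ^ 3 / 2 * Complex.I‖ ≤ |u| ^ 3 := by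
      simp only [norm_mul, norm_div, norm_pow, Complex.norm_real, Real.norm_eq_abs, Complex.norm_I]
      norm_num
    have hp : 0 ≤ |u| ^ 3 := by positivity
    calc _ ≤ |u| ^ 3 + ‖(1 : ℂ) - u * Complex.I‖ * |u| ^ 3 + |u| ^ 3 :=
          (norm_sub_le _ _).trans (add_le_add ((norm_sub_le _ _).trans (add_le_add h1 h4)) h5)
      _ ≤ _ := by nlinarith
  · have h1 : ‖ephi u - (Real.exp (-u ^ 2 / 2) : ℝ)‖ ≤ 1 + 1 := by
      refine (norm_sub_le _ _).trans (add_le_add (norm_ephi_le u) ?_)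
      rw [Complex.norm_real, Real.norm_eq_abs, Real.abs_exp]
      apply Real.exp_le_one_iff.2
      nlinarith [sq_nonneg u]
    have : 1 ≤ |u| ^ 3 := one_le_pow₀ hu
    linarith

lemma norm_prod_sub_le {ι : Type*} (s : Finset ι) (f g : ι → ℂ) (hf : ∀ i ∈ s, ‖f i‖ ≤ 1)
    (hg : ∀ i ∈ s, ‖g i‖ ≤ 1) :
    ‖∏ i ∈ s, f i - ∏ i ∈ s, g i‖ ≤ ∑ i ∈ s, ‖f i - g i‖ := by
  classical
  induction s using Finset.induction_on with
  | empty => simp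
  | insert i s hi ih =>
    rw [Finset.prod_insert hi, Finset.prod_insert hi, Finset.sum_insert hi]
    have e : f i * ∏ j ∈ s, f j - g i * ∏ j ∈ s, g j =
      (f i - g i) * ∏ j ∈ s, f j + g i * (∏ j ∈ s, f j - ∏ j ∈ s, g j) := by ring
    rw [e]
    have hP : ‖∏ j ∈ s, f j‖ ≤ 1 := by
      rw [norm_prod]
      exact Finset.prod_le_one (fun _ _ => norm_nonneg _) fun j hj => hf j (Finset.mem_insert_of_mem hj)
    have ih' := ih (fun j hj => hf j (Finset.mem_insert_of_mem hj))
      (fun j hj => hg j (Finset.mem_insert_of_mem hj))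
    refine (norm_add_le _ _).trans (add_le_add ?_ ?_)
    · rw [norm_mul]; exact mul_le_of_le_one_right (norm_nonneg _) hP
    · rw [norm_mul]
      exact (mul_le_of_le_one_left (norm_nonneg _) (hg i (Finset.mem_insert_self i s))).trans ih'

lemma integral_sq_gauss {w : ℝ} (hw : 0 < w) :
    IntegrableOn (fun t : ℝ => t ^ 2 * Real.exp (-(w ^ 2 * t ^ 2) / 2)) (Set.Ioi 0) ∧
    ∫ t in Set.Ioi (0:ℝ), t ^ 2 * Real.exp (-(w ^ 2 * t ^ 2) / 2) ≤ 8 / w ^ 3 := by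
  have hb : ∀ t : ℝ, t ^ 2 * Real.exp (-(w ^ 2 * t ^ 2) / 2) ≤
      4 / w ^ 2 * Real.exp (-(w ^ 2 / 4) * t ^ 2) := by
    intro t
    have h1 : w ^ 2 * t ^ 2 / 4 ≤ Real.exp (w ^ 2 * t ^ 2 / 4) :=
      (by linarith [Real.add_one_le_exp (w ^ 2 * t ^ 2 / 4)])
    have h2 : Real.exp (-(w ^ 2 * t ^ 2) / 2) = Real.exp (-(w ^ 2 / 4) * t ^ 2) *
        (Real.exp (w ^ 2 * t ^ 2 / 4))⁻¹ := by
      rw [← Real.exp_neg, ← Real.exp_add]; congr 1; ring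
    rw [h2]
    have h3 := Real.exp_pos (w ^ 2 * t ^ 2 / 4)
    have h4 : t ^ 2 * (Real.exp (w ^ 2 * t ^ 2 / 4))⁻¹ ≤ 4 / w ^ 2 := by
      rw [mul_inv_le_iff₀ h3, div_mul_eq_mul_div, le_div_iff₀ (by positivity)]
      linarith
    calc _ = (t ^ 2 * (Real.exp (w ^ 2 * t ^ 2 / 4))⁻¹) * Real.exp (-(w ^ 2 / 4) * t ^ 2) := by ring
      _ ≤ _ := by gcongr
  have hi : Integrable (fun t : ℝ => 4 / w ^ 2 * Real.exp (-(w ^ 2 / 4) * t ^ 2)) :=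
    (integrable_exp_neg_mul_sq (by positivity)).const_mul _
  have hintg : Integrable (fun t : ℝ => t ^ 2 * Real.exp (-(w ^ 2 * t ^ 2) / 2)) := by
    refine hi.mono' (by fun_prop) (Filter.Eventually.of_forall fun t => ?_)
    rw [Real.norm_eq_abs, abs_of_nonneg (by positivity)]
    exact hb t
  refine ⟨hintg.integrableOn, ?_⟩
  calc _ ≤ ∫ t in Set.Ioi (0:ℝ), 4 / w ^ 2 * Real.exp (-(w ^ 2 / 4) * t ^ 2) :=
        integral_mono hintg.integrableOn hi.integrableOn hb
    _ = 4 / w ^ 2 * (√(Real.pi / (w ^ 2 / 4)) / 2) := by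
        rw [integral_const_mul, integral_gaussian_Ioi]
    _ ≤ _ := by
        have : √(Real.pi / (w ^ 2 / 4)) ≤ 4 / w := by
          rw [Real.sqrt_le_left (by positivity)]
          have := Real.pi_le_four
          rw [div_pow, div_le_div_iff₀ (by positivity) (by positivity)]
          nlinarith [sq_nonneg w]
        calc _ ≤ 4 / w ^ 2 * (4 / w / 2) := by gcongr
          _ = _ := by field_simp; norm_num

/-- Gaussian replacement of the small summands -/
lemma sF_compare {ι : Type*} [DecidableEq ι] {s b : Finset ι} (hb : b ⊆ s) {a : ι → ℝ}
    {μ μb : Measure ℝ} (hμ : IsExpSum s a μ) (hμb : IsExpSum b a μb) {w : ℝ} (hw : 0 < w) (m : ℝ) :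
    |sF μ w m - sF μb (√(w ^ 2 + ∑ i ∈ s \ b, a i ^ 2)) m| ≤ 24 * (∑ i ∈ s \ b, |a i| ^ 3) / w ^ 3 := by
  have := hμ.prob
  have := hμb.prob
  set V := ∑ i ∈ s \ b, a i ^ 2 with hV
  set T := ∑ i ∈ s \ b, |a i| ^ 3 with hT
  have hV0 : 0 ≤ V := Finset.sum_nonneg fun i _ => sq_nonneg _
  have hT0 : 0 ≤ T := Finset.sum_nonneg fun i _ => by positivity
  have hw2 : 0 < √(w ^ 2 + V) := Real.sqrt_pos.2 (by positivity)
  rw [gil_pelaez μ hμ.int hw, gil_pelaez μb hμb.int hw2]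
  have hpt : ∀ t ∈ Set.Ioi (0:ℝ), |gpH μb (√(w ^ 2 + V)) m t - gpH μ w m t| ≤
      (3 * T) * (t ^ 2 * Real.exp (-(w ^ 2 * t ^ 2) / 2)) := by
    intro t ht
    have ht : 0 < t := ht
    have hcf : ‖charFun μ t - charFun μb t * (Real.exp (-(V * t ^ 2) / 2) : ℝ)‖ ≤ 3 * T * t ^ 3 := by
      rw [hμ.cf, hμb.cf, ← Finset.prod_sdiff hb, mul_comm, ← mul_sub, norm_mul]
      have h1 : ‖∏ i ∈ b, ephi (a i * t)‖ ≤ 1 := by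
        rw [norm_prod]
        exact Finset.prod_le_one (fun _ _ => norm_nonneg _) fun j hj => norm_ephi_le _
      have h2 : ((Real.exp (-(V * t ^ 2) / 2) : ℝ) : ℂ) =
          ∏ i ∈ s \ b, ((Real.exp (-(a i * t) ^ 2 / 2) : ℝ) : ℂ) := by
        rw [← Complex.ofReal_prod, ← Real.exp_sum]
        congr 2
        rw [hV, Finset.sum_mul, ← Finset.sum_neg_distrib, Finset.sum_div]
        exact Finset.sum_congr rfl fun i _ => by ring
      rw [h2]
      refine (mul_le_of_le_one_left (norm_nonneg _) h1).trans ?_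
      refine (norm_prod_sub_le _ _ _ (fun i _ => norm_ephi_le _) fun i _ => ?_).trans ?_
      · rw [Complex.norm_real, Real.norm_eq_abs, Real.abs_exp]
        apply Real.exp_le_one_iff.2
        nlinarith [sq_nonneg (a i * t)]
      · rw [hT, Finset.mul_sum, Finset.sum_mul]
        refine Finset.sum_le_sum fun i _ => (ephi_sub_le _).trans (le_of_eq ?_)
        rw [abs_mul, abs_of_pos ht]; ring
    have e1 : gpH μb (√(w ^ 2 + V)) m t - gpH μ w m t =
        -((Complex.exp (-(t * m) * Complex.I) *
          (charFun μ t - charFun μb t * (Real.exp (-(V * t ^ 2) / 2) : ℝ))).im / t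
          * Real.exp (-(w ^ 2 * t ^ 2) / 2)) := by
      unfold gpH
      rw [Real.sq_sqrt (by positivity), mul_sub, Complex.sub_im, ← mul_assoc, Complex.im_mul_ofReal]
      rw [show -((w ^ 2 + V) * t ^ 2) / 2 = -(V * t ^ 2) / 2 + -(w ^ 2 * t ^ 2) / 2 by ring,
        Real.exp_add]
      ring
    rw [e1, abs_neg, abs_mul, Real.abs_exp, abs_div, abs_of_pos ht, ← mul_assoc]
    refine mul_le_mul_of_nonneg_right ?_ (Real.exp_pos _).le
    rw [div_le_iff₀ ht]
    refine (Complex.abs_im_le_norm _).trans ?_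
    rw [norm_mul]
    have := Complex.norm_exp_ofReal_mul_I (-(t * m))
    push_cast at this
    rw [this, one_mul]
    exact hcf.trans (le_of_eq (by ring))
  have hI := integral_sq_gauss hw
  have hi1 := gpH_integrable μ hμ.int hw m
  have hi2 := gpH_integrable μb hμb.int hw2 m
  have e2 : 1 / 2 - Real.pi⁻¹ * (∫ t in Set.Ioi (0 : ℝ), gpH μ w m t) -
      (1 / 2 - Real.pi⁻¹ * ∫ t in Set.Ioi (0 : ℝ), gpH μb (√(w ^ 2 + V)) m t) =
      Real.pi⁻¹ * ∫ t in Set.Ioi (0 : ℝ), (gpH μb (√(w ^ 2 + V)) m t - gpH μ w m t) := by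
    rw [integral_sub hi2 hi1]; ring
  rw [e2, abs_mul, abs_of_pos (by positivity)]
  have h3 : |∫ t in Set.Ioi (0 : ℝ), (gpH μb (√(w ^ 2 + V)) m t - gpH μ w m t)| ≤ 3 * T * (8 / w ^ 3) := by
    calc _ ≤ ∫ t in Set.Ioi (0 : ℝ), |gpH μb (√(w ^ 2 + V)) m t - gpH μ w m t| :=
          abs_integral_le_integral_abs
      _ ≤ ∫ t in Set.Ioi (0 : ℝ), (3 * T) * (t ^ 2 * Real.exp (-(w ^ 2 * t ^ 2) / 2)) :=
          setIntegral_mono_on (hi2.sub hi1).abs (hI.1.const_mul _) measurableSet_Ioi hpt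
      _ ≤ _ := by
          rw [integral_const_mul]
          exact mul_le_mul_of_nonneg_left hI.2 (by positivity)
  have h4 : Real.pi⁻¹ ≤ 1 := inv_le_one_of_one_le₀ (by linarith [Real.pi_gt_three])
  calc _ ≤ 1 * (3 * T * (8 / w ^ 3)) := mul_le_mul h4 h3 (abs_nonneg _) zero_le_one
    _ = _ := by ring


/-! ## Part 4: the median of a sum of centred exponentials is nonpositive -/

lemma ephi_polar (u : ℝ) : ephi u = (((√(1 + u ^ 2))⁻¹ : ℝ) : ℂ) *
    Complex.exp (((-(u - Real.arctan u) : ℝ) : ℂ) * Complex.I) := by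
  unfold ephi
  have h0 : (0:ℝ) < 1 + u ^ 2 := by positivity
  have h1 : Complex.exp (((-(u - Real.arctan u) : ℝ) : ℂ) * Complex.I) =
      Complex.exp (-(u * Complex.I)) * Complex.exp ((Real.arctan u : ℝ) * Complex.I) := by
    rw [← Complex.exp_add]; congr 1; push_cast; ring
  have h2 : Complex.exp ((Real.arctan u : ℝ) * Complex.I) =
      (((√(1 + u ^ 2))⁻¹ : ℝ) : ℂ) * (1 + u * Complex.I) := by
    rw [Complex.exp_mul_I, ← Complex.ofReal_cos, ← Complex.ofReal_sin, Real.cos_arctan,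
      Real.sin_arctan]
    push_cast; ring
  rw [h1, h2, div_eq_iff (one_sub_ne u)]
  have h3 : (((√(1 + u ^ 2))⁻¹ : ℝ) : ℂ) * (((√(1 + u ^ 2))⁻¹ : ℝ) : ℂ) * (1 + u ^ 2) = 1 := by
    have : (√(1 + u ^ 2))⁻¹ * (√(1 + u ^ 2))⁻¹ * (1 + u ^ 2) = 1 := by
      rw [← mul_inv, Real.mul_self_sqrt h0.le, inv_mul_cancel₀ h0.ne']
    exact_mod_cast congrArg (fun x : ℝ => (x : ℂ)) this
  have h4 : (1 + (u : ℂ) * Complex.I) * (1 - u * Complex.I) = 1 + u ^ 2 := by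
    ring_nf; rw [Complex.I_sq]; ring
  linear_combination (-Complex.exp (-(u * Complex.I))) * h3 -
    (Complex.exp (-(u * Complex.I)) * (((√(1 + u ^ 2))⁻¹ : ℝ) : ℂ) *
        (((√(1 + u ^ 2))⁻¹ : ℝ) : ℂ)) * h4

noncomputable def psiF {ι : Type*} (s : Finset ι) (a : ι → ℝ) (t : ℝ) : ℝ :=
  ∑ i ∈ s, (a i * t - Real.arctan (a i * t))

noncomputable def dpsiF {ι : Type*} (s : Finset ι) (a : ι → ℝ) (t : ℝ) : ℝ :=
  ∑ i ∈ s, a i * (1 - 1 / (1 + (a i * t) ^ 2))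

noncomputable def rhoF {ι : Type*} (s : Finset ι) (a : ι → ℝ) (t : ℝ) : ℝ :=
  ∏ i ∈ s, √(1 + (a i * t) ^ 2)

lemma prod_ephi_im {ι : Type*} (s : Finset ι) (a : ι → ℝ) (t : ℝ) :
    (∏ i ∈ s, ephi (a i * t)).im = -((rhoF s a t)⁻¹ * Real.sin (psiF s a t)) := by
  have : ∏ i ∈ s, ephi (a i * t) = (((rhoF s a t)⁻¹ : ℝ) : ℂ) *
      Complex.exp (((-psiF s a t : ℝ) : ℂ) * Complex.I) := by
    simp_rw [ephi_polar]
    rw [Finset.prod_mul_distrib, ← Complex.exp_sum, ← Finset.sum_mul, ← Complex.ofReal_prod,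
      ← Complex.ofReal_sum, Finset.sum_neg_distrib, Finset.prod_inv_distrib]
    rfl
  rw [this, Complex.im_ofReal_mul, Complex.exp_ofReal_mul_I_im, Real.sin_neg]; ring

lemma psiF_hasDerivAt {ι : Type*} (s : Finset ι) (a : ι → ℝ) (t : ℝ) :
    HasDerivAt (psiF s a) (dpsiF s a t) t := by
  unfold psiF dpsiF
  refine HasDerivAt.fun_sum fun i _ => ?_
  have h1 : HasDerivAt (fun t => a i * t) (a i) t := by
    simpa using (hasDerivAt_id t).const_mul (a i)
  exact (h1.sub h1.arctan).congr_deriv (by ring)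

lemma rhoF_one_le {ι : Type*} (s : Finset ι) (a : ι → ℝ) (t : ℝ) : 1 ≤ rhoF s a t := by
  unfold rhoF
  refine Finset.one_le_prod fun i _ => ?_
  rw [Real.one_le_sqrt]; nlinarith [sq_nonneg (a i * t)]

lemma dpsiF_term_nonneg (u : ℝ) : 0 ≤ 1 - 1 / (1 + u ^ 2) := by
  rw [sub_nonneg, div_le_one (by positivity)]; nlinarith [sq_nonneg u]

lemma dpsiF_nonneg {ι : Type*} {s : Finset ι} {a : ι → ℝ} (ha : ∀ i ∈ s, 0 ≤ a i) (t : ℝ) :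
    0 ≤ dpsiF s a t :=
  Finset.sum_nonneg fun i hi => mul_nonneg (ha i hi) (dpsiF_term_nonneg _)

lemma psiF_nonneg {ι : Type*} {s : Finset ι} {a : ι → ℝ} (ha : ∀ i ∈ s, 0 ≤ a i) {t : ℝ}
    (ht : 0 ≤ t) : 0 ≤ psiF s a t := by
  refine Finset.sum_nonneg fun i hi => ?_
  have h0 := mul_nonneg (ha i hi) ht
  rw [sub_nonneg]
  have := Real.le_tan (x := Real.arctan (a i * t)) (by simpa using h0) (Real.arctan_lt_pi_div_two _)
  rwa [Real.tan_arctan] at this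

lemma psiF_le {ι : Type*} {s : Finset ι} {a : ι → ℝ} (ha : ∀ i ∈ s, 0 ≤ a i) {t : ℝ}
    (ht : 0 ≤ t) : psiF s a t ≤ (∑ i ∈ s, a i) * t := by
  rw [Finset.sum_mul]
  refine Finset.sum_le_sum fun i hi => ?_
  have h0 := mul_nonneg (ha i hi) ht
  have : 0 ≤ Real.arctan (a i * t) := by simpa using h0
  linarith

lemma psiF_le_dpsiF {ι : Type*} {s : Finset ι} {a : ι → ℝ} (ha : ∀ i ∈ s, 0 ≤ a i) {t : ℝ}
    (ht : 0 ≤ t) : psiF s a t ≤ t * dpsiF s a t := by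
  unfold psiF dpsiF
  rw [Finset.mul_sum]
  refine Finset.sum_le_sum fun i hi => ?_
  have h0 := mul_nonneg (ha i hi) ht
  set u := a i * t with hu
  have h1 : 0 ≤ Real.arctan u := by simpa using h0
  have h2 : Real.sin (Real.arctan u) * Real.cos (Real.arctan u) = u / (1 + u ^ 2) := by
    rw [Real.sin_arctan, Real.cos_arctan, div_mul_div_comm, mul_one, Real.mul_self_sqrt (by positivity)]
  have h3 : u / (1 + u ^ 2) ≤ Real.arctan u := by
    rw [← h2]
    have h4 := Real.sin_le h1
    have h5 : 0 ≤ Real.sin (Real.arctan u) := by rw [Real.sin_arctan]; positivity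
    nlinarith [Real.cos_le_one (Real.arctan u)]
  have h6 : t * (a i * (1 - 1 / (1 + u ^ 2))) = u - u / (1 + u ^ 2) := by rw [hu]; ring
  rw [h6]; linarith

noncomputable def DF {ι : Type*} (s : Finset ι) (a : ι → ℝ) (w t : ℝ) : ℝ :=
  t * dpsiF s a t * Real.exp (w ^ 2 * t ^ 2 / 2) * rhoF s a t

lemma DF_diff {ι : Type*} (s : Finset ι) (a : ι → ℝ) (w : ℝ) : Differentiable ℝ (DF s a w) := by
  intro t
  unfold DF dpsiF rhoF
  have h1 : DifferentiableAt ℝ (fun t => ∏ i ∈ s, √(1 + (a i * t) ^ 2)) t := by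
    refine DifferentiableAt.fun_finsetProd fun i _ => ?_
    refine DifferentiableAt.sqrt (by fun_prop) (by positivity)
  have h2 : DifferentiableAt ℝ (fun t => ∑ i ∈ s, a i * (1 - 1 / (1 + (a i * t) ^ 2))) t := by
    refine DifferentiableAt.fun_sum fun i _ => ?_
    refine DifferentiableAt.const_mul (DifferentiableAt.sub (by fun_prop)
      (DifferentiableAt.div (by fun_prop) (by fun_prop) (by positivity))) _
  exact ((differentiableAt_id.mul h2).mul (by fun_prop)).mul h1

lemma DF_mono {ι : Type*} {s : Finset ι} {a : ι → ℝ} (ha : ∀ i ∈ s, 0 ≤ a i) (w : ℝ) :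
    MonotoneOn (DF s a w) (Set.Ioi 0) := by
  intro x hx y hy hxy
  have hx : 0 < x := hx
  have hy : 0 < y := hy
  have h1 : rhoF s a x ≤ rhoF s a y := by
    refine Finset.prod_le_prod (fun i _ => Real.sqrt_nonneg _) fun i hi => Real.sqrt_le_sqrt ?_
    have := ha i hi
    gcongr
  have h2 : dpsiF s a x ≤ dpsiF s a y := by
    refine Finset.sum_le_sum fun i hi => ?_
    have := ha i hi
    gcongr
  have h3 := dpsiF_nonneg ha x
  have h4 := rhoF_one_le s a x
  have h5 := dpsiF_nonneg ha y
  unfold DF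
  gcongr

lemma sF_median {ι : Type*} {s : Finset ι} {a : ι → ℝ} (ha : ∀ i ∈ s, 0 ≤ a i)
    {μ : Measure ℝ} (hμ : IsExpSum s a μ) {w : ℝ} (hw : 0 < w) : 1 / 2 ≤ sF μ w 0 := by
  have := hμ.prob
  rw [gil_pelaez μ hμ.int hw]
  have hg : ∀ t, gpH μ w 0 t = -((rhoF s a t)⁻¹ * Real.sin (psiF s a t) / t *
      Real.exp (-(w ^ 2 * t ^ 2) / 2)) := by
    intro t
    unfold gpH
    rw [hμ.cf, Complex.ofReal_zero, mul_zero, neg_zero, zero_mul, Complex.exp_zero, one_mul,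
      prod_ephi_im]
    ring
  have hgi := gpH_integrable μ hμ.int hw 0
  suffices h : ∫ t in Set.Ioi (0 : ℝ), gpH μ w 0 t ≤ 0 by
    have : Real.pi⁻¹ * ∫ t in Set.Ioi (0 : ℝ), gpH μ w 0 t ≤ 0 :=
      mul_nonpos_of_nonneg_of_nonpos (by positivity) h
    linarith
  by_cases hall : ∀ i ∈ s, a i = 0
  · refine (setIntegral_nonpos measurableSet_Ioi fun t _ => ?_)
    rw [hg]
    have : psiF s a t = 0 := Finset.sum_eq_zero fun i hi => by simp [hall i hi]
    simp [this]
  push Not at hall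
  obtain ⟨i0, hi0, hi0'⟩ := hall
  have hdpos : ∀ t, 0 < t → 0 < dpsiF s a t := by
    intro t ht
    refine Finset.sum_pos' (fun i hi => mul_nonneg (ha i hi) (dpsiF_term_nonneg _)) ⟨i0, hi0, ?_⟩
    have h1 : 0 < a i0 := lt_of_le_of_ne (ha i0 hi0) (Ne.symm hi0')
    refine mul_pos h1 ?_
    rw [sub_pos, div_lt_one (by positivity)]
    have : 0 < (a i0 * t) ^ 2 := by positivity
    linarith
  have hDpos : ∀ t, 0 < t → 0 < DF s a w t := by
    intro t ht
    have := hdpos t ht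
    have := rhoF_one_le s a t
    unfold DF; positivity
  set D := DF s a w with hD
  set J : ℝ → ℝ := fun t => (1 - Real.cos (psiF s a t)) / D t with hJ
  have hJd : ∀ t, 0 < t → HasDerivAt J ((Real.sin (psiF s a t) * dpsiF s a t * D t -
      (1 - Real.cos (psiF s a t)) * deriv D t) / (D t) ^ 2) t := by
    intro t ht
    have h1 : HasDerivAt (fun t => 1 - Real.cos (psiF s a t)) (Real.sin (psiF s a t) * dpsiF s a t) t :=
      ((psiF_hasDerivAt s a t).cos.const_sub 1).congr_deriv (by ring)
    exact h1.div (DF_diff s a w t).hasDerivAt (hDpos t ht).ne'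
  have hD' : ∀ t, 0 < t → 0 ≤ deriv D t := by
    intro t ht
    have := (DF_mono ha w).derivWithin_nonneg (x := t)
    rwa [derivWithin_of_isOpen isOpen_Ioi (Set.mem_Ioi.2 ht)] at this
  have hineq : ∀ t, 0 < t → (Real.sin (psiF s a t) * dpsiF s a t * D t -
      (1 - Real.cos (psiF s a t)) * deriv D t) / (D t) ^ 2 ≤ - gpH μ w 0 t := by
    intro t ht
    have h1 := hDpos t ht
    have h2 := hD' t ht
    have h3 : 0 ≤ 1 - Real.cos (psiF s a t) := by linarith [Real.cos_le_one (psiF s a t)]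
    have h4 : - gpH μ w 0 t = (Real.sin (psiF s a t) * dpsiF s a t * D t) / (D t) ^ 2 := by
      rw [hg, neg_neg, hD]
      have h5 := hdpos t ht
      have h6 : 0 < rhoF s a t := by linarith [rhoF_one_le s a t]
      have h7 : Real.exp (-(w ^ 2 * t ^ 2) / 2) = (Real.exp (w ^ 2 * t ^ 2 / 2))⁻¹ := by
        rw [← Real.exp_neg]; congr 1; ring
      rw [h7]
      unfold DF
      field_simp
    rw [h4]
    gcongr
    nlinarith [mul_nonneg h3 h2]
  have hJnn : ∀ t, 0 < t → 0 ≤ J t := fun t ht =>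
    div_nonneg (by linarith [Real.cos_le_one (psiF s a t)]) (hDpos t ht).le
  have hJle : ∀ t, 0 < t → J t ≤ (∑ i ∈ s, a i) * t / 2 := by
    intro t ht
    have h1 := psiF_le ha ht.le
    have h2 := psiF_le_dpsiF ha ht.le
    have h3 := psiF_nonneg ha ht.le
    have h4 : t * dpsiF s a t ≤ D t := by
      rw [hD]; unfold DF
      have h5 : 0 ≤ t * dpsiF s a t := h3.trans h2
      have h6 := rhoF_one_le s a t
      have h7 : 1 ≤ Real.exp (w ^ 2 * t ^ 2 / 2) := Real.one_le_exp (by positivity)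
      calc t * dpsiF s a t = t * dpsiF s a t * 1 * 1 := by ring
        _ ≤ _ := by gcongr
    rw [hJ]; simp only
    rw [div_le_iff₀ (hDpos t ht)]
    have h5 := Real.one_sub_sq_div_two_le_cos (x := psiF s a t)
    have h6 : psiF s a t * psiF s a t ≤ ((∑ i ∈ s, a i) * t) * D t :=
      mul_le_mul h1 (h2.trans h4) h3 (h3.trans h1)
    nlinarith
  have hfin : ∀ u T, 0 < u → u ≤ T → -((∑ i ∈ s, a i) * u / 2) ≤ ∫ t in u..T, - gpH μ w 0 t := by
    intro u T hu hT
    have := intervalIntegral.sub_le_integral_of_hasDeriv_right_of_le hT (g := J)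
      (φ := fun t => - gpH μ w 0 t)
      (fun t ht => (hJd t (hu.trans_le ht.1)).continuousAt.continuousWithinAt)
      (fun t ht => (hJd t (hu.trans ht.1)).hasDerivWithinAt)
      ((hgi.mono_set fun t ht => Set.mem_Ioi.2 (hu.trans_le ht.1)).neg)
      (fun t ht => hineq t (hu.trans ht.1))
    linarith [hJle u hu, hJnn T (hu.trans_le hT)]
  have hIoi : ∀ u, 0 < u → ∫ t in Set.Ioi u, gpH μ w 0 t ≤ (∑ i ∈ s, a i) * u / 2 := by
    intro u hu
    have hI : IntegrableOn (fun t => - gpH μ w 0 t) (Set.Ioi u) :=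
      (hgi.mono_set (Set.Ioi_subset_Ioi hu.le)).neg
    have h1 := intervalIntegral_tendsto_integral_Ioi u hI Filter.tendsto_id
    have h2 := ge_of_tendsto h1 ((Filter.eventually_ge_atTop u).mono fun T hT => hfin u T hu hT)
    rw [integral_neg] at h2
    linarith
  have hsmall : ∀ u, 0 < u → (∑ i ∈ s, a i) * u ≤ 3 → ∫ t in Set.Ioc 0 u, gpH μ w 0 t ≤ 0 := by
    intro u hu hu3
    refine setIntegral_nonpos measurableSet_Ioc fun t ht => ?_
    rw [hg, neg_nonpos]
    have h1 := psiF_le ha ht.1.le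
    have h2 := psiF_nonneg ha ht.1.le
    have h3 : 0 ≤ ∑ i ∈ s, a i := Finset.sum_nonneg ha
    have h4 : 0 ≤ Real.sin (psiF s a t) := by
      apply Real.sin_nonneg_of_nonneg_of_le_pi h2
      have := mul_le_mul_of_nonneg_left ht.2 h3
      linarith [Real.pi_gt_three]
    have h5 := rhoF_one_le s a t
    have h6 : 0 < t := ht.1
    positivity
  have hA : 0 ≤ ∑ i ∈ s, a i := Finset.sum_nonneg ha
  refine le_of_forall_pos_le_add fun e he => ?_
  rw [zero_add]
  set u := min e 1 / (∑ i ∈ s, a i + 1) with hu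
  have hu0 : 0 < u := by positivity
  have hu1 : (∑ i ∈ s, a i) * u ≤ min e 1 := by
    rw [hu, mul_div_assoc', div_le_iff₀ (by positivity)]
    nlinarith [show 0 < min e 1 by positivity]
  have hsplit : ∫ t in Set.Ioi (0 : ℝ), gpH μ w 0 t =
      (∫ t in Set.Ioc 0 u, gpH μ w 0 t) + ∫ t in Set.Ioi u, gpH μ w 0 t := by
    rw [← setIntegral_union (Set.Ioc_disjoint_Ioi le_rfl) measurableSet_Ioi
      (hgi.mono_set Set.Ioc_subset_Ioi_self) (hgi.mono_set (Set.Ioi_subset_Ioi hu0.le)),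
      Set.Ioc_union_Ioi_eq_Ioi hu0.le]
  rw [hsplit]
  have h1 := hsmall u hu0 (by linarith [min_le_right e 1])
  have h2 := hIoi u hu0
  linarith [min_le_left e 1]


/-! ## Part 5: anti-concentration -/

lemma one_add_sum_le_prod' {ι : Type*} (s : Finset ι) (f : ι → ℝ) (hf : ∀ i ∈ s, 0 ≤ f i) :
    1 + ∑ i ∈ s, f i ≤ ∏ i ∈ s, (1 + f i) := by
  classical
  induction s using Finset.induction_on with
  | empty => simp
  | insert i s hi ih =>
    rw [Finset.sum_insert hi, Finset.prod_insert hi]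
    have h1 := ih fun j hj => hf j (Finset.mem_insert_of_mem hj)
    have h2 := hf i (Finset.mem_insert_self i s)
    have h3 : 0 ≤ ∑ i ∈ s, f i := Finset.sum_nonneg fun j hj => hf j (Finset.mem_insert_of_mem hj)
    nlinarith

lemma norm_cf_le {ι : Type*} {s : Finset ι} {a : ι → ℝ} {μ : Measure ℝ} (hμ : IsExpSum s a μ) (t : ℝ) :
    ‖charFun μ t‖ ≤ (√(1 + (∑ i ∈ s, a i ^ 2) * t ^ 2))⁻¹ := by
  rw [hμ.cf, norm_prod]
  simp_rw [norm_ephi]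
  rw [Finset.prod_inv_distrib, ← Real.sqrt_prod _ (fun i _ => by positivity)]
  have hV : 0 ≤ ∑ i ∈ s, a i ^ 2 := Finset.sum_nonneg fun i _ => sq_nonneg _
  apply inv_anti₀ (Real.sqrt_pos.2 (by positivity))
  apply Real.sqrt_le_sqrt
  have := one_add_sum_le_prod' s (fun i => (a i * t) ^ 2) (fun i _ => sq_nonneg _)
  refine le_trans (le_of_eq ?_) this
  rw [Finset.sum_mul]
  congr 1
  exact Finset.sum_congr rfl fun i _ => by ring

lemma gauss_fubini (μ : Measure ℝ) [IsProbabilityMeasure μ] (c : ℝ) :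
    ∫ x, Real.exp (-(c * x) ^ 2 / 2) ∂μ ≤ ∫ t, ‖charFun μ (c * t)‖ ∂(gaussianReal 0 1) := by
  have h1 : ∀ x : ℝ, ((Real.exp (-(c * x) ^ 2 / 2) : ℝ) : ℂ) =
      ∫ t, Complex.exp (((c * t : ℝ) : ℂ) * x * Complex.I) ∂(gaussianReal 0 1) := by
    intro x
    have := charFun_gaussianReal (μ := 0) (v := 1) (c * x)
    rw [charFun_apply_real] at this
    simp only [Complex.ofReal_zero, mul_zero, zero_mul, zero_sub, NNReal.coe_one, one_mul] at this
    push_cast at this ⊢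
    rw [show -((c : ℂ) * x) ^ 2 / 2 = -(((c:ℂ) * x) ^ 2 / 2) by ring]
    simp only [one_mul] at this
    rw [← this]
    congr 1; ext t; congr 1; ring
  have h2 : ((∫ x, Real.exp (-(c * x) ^ 2 / 2) ∂μ : ℝ) : ℂ) = ∫ t, charFun μ (c * t) ∂(gaussianReal 0 1) := by
    rw [← integral_complex_ofReal]
    simp_rw [h1, charFun_apply_real]
    rw [integral_integral_swap]
    refine Integrable.of_bound (C := 1) (by apply Measurable.aestronglyMeasurable; fun_prop) ?_
    filter_upwards with z
    have := Complex.norm_exp_ofReal_mul_I (c * z.2 * z.1)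
    push_cast at this
    simp only [Function.uncurry]
    push_cast
    rw [this]
  calc _ ≤ |∫ x, Real.exp (-(c * x) ^ 2 / 2) ∂μ| := le_abs_self _
    _ = ‖((∫ x, Real.exp (-(c * x) ^ 2 / 2) ∂μ : ℝ) : ℂ)‖ := by
      rw [Complex.norm_real, Real.norm_eq_abs]
    _ ≤ _ := by rw [h2]; exact norm_integral_le_integral_norm _

noncomputable def antiC (n : ℕ) : ℝ := ∫ t, (√(1 + ((n + 1) * t) ^ 2))⁻¹ ∂(gaussianReal 0 1)

lemma antiC_tendsto : Filter.Tendsto antiC Filter.atTop (nhds 0) := by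
  have h0 : (0:ℝ) = ∫ t : ℝ, (0 : ℝ) ∂(gaussianReal 0 1) := by simp
  rw [h0]
  unfold antiC
  have hne : ∀ᵐ t ∂(gaussianReal 0 1), t ≠ 0 := by
    have : NullSingletonClass (gaussianReal 0 1) := nullSingletonClass_gaussianReal one_ne_zero
    exact Measure.ae_ne (gaussianReal 0 1) (0:ℝ)
  refine tendsto_integral_of_dominated_convergence (fun _ => 1) (fun n => ?_) (integrable_const 1)
    (fun n => ?_) ?_
  · exact Measurable.aestronglyMeasurable (by fun_prop)
  · filter_upwards with t
    rw [Real.norm_eq_abs, abs_of_nonneg (by positivity)]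
    apply inv_le_one_of_one_le₀
    rw [Real.one_le_sqrt]; nlinarith [sq_nonneg ((n + 1) * t)]
  · filter_upwards [hne] with t ht
    apply Filter.Tendsto.inv_tendsto_atTop
    refine Filter.tendsto_atTop_mono (f := fun n : ℕ => (n : ℝ) * |t|) (fun n => ?_) ?_
    · apply Real.le_sqrt_of_sq_le
      rw [mul_pow, sq_abs, mul_pow]
      have : 0 ≤ t ^ 2 * (n : ℝ) := by positivity
      nlinarith [sq_nonneg t]
    · exact tendsto_natCast_atTop_atTop.atTop_mul_const (abs_pos.2 ht)

lemma anti_conc {ι : Type*} {s : Finset ι} {a : ι → ℝ} {μ : Measure ℝ} (hμ : IsExpSum s a μ)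
    (hV : 0 < ∑ i ∈ s, a i ^ 2) (n : ℕ) :
    μ.real (Set.Icc (-(√(∑ i ∈ s, a i ^ 2) / (n + 1))) (√(∑ i ∈ s, a i ^ 2) / (n + 1)))
      ≤ Real.exp (1 / 2) * antiC n := by
  have := hμ.prob
  set V := ∑ i ∈ s, a i ^ 2 with hVd
  have hσ : 0 < √V := Real.sqrt_pos.2 hV
  set c : ℝ := (n + 1) / √V with hc
  have hc0 : 0 < c := by positivity
  have h1 : μ.real (Set.Icc (-(√V / (n + 1))) (√V / (n + 1))) ≤
      ∫ x, Real.exp (1 / 2) * Real.exp (-(c * x) ^ 2 / 2) ∂μ := by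
    rw [← integral_indicator_one measurableSet_Icc]
    refine integral_mono_of_nonneg (Filter.Eventually.of_forall fun x => ?_) ?_ (Filter.Eventually.of_forall fun x => ?_)
    · exact Set.indicator_nonneg (fun _ _ => zero_le_one) x
    · refine Integrable.const_mul (Integrable.of_bound (C := 1)
        (Measurable.aestronglyMeasurable (by fun_prop)) ?_) _
      filter_upwards with x
      rw [Real.norm_eq_abs, Real.abs_exp]
      apply Real.exp_le_one_iff.2
      nlinarith [sq_nonneg (c * x)]
    · apply Set.indicator_le' (fun x hx => ?_) (fun x _ => by positivity)
      rw [← Real.exp_add]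
      apply Real.one_le_exp
      have h2 : |x| ≤ √V / (n + 1) := abs_le.2 hx
      have h3 : |c * x| ≤ 1 := by
        rw [abs_mul, abs_of_pos hc0]
        calc c * |x| ≤ c * (√V / (n + 1)) := by gcongr
          _ = 1 := by rw [hc]; field_simp
      have : (c * x) ^ 2 ≤ 1 := by rw [← sq_abs]; nlinarith [abs_nonneg (c * x)]
      linarith
  refine h1.trans ?_
  rw [integral_const_mul]
  refine mul_le_mul_of_nonneg_left ?_ (Real.exp_pos _).le
  refine (gauss_fubini μ c).trans ?_
  unfold antiC
  refine integral_mono_of_nonneg (Filter.Eventually.of_forall fun x => norm_nonneg _) ?_ (Filter.Eventually.of_forall fun t => ?_)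
  · refine Integrable.of_bound (C := 1) (Measurable.aestronglyMeasurable (by fun_prop)) ?_
    filter_upwards with t
    rw [Real.norm_eq_abs, abs_of_nonneg (by positivity)]
    apply inv_le_one_of_one_le₀
    rw [Real.one_le_sqrt]; nlinarith [sq_nonneg ((n + 1) * t)]
  · refine (norm_cf_le hμ (c * t)).trans (le_of_eq ?_)
    simp only
    congr 3
    rw [← hVd, hc]
    have : V = √V ^ 2 := (Real.sq_sqrt hV.le).symm
    rw [mul_pow, div_pow, ← this]; field_simp

lemma half_le_Iic {ι : Type*} {s : Finset ι} {a : ι → ℝ} (ha : ∀ i ∈ s, 0 ≤ a i) {μ : Measure ℝ}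
    (hμ : IsExpSum s a μ) {h : ℝ} (hh : 0 < h) : 1 / 2 ≤ μ.real (Set.Iic h) := by
  have := hμ.prob
  refine le_of_forall_pos_le_add fun e he => ?_
  set w := h * min e 1 with hw
  have hm : 0 < min e 1 := by positivity
  have hw0 : 0 < w := by positivity
  have h1 := sF_median ha hμ hw0
  have h2 := sF_le μ (h := h) hw0 h
  rw [sub_self] at h2
  have h3 := gPhi_tail (x := h / w) (by positivity)
  have h4 : 1 / (h / w) ^ 2 ≤ e := by
    rw [hw]
    have : 1 / (h / (h * min e 1)) ^ 2 = (min e 1) ^ 2 := by field_simp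
    rw [this]
    nlinarith [min_le_left e 1, min_le_right e 1]
  linarith

/-- uniform quantile lemma -/
lemma quantile_uniform {ε : ℝ} (hε : ε < 1 / 2) : ∃ δ > (0:ℝ), ∃ η > (0:ℝ),
    ∀ {ι : Type} {s : Finset ι} {a : ι → ℝ} (_ : ∀ i ∈ s, 0 ≤ a i) {μ : Measure ℝ}
    (_ : IsExpSum s a μ) (t : ℝ), -(δ * √(∑ i ∈ s, a i ^ 2)) ≤ t → ε + η ≤ μ.real (Set.Iic t) := by
  have hk : 0 < 1 / 2 - ε := by linarith
  have h1 : Filter.Tendsto (fun n => Real.exp (1 / 2) * antiC n) Filter.atTop (nhds 0) := by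
    simpa using antiC_tendsto.const_mul (Real.exp (1 / 2))
  obtain ⟨n, hn⟩ := (h1.eventually (gt_mem_nhds (show (0:ℝ) < (1 / 2 - ε) / 2 by linarith))).exists
  refine ⟨1 / (n + 1), by positivity, (1 / 2 - ε) / 2, by linarith, ?_⟩
  intro ι s a ha μ hμ t ht
  have := hμ.prob
  set V := ∑ i ∈ s, a i ^ 2 with hVd
  have hmono : μ.real (Set.Iic (-(1 / (n + 1) * √V))) ≤ μ.real (Set.Iic t) :=
    measureReal_mono (Set.Iic_subset_Iic.2 ht)
  refine le_trans ?_ hmono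
  have hV0 : 0 ≤ V := Finset.sum_nonneg fun i _ => sq_nonneg _
  rcases hV0.eq_or_lt with hV | hV
  · have hz : ∀ i ∈ s, a i = 0 := by
      intro i hi
      have := (Finset.sum_eq_zero_iff_of_nonneg (fun i _ => sq_nonneg (a i))).1 hV.symm i hi
      simpa using this
    have hd : μ = Measure.dirac 0 := by
      apply Measure.ext_of_charFun
      ext t
      rw [hμ.cf, charFun_dirac]
      simp only [inner_zero_left, Complex.ofReal_zero, zero_mul, Complex.exp_zero]
      refine Finset.prod_eq_one fun i hi => ?_
      rw [hz i hi]; simp [ephi]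
    rw [← hV, hd]
    simp [Measure.real]
    linarith
  · have hσ : 0 < √V := Real.sqrt_pos.2 hV
    have h2 := anti_conc hμ hV n
    rw [← hVd] at h2
    have h3 := half_le_Iic ha hμ (h := √V / (n + 1)) (by positivity)
    have h4 : μ.real (Set.Iic (√V / (n + 1))) ≤ μ.real (Set.Iic (-(1 / (n + 1) * √V))) +
        μ.real (Set.Icc (-(√V / (n + 1))) (√V / (n + 1))) := by
      refine le_trans (measureReal_mono ?_) (measureReal_union_le _ _)
      intro x hx
      rcases le_total x (-(√V / (n + 1))) with h | h
      · left; rw [Set.mem_Iic]; convert h using 1; ring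
      · right; exact ⟨h, hx⟩
    linarith


/-! ## Part 6: the key converse estimate -/

lemma log_one_add_ge {B x a : ℝ} (hB : 1 ≤ B) (hx : 2 * B ≤ x) (ha : 0 ≤ a) :
    2 * Real.log B / x * a - Real.log B / x ^ 2 * a ^ 2 ≤ Real.log (1 + a) := by
  have hl : 0 ≤ Real.log B := Real.log_nonneg hB
  have hx0 : 0 < x := by linarith
  rcases le_total B a with h | h
  · have h1 : Real.log B ≤ Real.log (1 + a) := Real.log_le_log (by linarith) (by linarith)
    have h2 : 2 * Real.log B / x * a - Real.log B / x ^ 2 * a ^ 2 =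
        Real.log B - Real.log B * (1 - a / x) ^ 2 := by field_simp; ring
    rw [h2]
    nlinarith [mul_nonneg hl (sq_nonneg (1 - a / x))]
  · have h1 := rpow_one_add_le_one_add_mul_self (s := B) (p := a / B) (by linarith)
      (by positivity) (by rw [div_le_one (by linarith)]; exact h)
    have h2 := Real.log_le_log (by positivity) h1
    rw [Real.log_rpow (by linarith), div_mul_cancel₀ _ (by linarith)] at h2
    have h3 : Real.log B ≤ Real.log (1 + B) := Real.log_le_log (by linarith) (by linarith)
    have h4 : 2 * Real.log B / x * a ≤ a / B * Real.log (1 + B) := by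
      calc 2 * Real.log B / x * a ≤ 2 * Real.log B / (2 * B) * a := by gcongr
        _ = a / B * Real.log B := by field_simp
        _ ≤ _ := by gcongr
    have h5 : 0 ≤ Real.log B / x ^ 2 * a ^ 2 := by positivity
    linarith

lemma amgm_three {u v g : ℝ} (hu : 0 ≤ u) (hv : 0 ≤ v) (hg : g ^ 3 = 27 * u * v ^ 2) :
    g ≤ u + 2 * v := by
  by_contra h
  push Not at h
  have h0 : 0 ≤ u + 2 * v := by positivity
  have h1 : (u + 2 * v) ^ 3 < g ^ 3 := by gcongr
  rw [hg] at h1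
  nlinarith [mul_nonneg hu (sq_nonneg (u - v)), mul_nonneg hv (sq_nonneg (u - v))]

/-- lower bound for the information mean in terms of the variance of the small summands -/
lemma lambda_lower {ι : Type} [DecidableEq ι] {s b : Finset ι} (hb : b ⊆ s) {a : ι → ℝ}
    (ha : ∀ i ∈ s, 0 ≤ a i) {A B y x : ℝ} (hB : 1 ≤ B) (hx : 2 * B ≤ x) (hlB : Real.log B ≤ B)
    (hy : 0 < y) (hby : ∀ i ∈ b, y ≤ a i) (hA : ∑ i ∈ s, a i ≤ A) :
    2 * Real.log B / x * A - Real.log B / x ^ 2 * (∑ i ∈ s \ b, a i ^ 2)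
      - 2 * Real.log B / x / y * (∑ i ∈ b, a i ^ 2) ≤
    (A - ∑ i ∈ s, a i) + ∑ i ∈ s, Real.log (1 + a i) := by
  have hl : 0 ≤ Real.log B := Real.log_nonneg hB
  have hx0 : 0 < x := by linarith
  have hα : 2 * Real.log B / x ≤ 1 := by rw [div_le_one hx0]; linarith
  have hα0 : 0 ≤ 2 * Real.log B / x := by positivity
  have h1 : ∑ i ∈ s \ b, (2 * Real.log B / x * a i - Real.log B / x ^ 2 * a i ^ 2) ≤
      ∑ i ∈ s \ b, Real.log (1 + a i) :=
    Finset.sum_le_sum fun i hi => log_one_add_ge hB hx (ha i (Finset.mem_sdiff.1 hi).1)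
  have h2 : ∑ i ∈ b, (2 * Real.log B / x * a i - 2 * Real.log B / x / y * a i ^ 2) ≤
      ∑ i ∈ b, Real.log (1 + a i) := by
    refine Finset.sum_le_sum fun i hi => ?_
    have h3 := hby i hi
    have h4 : 0 ≤ Real.log (1 + a i) := Real.log_nonneg (by linarith)
    have h5 : a i ≤ a i ^ 2 / y := by rw [le_div_iff₀ hy]; nlinarith
    have h6 : 2 * Real.log B / x * a i ≤ 2 * Real.log B / x * (a i ^ 2 / y) := by gcongr
    have h7 : 2 * Real.log B / x * (a i ^ 2 / y) = 2 * Real.log B / x / y * a i ^ 2 := by ring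
    linarith
  rw [Finset.sum_sub_distrib, ← Finset.mul_sum, ← Finset.mul_sum] at h1 h2
  have h8 := Finset.sum_sdiff hb (f := a)
  have h9 := Finset.sum_sdiff hb (f := fun i => Real.log (1 + a i))
  have h10 : 2 * Real.log B / x * (A - ∑ i ∈ s, a i) ≤ 1 * (A - ∑ i ∈ s, a i) :=
    mul_le_mul_of_nonneg_right hα (by linarith)
  have h11 : 2 * Real.log B / x * ∑ i ∈ s, a i = 2 * Real.log B / x * ∑ i ∈ s \ b, a i +
      2 * Real.log B / x * ∑ i ∈ b, a i := by rw [← h8]; ring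
  linarith

set_option maxHeartbeats 800000 in
lemma converse_gauss {q C₁ c₀ : ℝ} (hq : 0 < q) (hC₁0 : 0 < C₁)
    (hc₀ : c₀ = gphi q / (2 * (C₁ + 1))) {D l : ℝ} (hl2 : 2 ≤ l) (hD0 : 0 < D)
    (hlq : 1 / (2 * l ^ 2) ≤ q) (hlc : 3 ≤ c₀ * l ^ 3)
    (hDl : (24 * C₁ ^ 2 + 1) * l ^ 32 ≤ D)
    {ι : Type} [DecidableEq ι] {s b : Finset ι} {a : ι → ℝ} (ha : ∀ i ∈ s, 0 ≤ a i) (hb : b ⊆ s)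
    (hsm : ∀ i ∈ s \ b, a i ≤ D ^ 3)
    {μb μ : Measure ℝ} (hμb : IsExpSum b a μb) (hμ : IsExpSum s a μ)
    (hV'big : 2 * D ^ 8 ≤ ∑ i ∈ s \ b, a i ^ 2)
    (h7 : ∑ i ∈ s \ b, a i ^ 2 ≤ C₁ ^ 2 * D ^ 8 * l ^ 2) {t : ℝ}
    (ht1 : 3 / 4 * (D ^ 4 / l ^ 2) - q * √(∑ i ∈ s \ b, a i ^ 2) ≤ t) :
    gPhi (-q) + 1 / l ^ 6 ≤ μ.real (Set.Iic t) := by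
  have := hμ.prob
  have := hμb.prob
  have hl0 : 0 < l := by linarith
  set V' := ∑ i ∈ s \ b, a i ^ 2 with hV'
  have hV'pos : 0 < V' := by nlinarith [show 0 < D ^ 8 by positivity]
  set σ := √V' with hσ
  set Δ := D ^ 4 / l ^ 2 with hΔ
  have hΔ0 : 0 < Δ := by positivity
  set w₀ := D ^ 4 / l ^ 8 with hw₀
  have hw₀0 : 0 < w₀ := by positivity
  have hw₀D : w₀ ≤ D ^ 4 := div_le_self (by positivity) (one_le_pow₀ (by linarith))
  have h1 := sF_le μ (h := Δ / 4) hw₀0 t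
  have h2 : gPhi (-(Δ / 4 / w₀)) ≤ 1 / l ^ 6 := by
    refine (gPhi_tail (by positivity)).trans ?_
    have e : 1 / (Δ / 4 / w₀) ^ 2 = 16 / (l ^ 6 * l ^ 6) := by rw [hΔ, hw₀]; field_simp; norm_num
    rw [e, div_le_div_iff₀ (by positivity) (by positivity)]
    have : (2:ℝ) ^ 6 ≤ l ^ 6 := by gcongr
    nlinarith [show 0 < l ^ 6 by positivity]
  have h3 := sF_compare hb hμ hμb hw₀0 (t - Δ / 4)
  set τ := √(w₀ ^ 2 + V') with hτ
  have hτ2 : τ ^ 2 = w₀ ^ 2 + V' := Real.sq_sqrt (by positivity)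
  have hτ0 : 0 < τ := Real.sqrt_pos.2 (by positivity)
  have hστ : σ ≤ τ := Real.sqrt_le_sqrt (by nlinarith [sq_nonneg w₀])
  have h4 : 24 * (∑ i ∈ s \ b, |a i| ^ 3) / w₀ ^ 3 ≤ 1 / l ^ 6 := by
    have h5 : ∑ i ∈ s \ b, |a i| ^ 3 ≤ D ^ 3 * V' := by
      rw [hV', Finset.mul_sum]
      refine Finset.sum_le_sum fun i hi => ?_
      obtain ⟨hi1, hi2⟩ := Finset.mem_sdiff.1 hi
      have h6 := hsm i hi
      rw [abs_of_nonneg (ha i hi1), pow_succ, mul_comm]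
      gcongr
    calc 24 * (∑ i ∈ s \ b, |a i| ^ 3) / w₀ ^ 3 ≤
          24 * (D ^ 3 * (C₁ ^ 2 * D ^ 8 * l ^ 2)) / w₀ ^ 3 := by
          gcongr
          exact h5.trans (by gcongr)
      _ = (24 * C₁ ^ 2 * l ^ 32) / (D * l ^ 6) := by rw [hw₀]; field_simp
      _ ≤ D / (D * l ^ 6) := by
          gcongr
          nlinarith [show 0 < l ^ 32 by positivity]
      _ = _ := by field_simp
  have hmed := sF_median (fun i hi => ha i (hb hi)) hμb hτ0
  set q' := q - Δ / (2 * τ) with hq'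
  have hτD : D ^ 4 ≤ τ := by
    apply Real.le_sqrt_of_sq_le
    have e : (D ^ 4) ^ 2 = D ^ 8 := by ring
    linarith [sq_nonneg w₀, show 0 < D ^ 8 by positivity]
  have hq'0 : 0 ≤ q' := by
    have : Δ / (2 * τ) ≤ 1 / (2 * l ^ 2) := by
      rw [hΔ, div_div, div_le_div_iff₀ (by positivity) (by positivity)]
      nlinarith [show 0 < l ^ 2 by positivity]
    rw [hq']; linarith
  have h8 := sF_tail μb hτ0 hq'0 hmed
  have h9 : -q' * τ ≤ t - Δ / 4 := by
    have e : -q' * τ = Δ / 2 - q * τ := by rw [hq']; field_simp; ring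
    rw [e]
    have := mul_le_mul_of_nonneg_left hστ hq.le
    linarith
  have h10 := sF_mono μb hτ0 h9
  have h11 := gPhi_incr (a := -q) (b := -q') (m := q) (by rw [hq']; linarith [show 0 < Δ / (2 * τ) by positivity])
    le_rfl (by linarith)
  have hτle : τ ≤ (C₁ + 1) * (D ^ 4 * l) := by
    apply Real.sqrt_le_iff.2
    refine ⟨by positivity, ?_⟩
    have h12 : w₀ ^ 2 ≤ (D ^ 4 * l) ^ 2 := by
      gcongr
      nlinarith [show 0 < D ^ 4 by positivity]
    have : 0 ≤ C₁ * (D ^ 4 * l) ^ 2 := by positivity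
    calc w₀ ^ 2 + V' ≤ (D ^ 4 * l) ^ 2 + C₁ ^ 2 * D ^ 8 * l ^ 2 := by linarith
      _ ≤ _ := by nlinarith
  have h13 : 3 / l ^ 6 ≤ gphi q * (-q' - -q) := by
    have e : -q' - -q = Δ / (2 * τ) := by rw [hq']; ring
    rw [e]
    calc 3 / l ^ 6 ≤ (c₀ * l ^ 3) / l ^ 6 := by gcongr
      _ = gphi q * (Δ / (2 * ((C₁ + 1) * (D ^ 4 * l)))) := by rw [hc₀, hΔ]; field_simp
      _ ≤ _ := by
        have := gphi_pos q
        gcongr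
  have h14 := (abs_le.1 h3).1
  have h15 : 3 / l ^ 6 = 1 / l ^ 6 + 1 / l ^ 6 + 1 / l ^ 6 := by ring
  linarith

set_option maxHeartbeats 800000 in
lemma converse_core {q G δ C₁ c₀ η : ℝ} (hq : 0 < q) (hG : 0 < G) (hG3 : G ^ 3 = 9 * q ^ 2 / 4)
    (hδ : 0 < δ) (hC₁ : C₁ = G / δ) (hc₀ : c₀ = gphi q / (2 * (C₁ + 1)))
    (hquant : ∀ {ι : Type} {s : Finset ι} {a : ι → ℝ} (_ : ∀ i ∈ s, 0 ≤ a i) {μ : Measure ℝ}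
      (_ : IsExpSum s a μ) (t : ℝ), -(δ * √(∑ i ∈ s, a i ^ 2)) ≤ t → gPhi (-q) + η ≤ μ.real (Set.Iic t))
    {D l : ℝ} (hD : 1 ≤ D) (hl2 : 2 ≤ l) (hl : l ^ 3 = 6 * Real.log D)
    (hlη : 1 / l ^ 6 ≤ η) (hlG : 6 * G ≤ l ^ 2) (hlq : 1 / (2 * l ^ 2) ≤ q) (hlc : 3 ≤ c₀ * l ^ 3)
    (hDl : (24 * C₁ ^ 2 + 1) * l ^ 32 ≤ D)
    {ι : Type} {s : Finset ι} {a : ι → ℝ} (ha : ∀ i ∈ s, 0 ≤ a i) (hA : ∑ i ∈ s, a i ≤ D ^ 6)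
    (hsub : ∀ b ⊆ s, ∃ μb, IsExpSum b a μb) {μ : Measure ℝ} (hμ : IsExpSum s a μ) :
    gPhi (-q) + 1 / l ^ 6 ≤ μ.real (Set.Iic
      (D ^ 4 / l ^ 2 - G * D ^ 4 * l + ((D ^ 6 - ∑ i ∈ s, a i) + ∑ i ∈ s, Real.log (1 + a i)))) := by
  classical
  have := hμ.prob
  have hl0 : 0 < l := by linarith
  have hD0 : 0 < D := by linarith
  have hC₁0 : 0 < C₁ := by rw [hC₁]; positivity
  set V := ∑ i ∈ s, a i ^ 2 with hV
  set Λ := (D ^ 6 - ∑ i ∈ s, a i) + ∑ i ∈ s, Real.log (1 + a i) with hΛ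
  have hV0 : 0 ≤ V := Finset.sum_nonneg fun i _ => sq_nonneg _
  have hΛ0 : 0 ≤ Λ := by
    have : 0 ≤ ∑ i ∈ s, Real.log (1 + a i) :=
      Finset.sum_nonneg fun i hi => Real.log_nonneg (by linarith [ha i hi])
    rw [hΛ]; linarith
  by_cases hcase : G * D ^ 4 * l ≤ δ * √V
  · have h1 := hquant ha hμ (D ^ 4 / l ^ 2 - G * D ^ 4 * l + Λ) (by
      have : 0 < D ^ 4 / l ^ 2 := by positivity
      linarith)
    linarith
  push Not at hcase
  have hVle : V ≤ C₁ ^ 2 * D ^ 8 * l ^ 2 := by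
    have h1 : √V ≤ C₁ * D ^ 4 * l := by
      rw [hC₁, div_mul_eq_mul_div, div_mul_eq_mul_div, le_div_iff₀ hδ]; linarith
    have h2 := Real.sq_sqrt hV0
    have h3 : √V ^ 2 ≤ (C₁ * D ^ 4 * l) ^ 2 := by gcongr
    calc V = √V ^ 2 := h2.symm
      _ ≤ _ := h3
      _ = _ := by ring
  set b := s.filter fun i => D ^ 3 < a i with hbdef
  have hb : b ⊆ s := Finset.filter_subset _ _
  obtain ⟨μb, hμb⟩ := hsub b hb
  have := hμb.prob
  set V' := ∑ i ∈ s \ b, a i ^ 2 with hV'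
  set Vb := ∑ i ∈ b, a i ^ 2 with hVb
  have hV'0 : 0 ≤ V' := Finset.sum_nonneg fun i _ => sq_nonneg _
  have hVb0 : 0 ≤ Vb := Finset.sum_nonneg fun i _ => sq_nonneg _
  have hVs : V' + Vb = V := Finset.sum_sdiff hb
  set x := max (V' / D ^ 6) (2 * D ^ 2) with hx
  have hx2 : 2 * D ^ 2 ≤ x := le_max_right _ _
  have hx1 : V' / D ^ 6 ≤ x := le_max_left _ _
  have hx0 : 0 < x := by nlinarith [sq_nonneg D]
  have hlogB : Real.log (D ^ 2) = l ^ 3 / 3 := by rw [Real.log_pow, hl]; push_cast; ring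
  have hlogBD : Real.log (D ^ 2) ≤ D ^ 2 := by
    have := Real.log_le_sub_one_of_pos (show 0 < D ^ 2 by positivity)
    linarith
  have hlow := lambda_lower hb ha (A := D ^ 6) (B := D ^ 2) (y := D ^ 3) (x := x)
    (one_le_pow₀ hD) hx2 hlogBD (by positivity)
    (fun i hi => (Finset.mem_filter.1 hi).2.le) hA
  rw [← hΛ, ← hV', ← hVb, hlogB] at hlow
  -- the negative terms
  have hn1 : l ^ 3 / 3 / x ^ 2 * V' ≤ l ^ 3 / 3 / x * D ^ 6 := by
    have h1 : V' ≤ x * D ^ 6 := by rwa [div_le_iff₀ (by positivity)] at hx1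
    calc l ^ 3 / 3 / x ^ 2 * V' ≤ l ^ 3 / 3 / x ^ 2 * (x * D ^ 6) := by gcongr
      _ = _ := by field_simp
  have hpow : ∀ k : ℕ, k ≤ 32 → l ^ k ≤ l ^ 32 := fun k hk =>
    pow_le_pow_right₀ (by linarith) hk
  have hn2 : 2 * (l ^ 3 / 3) / x / D ^ 3 * Vb ≤ D ^ 4 / l ^ 2 / 4 := by
    calc 2 * (l ^ 3 / 3) / x / D ^ 3 * Vb ≤ 2 * (l ^ 3 / 3) / (2 * D ^ 2) / D ^ 3 *
          (C₁ ^ 2 * D ^ 8 * l ^ 2) := by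
          gcongr
          linarith
      _ = (4 / 3 * C₁ ^ 2 * l ^ 7) * D ^ 3 / l ^ 2 / 4 := by field_simp
      _ ≤ D * D ^ 3 / l ^ 2 / 4 := by
          gcongr
          have := hpow 7 (by norm_num)
          have h0 : 0 ≤ l ^ 7 := by positivity
          have h1 : C₁ ^ 2 * l ^ 7 ≤ C₁ ^ 2 * l ^ 32 := by gcongr
          nlinarith [sq_nonneg C₁]
      _ = _ := by ring
  have hΛ1 : D ^ 6 * (l ^ 3 / 3) / x - D ^ 4 / l ^ 2 / 4 ≤ Λ := by
    have e1 : 2 * (l ^ 3 / 3) / x * D ^ 6 = 2 * (D ^ 6 * (l ^ 3 / 3) / x) := by ring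
    have e2 : l ^ 3 / 3 / x * D ^ 6 = D ^ 6 * (l ^ 3 / 3) / x := by ring
    linarith
  rcases le_total (V' / D ^ 6) (2 * D ^ 2) with hsm | hbig
  · have hxe : x = 2 * D ^ 2 := max_eq_right hsm
    have h1 : G * D ^ 4 * l ≤ D ^ 6 * (l ^ 3 / 3) / x := by
      rw [hxe]
      have : D ^ 6 * (l ^ 3 / 3) / (2 * D ^ 2) = D ^ 4 * l * (l ^ 2 / 6) := by
        field_simp; norm_num
      rw [this]
      have h3 : G ≤ l ^ 2 / 6 := by linarith
      calc G * D ^ 4 * l = D ^ 4 * l * G := by ring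
        _ ≤ _ := by gcongr
    have h2 := hquant ha hμ (D ^ 4 / l ^ 2 - G * D ^ 4 * l + Λ) (by
      have : 0 < D ^ 4 / l ^ 2 := by positivity
      have : 0 ≤ δ * √V := by positivity
      linarith)
    linarith
  · have hxe : x = V' / D ^ 6 := max_eq_left hbig
    have hV'big : 2 * D ^ 8 ≤ V' := by
      rw [le_div_iff₀ (by positivity)] at hbig
      calc _ = 2 * D ^ 2 * D ^ 6 := by ring
        _ ≤ _ := hbig
    have hV'pos : 0 < V' := by nlinarith [show 0 < D ^ 8 by positivity]
    set σ := √V' with hσ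
    have hσ0 : 0 < σ := Real.sqrt_pos.2 hV'pos
    have hσ2 : σ ^ 2 = V' := Real.sq_sqrt hV'0
    have hL : G * D ^ 4 * l ≤ D ^ 6 * (l ^ 3 / 3) / x + q * σ := by
      have h1 := amgm_three (u := D ^ 12 * (l ^ 3 / 3) / σ ^ 2) (v := q * σ / 2) (g := G * D ^ 4 * l)
        (by positivity) (by positivity) (by
          rw [mul_pow, mul_pow, hG3]; field_simp; ring)
      have h2 : D ^ 6 * (l ^ 3 / 3) / x = D ^ 12 * (l ^ 3 / 3) / σ ^ 2 := by
        rw [hxe, hσ2]; field_simp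
      rw [h2]; linarith
    have hsm : ∀ i ∈ s \ b, a i ≤ D ^ 3 := by
      intro i hi
      obtain ⟨hi1, hi2⟩ := Finset.mem_sdiff.1 hi
      by_contra h
      exact hi2 (Finset.mem_filter.2 ⟨hi1, not_le.1 h⟩)
    exact converse_gauss hq hC₁0 hc₀ hl2 hD0 hlq hlc hDl ha hb hsm hμb hμ hV'big
      (by linarith) (by rw [hσ] at hL; linarith)


lemma expM_eq : expMeasure 1 =
    volume.withDensity (fun x => (Set.Ici (0:ℝ)).indicator (fun x => ENNReal.ofReal (Real.exp (-x))) x) := by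
  unfold expMeasure gammaMeasure
  congr 1
  funext x
  have := exponentialPDF_eq 1 x
  have h2 : gammaPDF 1 1 x = exponentialPDF 1 x := rfl
  rw [h2, this]
  by_cases hx : 0 ≤ x
  · simp [hx, Set.indicator]
  · simp [hx, Set.indicator]

instance : IsProbabilityMeasure (expMeasure 1) := isProbabilityMeasure_expMeasure one_pos

lemma expD_meas : Measurable (fun x => (Set.Ici (0:ℝ)).indicator (fun x => ENNReal.ofReal (Real.exp (-x))) x) := by
  apply Measurable.indicator _ measurableSet_Ici
  fun_prop

/-- likelihood ratio of the channel with input `x` against input `0` -/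
noncomputable def chanD (x y : ℝ) : ENNReal := ENNReal.ofReal (Real.exp (y * x / (1 + x) - Real.log (1 + x)))

lemma chanD_meas (x : ℝ) : Measurable (chanD x) := by unfold chanD; fun_prop

lemma expM_map_zero : (expMeasure 1).map (fun s => (1 + (0:ℝ)) * s) = expMeasure 1 := by
  have : (fun s : ℝ => (1 + (0:ℝ)) * s) = id := by funext s; simp
  rw [this, Measure.map_id]

lemma chan_density {x : ℝ} (hx : 0 ≤ x) :
    (expMeasure 1).map (fun s => (1 + x) * s) =
      ((expMeasure 1).map (fun s => (1 + (0:ℝ)) * s)).withDensity (chanD x) := by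
  rw [expM_map_zero]
  have h1 : (0:ℝ) < 1 + x := by linarith
  ext A hA
  rw [Measure.map_apply (by fun_prop) hA, withDensity_apply _ hA, expM_eq,
    withDensity_apply _ (by exact (measurable_const_mul (1+x)) hA),
    restrict_withDensity hA, lintegral_withDensity_eq_lintegral_mul _ expD_meas (chanD_meas x)]
  rw [← lintegral_indicator ((measurable_const_mul (1+x)) hA), ← lintegral_indicator hA]
  set F : ℝ → ENNReal := fun y => A.indicator (fun y => (Set.Ici (0:ℝ)).indicator
    (fun y => ENNReal.ofReal (Real.exp (-(y / (1 + x))))) y) y with hF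
  have hFm : Measurable F := by
    apply Measurable.indicator _ hA
    apply Measurable.indicator _ measurableSet_Ici
    fun_prop
  have e1 : ∀ s : ℝ, ((fun x_1 => (1 + x) * x_1) ⁻¹' A).indicator
      (fun x => (Set.Ici (0:ℝ)).indicator (fun x => ENNReal.ofReal (Real.exp (-x))) x) s
      = F ((1 + x) * s) := by
    intro s
    simp only [hF, Set.indicator, Set.mem_preimage, Set.mem_Ici]
    have : (0 ≤ (1 + x) * s) ↔ 0 ≤ s := by
      constructor
      · intro h; exact nonneg_of_mul_nonneg_right h h1
      · intro h; positivity
    simp only [this]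
    rw [mul_div_cancel_left₀ _ h1.ne']
    rfl
  have e2 : ∀ y : ℝ, A.indicator ((fun x => (Set.Ici (0:ℝ)).indicator
      (fun x => ENNReal.ofReal (Real.exp (-x))) x) * chanD x) y
      = ENNReal.ofReal |(1 + x)⁻¹| * F y := by
    intro y
    by_cases hy : y ∈ A
    · by_cases hy0 : 0 ≤ y
      · simp only [hF, Set.indicator, hy, Set.mem_Ici, hy0, if_true, Pi.mul_apply, chanD]
        rw [← ENNReal.ofReal_mul (Real.exp_nonneg _), ← ENNReal.ofReal_mul (abs_nonneg _),
          ← Real.exp_add, abs_of_pos (by positivity)]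
        congr 1
        rw [show -y + (y * x / (1 + x) - Real.log (1 + x)) = -(y/(1+x)) - Real.log (1+x) by
          field_simp; ring, Real.exp_sub, Real.exp_log h1]
        field_simp
      · simp [hF, Set.indicator, hy, hy0]
    · simp [hF, Set.indicator, hy]
  simp_rw [e1]
  rw [lintegral_congr e2, lintegral_const_mul _ hFm]
  rw [← lintegral_map hFm (measurable_const_mul (1+x)), Real.map_volume_mul_left h1.ne',
    lintegral_smul_measure]
  rfl

lemma infPi_withDensity {ι X : Type*} [MeasurableSpace X] (μ ν : ι → Measure X)
    [∀ i, IsProbabilityMeasure (μ i)] [∀ i, IsProbabilityMeasure (ν i)]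
    (f : ι → X → ENNReal) (hf : ∀ i, Measurable (f i)) (s : Finset ι)
    (h1 : ∀ i ∈ s, ν i = (μ i).withDensity (f i)) (h2 : ∀ i ∉ s, ν i = μ i) :
    Measure.infinitePi ν =
      (Measure.infinitePi μ).withDensity (fun y => ∏ i ∈ s, f i (y i)) := by
  classical
  symm
  apply Measure.eq_infinitePi
  intro u t ht
  have hm : MeasurableSet (Set.pi (u : Set ι) t) :=
    MeasurableSet.pi u.countable_toSet (fun i _ => ht i)
  rw [withDensity_apply _ hm, ← lintegral_indicator hm]
  set g : ι → X → ENNReal := fun i x =>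
    (if i ∈ u then (t i).indicator 1 x else 1) * (if i ∈ s then f i x else 1) with hg
  have hgm : ∀ i, Measurable (g i) := by
    intro i
    simp only [hg]
    apply Measurable.mul
    · split_ifs
      · exact measurable_one.indicator (ht i)
      · exact measurable_const
    · split_ifs
      · exact hf i
      · exact measurable_const
  have e1 : ∀ y : ι → X, (Set.pi (u : Set ι) t).indicator (fun y => ∏ i ∈ s, f i (y i)) y
      = ∏ i ∈ u ∪ s, g i (y i) := by
    intro y
    simp only [hg, Finset.prod_mul_distrib]
    rw [Finset.prod_ite_mem, Finset.prod_ite_mem, Finset.inter_eq_right.2 Finset.subset_union_left,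
      Finset.inter_eq_right.2 Finset.subset_union_right]
    by_cases hy : y ∈ Set.pi (u : Set ι) t
    · have h3 : ∏ i ∈ u, (t i).indicator (1 : X → ENNReal) (y i) = 1 := by
        apply Finset.prod_eq_one
        intro i hi
        simp [hy i hi]
      rw [Set.indicator_of_mem hy, h3, one_mul]
    · rw [Set.indicator_of_notMem hy]
      simp only [Set.mem_pi, not_forall] at hy
      obtain ⟨i, hi, hyi⟩ := hy
      rw [Finset.prod_eq_zero (i := i) hi (by simp [hyi]), zero_mul]
  rw [lintegral_congr e1]
  rw [lintegral_prod_eq_prod_lintegral_of_indepFun (u ∪ s) (fun i (y : ι → X) => g i (y i))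
    (iIndepFun_infinitePi hgm) (fun i => (hgm i).comp (measurable_pi_apply i))]
  have e2 : ∀ i, ∫⁻ y, g i (y i) ∂(Measure.infinitePi μ) = ∫⁻ x, g i x ∂(μ i) := by
    intro i
    rw [← Measure.infinitePi_map_eval μ i, lintegral_map (hgm i) (measurable_pi_apply i)]
  simp_rw [e2]
  have e3 : ∀ i, ∫⁻ x, g i x ∂(μ i) = if i ∈ u then ν i (t i) else 1 := by
    intro i
    have hνμ : ∀ A, MeasurableSet A → ν i A = ∫⁻ x in A, (if i ∈ s then f i x else 1) ∂(μ i) := by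
      intro A hA
      by_cases his : i ∈ s
      · simp [his, h1 i his, withDensity_apply _ hA]
      · simp [his, h2 i his]
    by_cases hi : i ∈ u
    · simp only [hg, hi, if_true]
      rw [hνμ _ (ht i), ← lintegral_indicator (ht i)]
      apply lintegral_congr
      intro x
      by_cases hx : x ∈ t i <;> simp [hx]
    · simp only [hg, hi, if_false, one_mul]
      have := hνμ Set.univ MeasurableSet.univ
      rw [Measure.restrict_univ, measure_univ] at this
      exact this.symm
  simp_rw [e3]
  rw [Finset.prod_ite_mem, Finset.inter_eq_right.2 Finset.subset_union_left]


lemma expM_integrable : Integrable (fun x : ℝ => x) (expMeasure 1) := by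
  have hfin : ∀ᵐ x ∂(volume : Measure ℝ), (Set.Ici (0:ℝ)).indicator (fun x => ENNReal.ofReal (Real.exp (-x))) x < ⊤ := by
    refine Filter.Eventually.of_forall (fun x => ?_)
    by_cases hx : 0 ≤ x <;> simp [Set.indicator, hx]
  rw [expM_eq, integrable_withDensity_iff_integrable_smul' expD_meas hfin]
  have h := Real.GammaIntegral_convergent (s := 2) (by norm_num)
  have h' : IntegrableOn (fun x : ℝ => Real.exp (-x) * x) (Set.Ici 0) := by
    rw [integrableOn_Ici_iff_integrableOn_Ioi]
    refine h.congr_fun ?_ measurableSet_Ioi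
    intro x hx
    norm_num
  rw [← integrable_indicator_iff measurableSet_Ici] at h'
  refine h'.congr (Filter.Eventually.of_forall (fun x => ?_))
  by_cases hx : 0 ≤ x <;> simp [Set.indicator, hx, ENNReal.toReal_ofReal (Real.exp_nonneg _)]

lemma expM_charFun (c t : ℝ) :
    charFun ((expMeasure 1).map (fun s => c * s - c)) t = ephi (c * t) := by
  have hfin : ∀ᵐ x ∂(volume : Measure ℝ), (Set.Ici (0:ℝ)).indicator (fun x => ENNReal.ofReal (Real.exp (-x))) x < ⊤ := by
    refine Filter.Eventually.of_forall (fun x => ?_)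
    by_cases hx : 0 ≤ x <;> simp [Set.indicator, hx]
  rw [charFun_apply_real, integral_map (by fun_prop) (by fun_prop), expM_eq,
    integral_withDensity_eq_integral_toReal_smul expD_meas hfin]
  have e1 : ∀ x : ℝ, ((Set.Ici (0:ℝ)).indicator (fun x => ENNReal.ofReal (Real.exp (-x))) x).toReal •
      Complex.exp (t * ((c * x - c : ℝ) : ℂ) * Complex.I) =
      (Set.Ici (0:ℝ)).indicator (fun x : ℝ => Complex.exp (-((c * t : ℝ) * Complex.I)) *
        Complex.exp ((((c * t : ℝ) : ℂ) * Complex.I - 1) * x)) x := by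
    intro x
    by_cases hx : 0 ≤ x
    · simp only [Set.indicator, Set.mem_Ici, hx, if_true, ENNReal.toReal_ofReal (Real.exp_nonneg _)]
      rw [← Complex.exp_add, Complex.real_smul, Complex.ofReal_exp, ← Complex.exp_add]
      congr 1
      push_cast
      ring
    · simp [Set.indicator, hx]
  rw [integral_congr_ae (Filter.Eventually.of_forall e1), integral_indicator measurableSet_Ici,
    integral_Ici_eq_integral_Ioi, integral_const_mul, integral_exp_mul_complex_Ioi (by simp)]
  unfold ephi
  have h0 := one_sub_ne (c * t)
  have h0' : ((c * t : ℝ) : ℂ) * Complex.I - 1 ≠ 0 := by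
    intro h; apply h0; linear_combination -h
  simp only [Complex.ofReal_zero, mul_zero, Complex.exp_zero]
  field_simp
  ring

instance simoLaw_prob (r : ℕ) (x : ℝ) : IsProbabilityMeasure (simoLaw r x) := by
  unfold simoLaw
  have : IsProbabilityMeasure ((expMeasure 1).map (fun s => (1 + x) * s)) :=
    Measure.isProbabilityMeasure_map (by fun_prop)
  infer_instance

instance chan_prob (x : ℝ) : IsProbabilityMeasure ((expMeasure 1).map (fun s => (1 + x) * s)) :=
    Measure.isProbabilityMeasure_map (by fun_prop)

/-- output law of codeword `c` -/
noncomputable def outLaw (r : ℕ) (c : ℕ → ℝ) : Measure (ℕ → Fin r → ℝ) :=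
  Measure.infinitePi (fun i => simoLaw r (c i))

instance (r : ℕ) (c : ℕ → ℝ) : IsProbabilityMeasure (outLaw r c) := by
  unfold outLaw; infer_instance

/-- the centered statistic over `b` -/
noncomputable def stX {r : ℕ} (c : ℕ → ℝ) (b : Finset (ℕ × Fin r)) (y : ℕ → Fin r → ℝ) : ℝ :=
  ∑ p ∈ b, (y p.1 p.2 * (c p.1 / (1 + c p.1)) - c p.1)

lemma stX_meas {r : ℕ} (c : ℕ → ℝ) (b : Finset (ℕ × Fin r)) : Measurable (stX c b) := by
  unfold stX; fun_prop

lemma outLaw_eval {r : ℕ} (c : ℕ → ℝ) (p : ℕ × Fin r) :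
    (outLaw r c).map (fun y => y p.1 p.2) = (expMeasure 1).map (fun s => (1 + c p.1) * s) := by
  have h1 := Measure.infinitePi_map_eval (fun i => simoLaw r (c i)) p.1
  have h2 : (simoLaw r (c p.1)).map (fun x => x p.2) = (expMeasure 1).map (fun s => (1 + c p.1) * s) := by
    unfold simoLaw
    exact (measurePreserving_eval _ p.2).map_eq
  rw [← h2, ← h1, Measure.map_map (by fun_prop) (by fun_prop)]
  rfl

lemma outLaw_law {r : ℕ} (c : ℕ → ℝ) (hc : ∀ i, 0 ≤ c i) (b : Finset (ℕ × Fin r)) :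
    IsExpSum b (fun p => c p.1) ((outLaw r c).map (stX c b)) := by
  have hmap : ∀ p : ℕ × Fin r, (outLaw r c).map (fun y => y p.1 p.2 * (c p.1 / (1 + c p.1)) - c p.1)
      = (expMeasure 1).map (fun s => c p.1 * s - c p.1) := by
    intro p
    have : (fun y : ℕ → Fin r → ℝ => y p.1 p.2 * (c p.1 / (1 + c p.1)) - c p.1) =
      (fun z : ℝ => z * (c p.1 / (1 + c p.1)) - c p.1) ∘ (fun y => y p.1 p.2) := rfl
    rw [this, ← Measure.map_map (by fun_prop) (by fun_prop), outLaw_eval,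
      Measure.map_map (by fun_prop) (by fun_prop)]
    congr 1
    funext s
    have := hc p.1
    simp only [Function.comp]
    field_simp
  have hind : iIndepFun (fun (p : ℕ × Fin r) (y : ℕ → Fin r → ℝ) =>
      y p.1 p.2 * (c p.1 / (1 + c p.1)) - c p.1) (outLaw r c) := by
    obtain ⟨ν, hν⟩ : ∃ ν : ℕ → Fin r → Measure ℝ, ν = fun i _ => (expMeasure 1).map (fun s => (1 + c i) * s) :=
      ⟨_, rfl⟩
    have hpr : ∀ (i : ℕ) (j : Fin r), IsProbabilityMeasure (ν i j) := by
      rw [hν]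
      exact fun i _ => chan_prob (c i)
    have := iIndepFun_uncurry_infinitePi' (ι := ℕ) (κ := Fin r) (Ω := fun _ _ => ℝ) (mΩ := fun _ _ => Real.measurableSpace) (𝓧 := fun _ _ => ℝ) (X := fun (i : ℕ) (k : Fin r) (z : ℝ) =>
        z * (c i / (1 + c i)) - c i)
      ν (by fun_prop)
    simp only [Measure.infinitePi_eq_pi] at this
    rw [hν] at this
    exact this
  refine ⟨Measure.isProbabilityMeasure_map (stX_meas c b).aemeasurable, ?_, ?_⟩
  · rw [integrable_map_measure (by fun_prop) (stX_meas c b).aemeasurable]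
    unfold stX
    apply integrable_finsetSum
    intro p _
    have hi : Integrable (fun x => x) ((expMeasure 1).map (fun s => c p.1 * s - c p.1)) := by
      rw [integrable_map_measure (by fun_prop) (by fun_prop)]
      exact (expM_integrable.const_mul (c p.1)).sub (integrable_const _)
    rw [← hmap p, integrable_map_measure (by fun_prop) (Measurable.aemeasurable (by fun_prop))] at hi
    exact hi
  · intro t
    unfold stX
    rw [iIndepFun.charFun_map_fun_finsetSum_eq_prod (fun p _ => Measurable.aemeasurable (by fun_prop)) (hind.restrict b),
      Finset.prod_apply]
    refine Finset.prod_congr rfl (fun p _ => ?_)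
    rw [hmap, expM_charFun]


lemma isPiNat_outLaw (r : ℕ) (c : ℕ → ℝ) : IsPiNat (fun i => simoLaw r (c i)) (outLaw r c) := by
  refine ⟨inferInstance, ?_⟩
  intro s A hA
  have : {y : ℕ → Fin r → ℝ | ∀ i ∈ s, y i ∈ A i} = Set.pi (s : Set ℕ) A := by
    ext y; simp [Set.mem_pi]
  rw [this]
  exact Measure.infinitePi_pi _ (fun i _ => hA i)

lemma eq_outLaw {r : ℕ} {c : ℕ → ℝ} {μ : Measure (ℕ → Fin r → ℝ)}
    (h : IsPiNat (fun i => simoLaw r (c i)) μ) : μ = outLaw r c := by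
  apply Measure.eq_infinitePi
  intro s t ht
  rw [← h.2 s t ht]
  congr 1

lemma outLaw_congr {r : ℕ} {c c' : ℕ → ℝ} (s : Finset ℕ) (hcc : ∀ i ∈ s, c i = c' i)
    {D : Set (ℕ → Fin r → ℝ)} (hD : MeasurableSet D)
    (hdep : ∀ y y' : ℕ → Fin r → ℝ, (∀ i ∈ s, y i = y' i) → y ∈ D → y' ∈ D) :
    outLaw r c D = outLaw r c' D := by
  classical
  set ex : (s → Fin r → ℝ) → (ℕ → Fin r → ℝ) := fun z i => if h : i ∈ s then z ⟨i, h⟩ else 0 with hex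
  have hexm : Measurable ex := by
    rw [measurable_pi_iff]
    intro i
    simp only [hex]
    by_cases h : i ∈ s
    · simp only [h, dif_pos]; exact measurable_pi_apply _
    · simp only [h]; exact measurable_const
  have hDc : D = cylinder s (ex ⁻¹' D) := by
    ext y
    simp only [mem_cylinder, Set.mem_preimage]
    have hy : ∀ i ∈ s, y i = ex (s.restrict y) i := by
      intro i hi
      simp [hex, hi]
    exact ⟨hdep _ _ hy, hdep _ _ (fun i hi => (hy i hi).symm)⟩
  rw [hDc]
  unfold outLaw
  rw [Measure.infinitePi_cylinder _ (hexm hD), Measure.infinitePi_cylinder _ (hexm hD)]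
  congr 2
  funext i
  rw [hcc i i.2]

/-- information density -/
noncomputable def stI {r : ℕ} (c : ℕ → ℝ) (s : Finset ℕ) (y : ℕ → Fin r → ℝ) : ℝ :=
  ∑ p ∈ s ×ˢ (Finset.univ : Finset (Fin r)), (y p.1 p.2 * c p.1 / (1 + c p.1) - Real.log (1 + c p.1))

lemma stI_meas {r : ℕ} (c : ℕ → ℝ) (s : Finset ℕ) : Measurable (stI (r := r) c s) := by
  unfold stI; fun_prop

lemma stI_eq {r : ℕ} (c : ℕ → ℝ) (s : Finset ℕ) (y : ℕ → Fin r → ℝ) :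
    stI c s y = stX c (s ×ˢ Finset.univ) y + ∑ p ∈ s ×ˢ (Finset.univ : Finset (Fin r)), c p.1
      - ∑ p ∈ s ×ˢ (Finset.univ : Finset (Fin r)), Real.log (1 + c p.1) := by
  unfold stI stX
  rw [← Finset.sum_add_distrib, ← Finset.sum_sub_distrib]
  refine Finset.sum_congr rfl (fun p _ => ?_)
  ring

lemma simo_density {r : ℕ} {x : ℝ} (hx : 0 ≤ x) :
    simoLaw r x = (simoLaw r 0).withDensity (fun y => ∏ k, chanD x (y k)) := by
  unfold simoLaw
  rw [← Measure.infinitePi_eq_pi, ← Measure.infinitePi_eq_pi]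
  exact infPi_withDensity _ _ (fun _ => chanD x) (fun _ => chanD_meas x) Finset.univ
    (fun i _ => chan_density hx) (by simp)

lemma out_density {r : ℕ} {c : ℕ → ℝ} (hc : ∀ i, 0 ≤ c i) (s : Finset ℕ) (hs : ∀ i ∉ s, c i = 0) :
    outLaw r c = (outLaw r 0).withDensity (fun y => ENNReal.ofReal (Real.exp (stI c s y))) := by
  unfold outLaw
  rw [infPi_withDensity (fun i => simoLaw r ((0 : ℕ → ℝ) i)) (fun i => simoLaw r (c i))
    (fun i (z : Fin r → ℝ) => ∏ k, chanD (c i) (z k)) ?_ s ?_ ?_]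
  · congr 1
    funext y
    unfold stI
    rw [Real.exp_sum, ENNReal.ofReal_prod_of_nonneg (fun _ _ => Real.exp_nonneg _), Finset.prod_product]
    rfl
  · intro i
    apply Finset.measurable_fun_prod
    intro k _
    exact (chanD_meas _).comp (measurable_pi_apply k)
  · intro i _
    exact simo_density (hc i)
  · intro i hi
    simp [hs i hi]

lemma change_meas {r : ℕ} {c : ℕ → ℝ} (hc : ∀ i, 0 ≤ c i) (s : Finset ℕ) (hs : ∀ i ∉ s, c i = 0)
    (γ : ℝ) {D : Set (ℕ → Fin r → ℝ)} (hD : MeasurableSet D) :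
    (outLaw r c).real D ≤ (outLaw r c).real {y | γ < stI c s y} + Real.exp γ * (outLaw r 0).real D := by
  have hm : MeasurableSet {y : ℕ → Fin r → ℝ | stI c s y ≤ γ} :=
    measurableSet_le (stI_meas c s) measurable_const
  have h1 : D ⊆ {y | γ < stI c s y} ∪ (D ∩ {y | stI c s y ≤ γ}) := by
    intro y hy
    by_cases h : γ < stI c s y
    · exact Or.inl h
    · exact Or.inr ⟨hy, not_lt.1 h⟩
  have h2 : (outLaw r c) (D ∩ {y | stI c s y ≤ γ}) ≤ ENNReal.ofReal (Real.exp γ) * (outLaw r 0) D := by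
    rw [out_density hc s hs, withDensity_apply _ (hD.inter hm)]
    calc ∫⁻ y in D ∩ {y | stI c s y ≤ γ}, ENNReal.ofReal (Real.exp (stI c s y)) ∂(outLaw r 0)
        ≤ ∫⁻ y in D ∩ {y | stI c s y ≤ γ}, ENNReal.ofReal (Real.exp γ) ∂(outLaw r 0) := by
          apply setLIntegral_mono (by fun_prop)
          intro y hy
          apply ENNReal.ofReal_le_ofReal
          exact Real.exp_le_exp.2 hy.2
      _ = ENNReal.ofReal (Real.exp γ) * (outLaw r 0) (D ∩ {y | stI c s y ≤ γ}) := by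
          rw [setLIntegral_const]
      _ ≤ _ := by gcongr; exact Set.inter_subset_left
  have h3 : (outLaw r c).real (D ∩ {y | stI c s y ≤ γ}) ≤ Real.exp γ * (outLaw r 0).real D := by
    unfold Measure.real
    rw [← ENNReal.toReal_ofReal (Real.exp_nonneg γ), ← ENNReal.toReal_mul]
    apply ENNReal.toReal_mono _ h2
    exact ENNReal.mul_ne_top ENNReal.ofReal_ne_top (measure_ne_top _ _)
  calc (outLaw r c).real D ≤ _ := measureReal_mono h1
    _ ≤ _ := measureReal_union_le _ _
    _ ≤ _ := by linarith

lemma null_tail {r : ℕ} {c : ℕ → ℝ} (hc : ∀ i, 0 ≤ c i) (s : Finset ℕ) (hs : ∀ i ∉ s, c i = 0)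
    (γ : ℝ) : (outLaw r 0).real {y | γ < stI c s y} ≤ Real.exp (-γ) := by
  have hm : MeasurableSet {y : ℕ → Fin r → ℝ | γ < stI c s y} :=
    measurableSet_lt measurable_const (stI_meas c s)
  have h2 : ENNReal.ofReal (Real.exp γ) * (outLaw r 0) {y | γ < stI c s y} ≤ 1 := by
    calc ENNReal.ofReal (Real.exp γ) * (outLaw r 0) {y | γ < stI c s y}
        = ∫⁻ y in {y | γ < stI c s y}, ENNReal.ofReal (Real.exp γ) ∂(outLaw r 0) := by
          rw [setLIntegral_const]
      _ ≤ ∫⁻ y in {y | γ < stI c s y}, ENNReal.ofReal (Real.exp (stI c s y)) ∂(outLaw r 0) := by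
          apply setLIntegral_mono
          · exact (Real.measurable_exp.comp (stI_meas c s)).ennreal_ofReal
          intro y hy
          apply ENNReal.ofReal_le_ofReal
          exact Real.exp_le_exp.2 (le_of_lt hy)
      _ = outLaw r c {y | γ < stI c s y} := by
          rw [out_density hc s hs, withDensity_apply _ hm]
      _ ≤ 1 := prob_le_one
  have h3 : Real.exp γ * (outLaw r 0).real {y | γ < stI c s y} ≤ 1 := by
    unfold Measure.real
    rw [← ENNReal.toReal_ofReal (Real.exp_nonneg γ), ← ENNReal.toReal_mul]
    exact ENNReal.toReal_mono ENNReal.one_ne_top h2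
  rw [Real.exp_neg, ← one_div, le_div_iff₀ (Real.exp_pos _)]
  linarith

lemma cyl_approx {r : ℕ} (P Q : Measure (ℕ → Fin r → ℝ)) [IsProbabilityMeasure P] [IsProbabilityMeasure Q]
    {G : Set (ℕ → Fin r → ℝ)} (hG : MeasurableSet G) {θ : ℝ} (hθ : 0 < θ) :
    ∃ s : Finset ℕ, ∃ D, MeasurableSet D ∧
      (∀ y y' : ℕ → Fin r → ℝ, (∀ i ∈ s, y i = y' i) → y ∈ D → y' ∈ D) ∧
      P.real G ≤ P.real D + θ ∧ Q.real D ≤ Q.real G + θ := by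
  obtain ⟨D, hD, hlt⟩ := exists_measure_symmDiff_lt_of_generateFrom_isSetRing (μ := P + Q)
    (C := measurableCylinders (fun _ : ℕ => Fin r → ℝ)) (isSetRing_measurableCylinders)
    ⟨{Set.univ}, by simp, by rw [Set.singleton_subset_iff]; exact univ_mem_measurableCylinders _, by simp⟩
    (generateFrom_measurableCylinders).symm hG (ε := ENNReal.ofReal θ) (by simpa using hθ)
  have hDm : MeasurableSet D := MeasurableSet.of_mem_measurableCylinders hD
  obtain ⟨s, S, hS, rfl⟩ := (mem_measurableCylinders D).1 hD
  rw [Measure.add_apply] at hlt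
  have key : ∀ (R : Measure (ℕ → Fin r → ℝ)) (A B : Set (ℕ → Fin r → ℝ)), IsProbabilityMeasure R →
      R (symmDiff A B) ≤ ENNReal.ofReal θ → R.real A ≤ R.real B + θ := by
    intro R A B _ h
    have h1 : A ⊆ B ∪ symmDiff A B := by
      intro y hy
      by_cases hB : y ∈ B
      · exact Or.inl hB
      · exact Or.inr (Or.inl ⟨hy, hB⟩)
    have h2 : R.real (symmDiff A B) ≤ θ := by
      unfold Measure.real
      exact ENNReal.toReal_le_of_le_ofReal hθ.le h
    linarith [measureReal_mono (μ := R) h1, measureReal_union_le (μ := R) B (symmDiff A B)]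
  refine ⟨s, _, hDm, ?_, ?_, ?_⟩
  · intro y y' h hy
    simp only [mem_cylinder] at hy ⊢
    have : s.restrict y' = s.restrict y := by
      funext i; exact (h i i.2).symm
    rw [this]; exact hy
  · apply key P _ _ inferInstance
    rw [symmDiff_comm]
    exact le_trans le_self_add hlt.le
  · apply key Q _ _ inferInstance
    exact le_trans le_add_self hlt.le

lemma meta_converse {r M : ℕ} {E ε γ δ : ℝ} (hE : 0 ≤ E) (hε : 0 ≤ ε) (code : SimoCode r E M ε)
    (h : ∀ c : ℕ → ℝ, (∀ i, 0 ≤ c i) → ∀ s : Finset ℕ, (∀ i ∉ s, c i = 0) → ∑ i ∈ s, c i ≤ E →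
      ε + δ ≤ (outLaw r c).real {y | stI c s y ≤ γ}) : M * δ ≤ Real.exp γ := by
  classical
  have hMpos : 0 < M := by
    have := (code.dec (fun _ _ => 0)).pos
    exact this
  have hM' : (0:ℝ) < M := by exact_mod_cast hMpos
  have hGm : ∀ j, MeasurableSet {y | code.dec y = j} := fun j => code.meas_dec (measurableSet_singleton j)
  have hsum : ∑ j, (outLaw r 0).real {y | code.dec y = j} = 1 := by
    have := sum_measureReal_preimage_singleton (μ := outLaw r 0) (Finset.univ : Finset (Fin M)) (f := code.dec)
      (fun j _ => hGm j)
    have h2 : (outLaw r 0).real (code.dec ⁻¹' ↑(Finset.univ : Finset (Fin M))) = 1 := by simp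
    rw [h2] at this
    exact this
  have : Nonempty (Fin M) := ⟨⟨0, hMpos⟩⟩
  obtain ⟨j, -, hj⟩ : ∃ j ∈ (Finset.univ : Finset (Fin M)), (outLaw r 0).real {y | code.dec y = j} ≤ 1 / (M:ℝ) := by
    apply Finset.exists_le_of_sum_le Finset.univ_nonempty
    rw [hsum]
    simp [hM'.ne']
  set c := code.enc j with hc
  have hPj : 1 - ε ≤ (outLaw r c).real {y | code.dec y = j} := by
    have h1 := code.err j (outLaw r c) (isPiNat_outLaw r c)
    have h2 : {y | code.dec y ≠ j} = {y | code.dec y = j}ᶜ := rfl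
    have h3 : (outLaw r c).real {y | code.dec y ≠ j} ≤ ε := ENNReal.toReal_le_of_le_ofReal hε h1
    rw [h2, probReal_compl_eq_one_sub (hGm j)] at h3
    linarith
  have key : ∀ θ > 0, δ ≤ Real.exp γ / M + θ * (1 + Real.exp γ) := by
    intro θ hθ
    obtain ⟨s, D, hDm, hdep, hP, hQ⟩ := cyl_approx (outLaw r c) (outLaw r 0) (hGm j) hθ
    set c' : ℕ → ℝ := fun i => if i ∈ s then c i else 0 with hc'
    have e1 : (outLaw r c).real D = (outLaw r c').real D := by
      unfold Measure.real
      rw [outLaw_congr s (c := c) (c' := c') (fun i hi => by simp [hc', hi]) hDm hdep]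
    have hc'0 : ∀ i, 0 ≤ c' i := by
      intro i; simp only [hc']; split_ifs
      · exact code.enc_nonneg j i
      · exact le_rfl
    have hs' : ∀ i ∉ s, c' i = 0 := fun i hi => by simp [hc', hi]
    have h1 := change_meas (r := r) hc'0 s hs' γ hDm
    have hcost : ∑ i ∈ s, c' i ≤ E := by
      have h2 : ∑ i ∈ s, c' i = ∑ i ∈ s, c i := Finset.sum_congr rfl (fun i hi => by simp [hc', hi])
      have h3 : ∑ i ∈ s, ENNReal.ofReal (c i) ≤ ENNReal.ofReal E :=
        le_trans (ENNReal.sum_le_tsum s) (code.cost j)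
      rw [← ENNReal.ofReal_sum_of_nonneg (fun i _ => code.enc_nonneg j i),
        ENNReal.ofReal_le_ofReal_iff hE] at h3
      rw [h2]; exact h3
    have h4 := h c' hc'0 s hs' hcost
    have hm : MeasurableSet {y : ℕ → Fin r → ℝ | stI c' s y ≤ γ} :=
      measurableSet_le (stI_meas c' s) measurable_const
    have h5 : (outLaw r c').real {y | γ < stI c' s y} = 1 - (outLaw r c').real {y | stI c' s y ≤ γ} := by
      rw [← probReal_compl_eq_one_sub hm]
      congr 1
      ext y; simp
    have h6 : Real.exp γ * (outLaw r 0).real D ≤ Real.exp γ * (1 / M + θ) := by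
      apply mul_le_mul_of_nonneg_left _ (Real.exp_nonneg _)
      linarith
    have h7 : Real.exp γ * (1 / M + θ) = Real.exp γ / M + Real.exp γ * θ := by ring
    linarith
  have hδ : δ ≤ Real.exp γ / M := by
    apply le_of_forall_pos_le_add
    intro θ hθ
    have hp : 0 < 1 + Real.exp γ := by positivity
    have := key (θ / (1 + Real.exp γ)) (by positivity)
    rwa [div_mul_cancel₀ _ hp.ne'] at this
  rw [le_div_iff₀ hM'] at hδ
  linarith


lemma ev_pow_le_exp (C : ℝ) (n : ℕ) : ∀ᶠ l : ℝ in Filter.atTop, C * l ^ n ≤ Real.exp (l ^ 3 / 6) := by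
  have h := Real.tendsto_pow_mul_exp_neg_atTop_nhds_zero n
  have h1 := h.eventually (gt_mem_nhds (show (0:ℝ) < 1 / (|C| + 1) by positivity))
  filter_upwards [h1, Filter.eventually_ge_atTop (3:ℝ)] with l hl h3
  rw [Real.exp_neg, ← div_eq_mul_inv, div_lt_div_iff₀ (Real.exp_pos _) (by positivity)] at hl
  have h4 : Real.exp l ≤ Real.exp (l ^ 3 / 6) := by
    apply Real.exp_le_exp.2
    nlinarith [mul_nonneg (show 0 ≤ l by linarith) (show 0 ≤ l ^ 2 - 6 by nlinarith)]
  have h5 : C * l ^ n ≤ |C| * l ^ n := mul_le_mul_of_nonneg_right (le_abs_self C) (by positivity)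
  have h6 : 0 ≤ l ^ n := by positivity
  linarith

lemma sum_prod_univ {r : ℕ} (c : ℕ → ℝ) (s : Finset ℕ) :
    ∑ p ∈ s ×ˢ (Finset.univ : Finset (Fin r)), c p.1 = r * ∑ i ∈ s, c i := by
  rw [Finset.sum_product]
  simp [Finset.mul_sum]

lemma converse_l {q G : ℝ} (hq : 0 < q) (hG : 0 < G) (hG3 : G ^ 3 = 9 * q ^ 2 / 4) :
    ∃ l₀ : ℝ, ∀ l ≥ l₀, ∀ (r : ℕ) (E : ℝ) (M : ℕ), 0 < r → r * E = Real.exp (l ^ 3 / 6) ^ 6 →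
      Nonempty (SimoCode r E M (gPhi (-q))) →
      (M : ℝ) ≤ l ^ 6 * Real.exp (Real.exp (l ^ 3 / 6) ^ 6 - G * Real.exp (l ^ 3 / 6) ^ 4 * l
        + Real.exp (l ^ 3 / 6) ^ 4 / l ^ 2) := by
  have hε : gPhi (-q) < 1 / 2 := by
    have := gPhi_incr (a := -q) (b := 0) (m := q) (by linarith) (by linarith) (by linarith)
    rw [gPhi_zero] at this
    have h2 := mul_pos (gphi_pos q) hq
    linarith
  obtain ⟨δ, hδ, η, hη, hquant⟩ := quantile_uniform hε
  set C₁ := G / δ with hC₁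
  have hC₁0 : 0 < C₁ := by positivity
  set c₀ := gphi q / (2 * (C₁ + 1)) with hc₀
  have hc₀0 : 0 < c₀ := div_pos (gphi_pos q) (by positivity)
  have ev : ∀ᶠ l : ℝ in Filter.atTop, 2 ≤ l ∧ 1 / l ^ 6 ≤ η ∧ 6 * G ≤ l ^ 2 ∧ 1 / (2 * l ^ 2) ≤ q ∧
      3 ≤ c₀ * l ^ 3 ∧ (24 * C₁ ^ 2 + 1) * l ^ 32 ≤ Real.exp (l ^ 3 / 6) := by
    filter_upwards [Filter.eventually_ge_atTop 2, Filter.eventually_ge_atTop (1/η),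
      Filter.eventually_ge_atTop (6 * G), Filter.eventually_ge_atTop (1/q),
      Filter.eventually_ge_atTop (3/c₀), ev_pow_le_exp (24 * C₁ ^ 2 + 1) 32] with l h1 h2 h3 h4 h5 h6
    have hl1 : 1 ≤ l := by linarith
    have hl2 : l ≤ l ^ 2 := le_self_pow₀ hl1 (by norm_num)
    have hl3 : l ≤ l ^ 3 := le_self_pow₀ hl1 (by norm_num)
    have hl6 : l ≤ l ^ 6 := le_self_pow₀ hl1 (by norm_num)
    refine ⟨h1, ?_, by linarith, ?_, ?_, h6⟩
    · rw [div_le_iff₀ (by positivity)]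
      rw [div_le_iff₀ hη] at h2
      nlinarith
    · rw [div_le_iff₀ (by positivity)]
      rw [div_le_iff₀ hq] at h4
      nlinarith
    · rw [div_le_iff₀ hc₀0] at h5
      nlinarith
  obtain ⟨l₀, hl₀⟩ := Filter.eventually_atTop.1 ev
  refine ⟨l₀, ?_⟩
  intro l hl r E M hr hrE ⟨code⟩
  obtain ⟨hl2, hlη, hlG, hlq, hlc, hDl⟩ := hl₀ l hl
  obtain ⟨D, hD⟩ : ∃ D, D = Real.exp (l ^ 3 / 6) := ⟨_, rfl⟩
  rw [← hD] at hrE hDl ⊢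
  have hl0 : 0 < l := by linarith
  have hr' : (0:ℝ) < r := by exact_mod_cast hr
  have hD1 : 1 ≤ D := by rw [hD]; exact Real.one_le_exp (by positivity)
  have hlD : l ^ 3 = 6 * Real.log D := by rw [hD, Real.log_exp]; ring
  have hE0 : 0 ≤ E := by
    have : 0 < r * E := by rw [hrE]; positivity
    exact (pos_of_mul_pos_right this hr'.le).le
  have h := meta_converse (δ := 1 / l ^ 6) (γ := D ^ 6 - G * D ^ 4 * l + D ^ 4 / l ^ 2) hE0 (gPhi_nonneg _) code (by
    intro c hc s hs hcost
    have hA : ∑ p ∈ s ×ˢ (Finset.univ : Finset (Fin r)), c p.1 ≤ D ^ 6 := by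
      rw [sum_prod_univ, ← hrE]
      exact mul_le_mul_of_nonneg_left hcost hr'.le
    have h1 := converse_core hq hG hG3 hδ hC₁ hc₀ hquant hD1 hl2 hlD hlη hlG hlq hlc hDl
      (s := s ×ˢ (Finset.univ : Finset (Fin r))) (a := fun p => c p.1) (fun p _ => hc p.1) hA
      (fun b _ => ⟨_, outLaw_law c hc b⟩) (outLaw_law c hc _)
    refine le_trans h1 (le_of_eq ?_)
    rw [map_measureReal_apply (stX_meas _ _) measurableSet_Iic]
    congr 1
    ext y
    simp only [Set.mem_preimage, Set.mem_Iic, Set.mem_ofPred_eq, stI_eq]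
    constructor <;> intro h <;> linarith)
  rw [mul_one_div, div_le_iff₀ (by positivity)] at h
  linarith


lemma exists_decoder {Ω : Type*} [MeasurableSpace Ω] {M : ℕ} (hM : 0 < M) (A : Fin M → Set Ω)
    (hA : ∀ j, MeasurableSet (A j)) : ∃ f : Ω → Fin M, Measurable f ∧
      ∀ y j, y ∈ A j → (∀ i, i ≠ j → y ∉ A i) → f y = j := by
  classical
  set φ : Ω → (Fin M → Prop) := fun y j => y ∈ A j with hφ
  have hφm : Measurable φ := by
    rw [measurable_pi_iff]
    intro j
    exact measurable_mem.2 (hA j)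
  set F : (Fin M → Prop) → Fin M := fun p => if h : ∃ j, p j then h.choose else ⟨0, hM⟩ with hF
  refine ⟨F ∘ φ, (measurable_of_countable F).comp hφm, ?_⟩
  intro y j hj hn
  have hex : ∃ j, φ y j := ⟨j, hj⟩
  simp only [Function.comp, hF, hex, dif_pos]
  by_contra hne
  exact hn _ hne hex.choose_spec

lemma exists_code {r N M : ℕ} {E ε x γ η : ℝ} (hM : 0 < M) (hx : 0 ≤ x) (hNx : N * x ≤ E)
    (hMη : M * Real.exp (-γ) ≤ η)
    (h : ∀ {ι : Type} {b : Finset ι} {a : ι → ℝ} {μ : Measure ℝ}, (∀ i ∈ b, a i = x) →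
      b.card = r * N → IsExpSum b a μ →
      μ.real (Set.Iic (γ - (r * N : ℕ) * (x - Real.log (1 + x)))) ≤ ε - η) :
    Nonempty (SimoCode r E M ε) := by
  classical
  set s : ℕ → Finset ℕ := fun j => Finset.Ico (j * N) ((j + 1) * N) with hs
  set c : ℕ → ℕ → ℝ := fun j i => if i ∈ s j then x else 0 with hc
  have hc0 : ∀ j i, 0 ≤ c j i := by
    intro j i; simp only [hc]; split_ifs
    · exact hx
    · exact le_rfl
  have hcs : ∀ j, ∀ i ∉ s j, c j i = 0 := fun j i hi => by simp [hc, hi]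
  have hdisj : ∀ j m, j ≠ m → ∀ i ∈ s m, c j i = 0 := by
    intro j m hjm i hi
    apply hcs
    intro hi'
    simp only [hs, Finset.mem_Ico] at hi hi'
    rcases lt_or_gt_of_ne hjm with h1 | h1
    · have : (j + 1) * N ≤ m * N := Nat.mul_le_mul_right N h1
      omega
    · have : (m + 1) * N ≤ j * N := Nat.mul_le_mul_right N h1
      omega
  have hcard : ∀ j, (s j).card = N := by
    intro j
    simp only [hs, Nat.card_Ico]
    rw [← Nat.sub_mul]; simp
  have hm : ∀ j, MeasurableSet {y : ℕ → Fin r → ℝ | γ < stI (c j) (s j) y} := fun j =>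
    measurableSet_lt measurable_const (stI_meas _ _)
  obtain ⟨f, hfm, hf⟩ := exists_decoder hM (fun j : Fin M => {y : ℕ → Fin r → ℝ | γ < stI (c j) (s j) y})
    (fun j => hm j)
  refine ⟨⟨fun j => c j, fun j => hc0 j, f, hfm, ?_, ?_⟩⟩
  · intro j
    rw [tsum_eq_sum (s := s j) (fun i hi => by simp [hcs j i hi])]
    rw [← ENNReal.ofReal_sum_of_nonneg (fun i _ => hc0 j i)]
    apply ENNReal.ofReal_le_ofReal
    rw [Finset.sum_congr rfl (fun i hi => show c j i = x by simp [hc, hi])]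
    simp [hcard, hNx]
  · intro j μ hμ
    rw [eq_outLaw hμ]
    have hsub : {y | f y ≠ j} ⊆ {y | stI (c j) (s j) y ≤ γ} ∪
        ⋃ m ∈ (Finset.univ : Finset (Fin M)).erase j, {y | γ < stI (c m) (s m) y} := by
      intro y hy
      by_contra hcon
      simp only [Set.mem_union, Set.mem_iUnion, not_or, not_exists] at hcon
      apply hy
      apply hf y j
      · have hc1 : ¬ (stI (c j) (s j) y ≤ γ) := hcon.1
        exact not_le.1 hc1
      · intro i hij hi
        exact hcon.2 i (Finset.mem_erase.2 ⟨hij, Finset.mem_univ _⟩) hi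
    have h1 : (outLaw r (c j)).real {y | stI (c j) (s j) y ≤ γ} ≤ ε - η := by
      have h2 := h (b := s j ×ˢ (Finset.univ : Finset (Fin r))) (a := fun p => c j p.1)
        (fun p hp => by
          have := (Finset.mem_product.1 hp).1
          simp [hc, this])
        (by simp [hcard, mul_comm]) (outLaw_law (c j) (hc0 j) _)
      rw [map_measureReal_apply (stX_meas _ _) measurableSet_Iic] at h2
      refine le_trans (le_of_eq ?_) h2
      congr 1
      ext y
      simp only [Set.mem_preimage, Set.mem_Iic, Set.mem_ofPred_eq, stI_eq]
      rw [sum_prod_univ, sum_prod_univ (fun i => Real.log (1 + c j i)),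
        Finset.sum_congr rfl (fun i hi => show c j i = x by simp [hc, hi]),
        Finset.sum_congr rfl (fun i hi => show Real.log (1 + c j i) = Real.log (1 + x) by simp [hc, hi])]
      simp only [Finset.sum_const, hcard, nsmul_eq_mul]
      push_cast
      constructor <;> intro h <;> linarith
    have h3 : ∀ m ∈ (Finset.univ : Finset (Fin M)).erase j,
        (outLaw r (c j)).real {y | γ < stI (c m) (s m) y} ≤ Real.exp (-γ) := by
      intro m hm'
      have hjm : (j:ℕ) ≠ m := by
        intro h; exact (Finset.mem_erase.1 hm').1 (Fin.ext h.symm)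
      have : outLaw r (c j) {y | γ < stI (c m) (s m) y} = outLaw r 0 {y | γ < stI (c m) (s m) y} := by
        apply outLaw_congr (s m) (fun i hi => by simp [hdisj j m hjm i hi]) (hm m)
        intro y y' hyy hy
        have : stI (c m) (s m) y' = stI (c m) (s m) y := by
          unfold stI
          refine Finset.sum_congr rfl (fun p hp => ?_)
          rw [hyy p.1 (Finset.mem_product.1 hp).1]
        simp only [Set.mem_ofPred_eq] at hy ⊢
        rw [this]; exact hy
      unfold Measure.real
      rw [this]
      exact null_tail (hc0 m) (s m) (hcs m) γ
    have h4 : (outLaw r (c j)).real {y | f y ≠ j} ≤ ε := by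
      calc (outLaw r (c j)).real {y | f y ≠ j} ≤ _ := measureReal_mono hsub
        _ ≤ _ := measureReal_union_le _ _
        _ ≤ (ε - η) + ∑ m ∈ (Finset.univ : Finset (Fin M)).erase j, Real.exp (-γ) := by
            apply add_le_add h1
            exact le_trans (measureReal_biUnion_finset_le _ _) (Finset.sum_le_sum h3)
        _ ≤ (ε - η) + M * Real.exp (-γ) := by
            gcongr
            rw [Finset.sum_const, nsmul_eq_mul]
            apply mul_le_mul_of_nonneg_right _ (Real.exp_nonneg _)
            have : ((Finset.univ : Finset (Fin M)).erase j).card ≤ M := by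
              simp
            exact_mod_cast this
        _ ≤ ε := by linarith
    rw [← ENNReal.ofReal_toReal (measure_ne_top (outLaw r (c j)) _)]
    exact ENNReal.ofReal_le_ofReal h4

lemma sF_dirac {w m : ℝ} : sF (Measure.dirac 0) w m = gPhi (m / w) := by
  unfold sF
  rw [integral_dirac]
  simp

lemma isExpSum_dirac {ι : Type*} (a : ι → ℝ) : IsExpSum ∅ a (Measure.dirac 0) := by
  refine ⟨inferInstance, ?_, ?_⟩
  · exact integrable_dirac (by simp)
  · intro t
    simp [charFun_dirac]

lemma ach_gauss {ι : Type} {b : Finset ι} {a : ι → ℝ} {μ : Measure ℝ} {x σ q w h : ℝ} (hx : 0 ≤ x)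
    (ha : ∀ i ∈ b, a i = x) (hμ : IsExpSum b a μ) (hσ : 0 < σ) (hV : b.card * x ^ 2 ≤ σ ^ 2)
    (hw : 0 < w) (hwσ : w ≤ σ) (hq : 0 < q) (hqw : 2 * (q * w) ≤ h) (hh : h ≤ 4 * σ) :
    μ.real (Set.Iic (-(q * σ) - 2 * h)) ≤ gPhi (-q) - gphi (q + 1) * (h / (4 * σ))
      + 24 * (b.card * x ^ 3) / w ^ 3 + (w / h) ^ 2 := by
  classical
  have := hμ.prob
  have hh0 : 0 < h := by nlinarith [mul_pos hq hw]
  have h1 := le_sF μ (h := h) hw (-(q * σ) - 2 * h)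
  have h2 : gPhi (-(h / w)) ≤ (w / h) ^ 2 := by
    refine le_trans (gPhi_tail (by positivity)) (le_of_eq ?_)
    field_simp
  have h3 := sF_compare (Finset.empty_subset b) hμ (isExpSum_dirac a) hw (-(q * σ) - 2 * h + h)
  rw [sF_dirac, Finset.sdiff_empty, Finset.sum_congr rfl (fun i hi => by rw [ha i hi]),
    Finset.sum_congr rfl (fun i hi => show |a i| ^ 3 = x ^ 3 by rw [ha i hi, abs_of_nonneg hx])] at h3
  simp only [Finset.sum_const, nsmul_eq_mul] at h3
  have h4 := (abs_le.1 h3).2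
  set W := √(w ^ 2 + b.card * x ^ 2) with hW
  have hW0 : 0 < W := by rw [hW]; positivity
  have hW1 : W ≤ σ + w := by
    rw [hW]
    apply Real.sqrt_le_iff.2
    refine ⟨by positivity, ?_⟩
    nlinarith [mul_pos hσ hw]
  have h5 : (-(q * σ) - 2 * h + h) / W ≤ -q - h / (4 * σ) := by
    rw [div_le_iff₀ hW0]
    have e1 : q * W ≤ q * σ + q * w := by nlinarith
    have e2 : h / (4 * σ) * W ≤ h / (4 * σ) * (2 * σ) := by
      apply mul_le_mul_of_nonneg_left _ (by positivity)
      linarith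
    have e3 : h / (4 * σ) * (2 * σ) = h / 2 := by field_simp; ring
    nlinarith
  have h6 : gPhi ((-(q * σ) - 2 * h + h) / W) ≤ gPhi (-q - h / (4 * σ)) := gPhi_mono h5
  have h7 : h / (4 * σ) ≤ 1 := by rw [div_le_one (by positivity)]; exact hh
  have h8 := gPhi_incr (a := -q - h / (4 * σ)) (b := -q) (m := q + 1)
    (by have : 0 ≤ h / (4 * σ) := by positivity
        linarith) (by linarith) (by linarith)
  have h9 : -q - (-q - h / (4 * σ)) = h / (4 * σ) := by ring
  rw [h9] at h8
  linarith


lemma ach_prob {g q D l : ℝ} (hg : 0 < g) (hq : 0 < q) (hD : 1 ≤ D) (hl : 1 ≤ l)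
    (h1 : g ≤ l ^ 9) (h2 : 4 * q ≤ l ^ 6) (h3 : g ≤ 8 * l ^ 3) (h4 : 6 ≤ gphi (q + 1) * g / 8 * l ^ 3)
    (h5 : 24 / g ^ 4 * l ^ 34 ≤ D) {ι : Type} {b : Finset ι} {a : ι → ℝ} {μ : Measure ℝ}
    (ha : ∀ i ∈ b, a i = D ^ 2 * l ^ 2 / g ^ 2) (hμ : IsExpSum b a μ)
    (hn : b.card * (D ^ 2 * l ^ 2 / g ^ 2) ≤ D ^ 6) :
    μ.real (Set.Iic (-(q * (D ^ 4 * l / g)) - D ^ 4 / l ^ 2)) ≤ gPhi (-q) - 1 / l ^ 6 := by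
  have hD0 : 0 < D := by linarith
  have hl0 : 0 < l := by linarith
  obtain ⟨x, hx⟩ : ∃ x, x = D ^ 2 * l ^ 2 / g ^ 2 := ⟨_, rfl⟩
  rw [← hx] at ha hn
  have hx0 : 0 < x := by rw [hx]; positivity
  have key := ach_gauss (σ := D ^ 4 * l / g) (q := q) (w := D ^ 4 / l ^ 8) (h := D ^ 4 / (2 * l ^ 2))
    hx0.le ha hμ (by positivity) (by
      have e : (D ^ 4 * l / g) ^ 2 = D ^ 6 * x := by rw [hx]; field_simp
      rw [e]
      nlinarith) (by positivity) (by
      rw [div_le_div_iff₀ (by positivity) hg]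
      have : D ^ 4 * g ≤ D ^ 4 * l ^ 9 := mul_le_mul_of_nonneg_left h1 (by positivity)
      nlinarith) hq (by
      have : 2 * (q * (D ^ 4 / l ^ 8)) = (4 * q) * (D ^ 4 / (2 * l ^ 8)) := by field_simp; ring
      rw [this]
      have e : D ^ 4 / (2 * l ^ 2) = l ^ 6 * (D ^ 4 / (2 * l ^ 8)) := by field_simp
      rw [e]
      exact mul_le_mul_of_nonneg_right h2 (by positivity)) (by
      rw [div_le_iff₀ (by positivity)]
      have e : 4 * (D ^ 4 * l / g) * (2 * l ^ 2) = D ^ 4 * ((8 * l ^ 3) / g) := by field_simp; ring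
      rw [e]
      have : 1 ≤ 8 * l ^ 3 / g := by rw [le_div_iff₀ hg]; linarith
      have hD4 : 0 ≤ D ^ 4 := by positivity
      nlinarith)
  have e1 : -(q * (D ^ 4 * l / g)) - 2 * (D ^ 4 / (2 * l ^ 2)) = -(q * (D ^ 4 * l / g)) - D ^ 4 / l ^ 2 := by
    field_simp
  rw [e1] at key
  have e2 : D ^ 4 / (2 * l ^ 2) / (4 * (D ^ 4 * l / g)) = g / (8 * l ^ 3) := by field_simp; ring
  have e3 : (D ^ 4 / l ^ 8 / (D ^ 4 / (2 * l ^ 2))) ^ 2 = 4 / l ^ 12 := by field_simp; ring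
  rw [e2, e3] at key
  have e4 : 24 * (b.card * x ^ 3) / (D ^ 4 / l ^ 8) ^ 3 ≤ 1 / l ^ 6 := by
    have f1 : (b.card : ℝ) * x ^ 3 ≤ D ^ 6 * x ^ 2 := by
      have := mul_le_mul_of_nonneg_right hn (sq_nonneg x)
      nlinarith
    have f2 : 24 * (b.card * x ^ 3) / (D ^ 4 / l ^ 8) ^ 3 ≤ 24 * (D ^ 6 * x ^ 2) / (D ^ 4 / l ^ 8) ^ 3 := by
      gcongr
    have f3 : 24 * (D ^ 6 * x ^ 2) / (D ^ 4 / l ^ 8) ^ 3 = (24 / g ^ 4 * l ^ 34) / (D ^ 2 * l ^ 6) := by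
      rw [hx]; field_simp
    have f4 : (24 / g ^ 4 * l ^ 34) / (D ^ 2 * l ^ 6) ≤ D ^ 2 / (D ^ 2 * l ^ 6) := by
      apply div_le_div_of_nonneg_right _ (by positivity)
      nlinarith
    have f5 : D ^ 2 / (D ^ 2 * l ^ 6) = 1 / l ^ 6 := by field_simp
    linarith
  have e5 : 4 / l ^ 12 ≤ 4 / l ^ 6 := by
    apply div_le_div_of_nonneg_left (by norm_num) (by positivity)
    exact pow_le_pow_right₀ hl (by norm_num)
  have e6 : 6 / l ^ 6 ≤ gphi (q + 1) * (g / (8 * l ^ 3)) := by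
    have : gphi (q + 1) * (g / (8 * l ^ 3)) = (gphi (q + 1) * g / 8 * l ^ 3) / l ^ 6 := by field_simp
    rw [this]
    exact div_le_div_of_nonneg_right h4 (by positivity)
  have e7 : 6 / l ^ 6 = 1 / l ^ 6 + 4 / l ^ 6 + 1 / l ^ 6 := by ring
  linarith

lemma ach_gamma {g q D l n ρ : ℝ} (hg : 0 < g) (hq : q = 2 * g ^ 3 / 3) (hD : 1 ≤ D) (hl : 1 ≤ l)
    (hlD : l ^ 3 = 6 * Real.log D) (hn1 : n * (D ^ 2 * l ^ 2 / g ^ 2) ≤ D ^ 6)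
    (hn2 : D ^ 6 - ρ * (D ^ 2 * l ^ 2 / g ^ 2) ≤ n * (D ^ 2 * l ^ 2 / g ^ 2))
    (hx1 : 1 + l ^ 2 / g ^ 2 ≤ l ^ 3) (hρ : ρ / g ^ 2 * l ^ 4 ≤ D) :
    D ^ 6 - g ^ 2 * D ^ 4 * l - 3 * g ^ 2 * (D ^ 4 * Real.log l / l ^ 2) - 2 * (D ^ 4 / l ^ 2) ≤
      n * (D ^ 2 * l ^ 2 / g ^ 2 - Real.log (1 + D ^ 2 * l ^ 2 / g ^ 2)) - q * (D ^ 4 * l / g) - D ^ 4 / l ^ 2 := by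
  have hD0 : 0 < D := by linarith
  have hl0 : 0 < l := by linarith
  obtain ⟨x, hx⟩ : ∃ x, x = D ^ 2 * l ^ 2 / g ^ 2 := ⟨_, rfl⟩
  rw [← hx] at hn1 hn2 ⊢
  have hx0 : 0 < x := by rw [hx]; positivity
  have a1 : Real.log (1 + x) ≤ l ^ 3 / 3 + 3 * Real.log l := by
    have b1 : 1 + x ≤ D ^ 2 * l ^ 3 := by
      have b2 : D ^ 2 * (1 + l ^ 2 / g ^ 2) ≤ D ^ 2 * l ^ 3 := mul_le_mul_of_nonneg_left hx1 (by positivity)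
      have b3 : D ^ 2 * (1 + l ^ 2 / g ^ 2) = D ^ 2 + x := by rw [hx]; ring
      nlinarith
    calc Real.log (1 + x) ≤ Real.log (D ^ 2 * l ^ 3) := Real.log_le_log (by positivity) b1
      _ = 2 * Real.log D + 3 * Real.log l := by
          rw [Real.log_mul (by positivity) (by positivity), Real.log_pow, Real.log_pow]; norm_num
      _ = _ := by rw [hlD]; ring
  have a2 : 0 ≤ Real.log (1 + x) := Real.log_nonneg (by linarith)
  have hn3 : n ≤ g ^ 2 * D ^ 4 / l ^ 2 := by
    have : g ^ 2 * D ^ 4 / l ^ 2 = D ^ 6 / x := by rw [hx]; field_simp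
    rw [this, le_div_iff₀ hx0]; exact hn1
  have a3 : n * Real.log (1 + x) ≤ g ^ 2 * D ^ 4 / l ^ 2 * (l ^ 3 / 3 + 3 * Real.log l) := by
    calc n * Real.log (1 + x) ≤ g ^ 2 * D ^ 4 / l ^ 2 * Real.log (1 + x) :=
          mul_le_mul_of_nonneg_right hn3 a2
      _ ≤ _ := mul_le_mul_of_nonneg_left a1 (by positivity)
  have a4 : g ^ 2 * D ^ 4 / l ^ 2 * (l ^ 3 / 3 + 3 * Real.log l) =
      g ^ 2 * D ^ 4 * l / 3 + 3 * g ^ 2 * (D ^ 4 * Real.log l / l ^ 2) := by field_simp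
  have a5 : q * (D ^ 4 * l / g) = 2 / 3 * (g ^ 2 * D ^ 4 * l) := by rw [hq]; field_simp
  have a6 : ρ * x ≤ D ^ 4 / l ^ 2 := by
    rw [le_div_iff₀ (by positivity)]
    have : ρ * x * l ^ 2 = D ^ 2 * (ρ / g ^ 2 * l ^ 4) := by rw [hx]; field_simp
    rw [this]
    have c1 : D ^ 2 * (ρ / g ^ 2 * l ^ 4) ≤ D ^ 2 * D := mul_le_mul_of_nonneg_left hρ (by positivity)
    have c2 : D ^ 2 * D ≤ D ^ 4 := by
      have : D ^ 3 ≤ D ^ 4 := pow_le_pow_right₀ hD (by norm_num)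
      nlinarith
    linarith
  rw [a5]
  linarith

set_option maxHeartbeats 1600000 in
lemma ach_l {g q : ℝ} (hg : 0 < g) (hq : q = 2 * g ^ 3 / 3) (r : ℕ) (hr : 0 < r) :
    ∃ l₀ : ℝ, ∀ l ≥ l₀, ∀ E : ℝ, r * E = Real.exp (l ^ 3 / 6) ^ 6 →
      ∃ M : ℕ, 1 ≤ M ∧ Nonempty (SimoCode r E M (gPhi (-q))) ∧
      Real.exp (l ^ 3 / 6) ^ 6 - g ^ 2 * Real.exp (l ^ 3 / 6) ^ 4 * l
        - (3 * g ^ 2 + 3) * (Real.exp (l ^ 3 / 6) ^ 4 * Real.log l / l ^ 2) ≤ Real.log M := by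
  have hq0 : 0 < q := by rw [hq]; positivity
  have hr' : (0:ℝ) < r := by exact_mod_cast hr
  have hcg : 0 < gphi (q + 1) * g / 8 := by have := gphi_pos (q + 1); positivity
  have ev : ∀ᶠ l : ℝ in Filter.atTop, 3 ≤ l ∧ g ≤ l ∧ 4 * q ≤ l ∧ 6 ≤ gphi (q + 1) * g / 8 * l ∧
      1 + 1 / g ^ 2 ≤ l ∧
      24 / g ^ 4 * l ^ 34 ≤ Real.exp (l ^ 3 / 6) ∧ r / g ^ 2 * l ^ 4 ≤ Real.exp (l ^ 3 / 6) ∧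
      7 * l ^ 3 ≤ Real.exp (l ^ 3 / 6) ∧ (4 * g ^ 2 + 9) * l ^ 1 ≤ Real.exp (l ^ 3 / 6) := by
    filter_upwards [Filter.eventually_ge_atTop 3, Filter.eventually_ge_atTop g,
      Filter.eventually_ge_atTop (4 * q), Filter.eventually_ge_atTop (6 / (gphi (q + 1) * g / 8)),
      Filter.eventually_ge_atTop (1 + 1 / g ^ 2),
      ev_pow_le_exp (24 / g ^ 4) 34, ev_pow_le_exp (r / g ^ 2) 4, ev_pow_le_exp 7 3,
      ev_pow_le_exp (4 * g ^ 2 + 9) 1] with l h1 h2 h3 h4 h5 h6 h7 h8 h9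
    refine ⟨h1, h2, h3, ?_, h5, h6, h7, h8, h9⟩
    rw [div_le_iff₀ hcg] at h4
    linarith
  obtain ⟨l₀, hl₀⟩ := Filter.eventually_atTop.1 ev
  refine ⟨l₀, ?_⟩
  intro l hl E hrE
  obtain ⟨hl3, hlg, hlq, hlc, hlx, hD1, hD2, hD3, hD4⟩ := hl₀ l hl
  obtain ⟨D, hD⟩ : ∃ D, D = Real.exp (l ^ 3 / 6) := ⟨_, rfl⟩
  rw [← hD] at hrE hD1 hD2 hD3 hD4 ⊢
  have hl0 : 0 < l := by linarith
  have hl1 : 1 ≤ l := by linarith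
  have hDone : 1 ≤ D := by rw [hD]; exact Real.one_le_exp (by positivity)
  have hD0 : 0 < D := by linarith
  have hlD : l ^ 3 = 6 * Real.log D := by rw [hD, Real.log_exp]; ring
  have hE0 : 0 ≤ E := by
    have : 0 < r * E := by rw [hrE]; positivity
    exact (pos_of_mul_pos_right this hr'.le).le
  obtain ⟨x, hx⟩ : ∃ x, x = D ^ 2 * l ^ 2 / g ^ 2 := ⟨_, rfl⟩
  have hx0 : 0 < x := by rw [hx]; positivity
  set N := ⌊E / x⌋₊ with hN
  have hN1 : N * x ≤ E := by
    have := Nat.floor_le (show 0 ≤ E / x by positivity)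
    rwa [le_div_iff₀ hx0] at this
  have hN2 : E - x ≤ N * x := by
    have := Nat.lt_floor_add_one (E / x)
    rw [div_lt_iff₀ hx0] at this
    nlinarith
  have hn1 : ((r * N : ℕ) : ℝ) * x ≤ D ^ 6 := by
    push_cast
    rw [← hrE, mul_assoc]
    exact mul_le_mul_of_nonneg_left hN1 hr'.le
  have hn2 : D ^ 6 - r * x ≤ ((r * N : ℕ) : ℝ) * x := by
    push_cast
    rw [← hrE, mul_assoc, ← mul_sub]
    exact mul_le_mul_of_nonneg_left hN2 hr'.le
  have hll3 : l ≤ l ^ 3 := le_self_pow₀ hl1 (by norm_num)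
  have hll6 : l ≤ l ^ 6 := le_self_pow₀ hl1 (by norm_num)
  have hll9 : l ≤ l ^ 9 := le_self_pow₀ hl1 (by norm_num)
  have hx1 : 1 + l ^ 2 / g ^ 2 ≤ l ^ 3 := by
    have h1 : l ^ 2 * (1 + 1 / g ^ 2) ≤ l ^ 2 * l := mul_le_mul_of_nonneg_left hlx (by positivity)
    have h2 : l ^ 2 * (1 + 1 / g ^ 2) = l ^ 2 + l ^ 2 / g ^ 2 := by ring
    nlinarith
  obtain ⟨γ, hγ⟩ : ∃ γ, γ = ((r * N : ℕ) : ℝ) * (x - Real.log (1 + x)) - q * (D ^ 4 * l / g) - D ^ 4 / l ^ 2 :=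
    ⟨_, rfl⟩
  have hγ1 := ach_gamma (ρ := r) (n := ((r * N : ℕ) : ℝ)) hg hq hDone hl1 hlD (by rw [← hx]; exact hn1)
    (by rw [← hx]; exact hn2) hx1 hD2
  rw [← hx, ← hγ] at hγ1
  have hlogl : 1 ≤ Real.log l := by
    rw [Real.le_log_iff_exp_le hl0]
    linarith [Real.exp_one_lt_d9]
  have hlogl2 : Real.log l ≤ l := by linarith [Real.log_le_sub_one_of_pos hl0]
  obtain ⟨T, hT⟩ : ∃ T, T = D ^ 4 * Real.log l / l ^ 2 := ⟨_, rfl⟩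
  have hT1 : D ^ 4 / l ^ 2 ≤ T := by
    rw [hT]
    apply div_le_div_of_nonneg_right _ (by positivity)
    have : 0 ≤ D ^ 4 := by positivity
    nlinarith
  have hT2 : T ≤ D ^ 4 * l := by
    rw [hT, div_le_iff₀ (by positivity)]
    have h1 : D ^ 4 * Real.log l ≤ D ^ 4 * l := mul_le_mul_of_nonneg_left hlogl2 (by positivity)
    have h2 : 0 ≤ D ^ 4 * l := by positivity
    have h3 : 1 ≤ l ^ 2 := one_le_pow₀ hl1
    nlinarith
  have hDD : D ≤ D ^ 4 := le_self_pow₀ hDone (by norm_num)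
  have hT3 : 7 * Real.log l ≤ D ^ 4 / l ^ 2 := by
    rw [le_div_iff₀ (by positivity)]
    have : 7 * Real.log l * l ^ 2 ≤ 7 * l * l ^ 2 := by
      apply mul_le_mul_of_nonneg_right _ (by positivity); linarith
    have h2 : 7 * l * l ^ 2 = 7 * l ^ 3 := by ring
    linarith
  rw [← hT] at hγ1 ⊢
  have hγ2 : 6 * Real.log l ≤ γ := by
    have h1 : g ^ 2 * T ≤ g ^ 2 * (D ^ 4 * l) := mul_le_mul_of_nonneg_left hT2 (by positivity)
    have h2 : D ^ 4 * ((4 * g ^ 2 + 9) * l ^ 1) ≤ D ^ 4 * D := mul_le_mul_of_nonneg_left hD4 (by positivity)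
    have h3 : D ^ 4 * D ≤ D ^ 6 := by
      have : D ^ 5 ≤ D ^ 6 := pow_le_pow_right₀ hDone (by norm_num)
      nlinarith
    have h4 : D ^ 4 * ((4 * g ^ 2 + 9) * l ^ 1) = 4 * (g ^ 2 * (D ^ 4 * l)) + 9 * (D ^ 4 * l) := by ring
    have h5 : g ^ 2 * D ^ 4 * l = g ^ 2 * (D ^ 4 * l) := by ring
    have h6 : 3 * g ^ 2 * T = 3 * (g ^ 2 * T) := by ring
    have h7 : 0 ≤ Real.log l := by linarith
    have h8 : 0 ≤ D ^ 4 * l := by positivity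
    linarith
  set M := ⌊Real.exp γ / l ^ 6⌋₊ with hM
  have hl6 : l ^ 6 = Real.exp (6 * Real.log l) := by
    rw [← Real.exp_log (show 0 < l ^ 6 by positivity), Real.log_pow]; norm_num
  have hY : 1 ≤ Real.exp γ / l ^ 6 := by
    rw [hl6, ← Real.exp_sub]
    exact Real.one_le_exp (by linarith)
  have hM1 : 1 ≤ M := by rw [hM]; exact (Nat.one_le_floor_iff _).2 hY
  have hM2 : Real.exp γ / l ^ 6 ≤ 2 * M := by
    have h1 := Nat.lt_floor_add_one (Real.exp γ / l ^ 6)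
    have h2 : (1:ℝ) ≤ M := by exact_mod_cast hM1
    rw [← hM] at h1
    linarith
  have hM3 : (M:ℝ) ≤ Real.exp γ / l ^ 6 := Nat.floor_le (by positivity)
  refine ⟨M, hM1, ?_, ?_⟩
  · apply exists_code (N := N) (x := x) (γ := γ) (η := 1 / l ^ 6) hM1 hx0.le hN1
    · calc (M:ℝ) * Real.exp (-γ) ≤ Real.exp γ / l ^ 6 * Real.exp (-γ) :=
            mul_le_mul_of_nonneg_right hM3 (Real.exp_nonneg _)
        _ = 1 / l ^ 6 := by rw [Real.exp_neg]; field_simp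
    · intro ι b a μ ha hcard hμ
      have h1 := ach_prob hg hq0 hDone hl1 (by linarith) (by linarith) (by linarith)
        (by have := mul_le_mul_of_nonneg_left hll3 hcg.le; linarith) hD1
        (by rw [← hx]; exact ha) hμ (by rw [← hx, hcard]; exact hn1)
      have e : γ - ((r * N : ℕ) : ℝ) * (x - Real.log (1 + x)) = -(q * (D ^ 4 * l / g)) - D ^ 4 / l ^ 2 := by
        rw [hγ]; ring
      rw [e]
      exact h1
  · have hMpos : (0:ℝ) < M := by exact_mod_cast hM1
    have h1 : γ - 6 * Real.log l ≤ Real.log 2 + Real.log M := by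
      rw [← Real.log_mul (by norm_num) hMpos.ne', Real.le_log_iff_exp_le (by positivity), Real.exp_sub, ← hl6]
      exact hM2
    have h2 : Real.log 2 ≤ Real.log l := Real.log_le_log (by norm_num) (by linarith)
    have h3 : (3 * g ^ 2 + 3) * T = 3 * g ^ 2 * T + 3 * T := by ring
    linarith


lemma mstar_l {g q : ℝ} (hg : 0 < g) (hq : q = 2 * g ^ 3 / 3) (r : ℕ) (hr : 0 < r) :
    ∃ l₀ : ℝ, ∀ l ≥ l₀, ∀ E : ℝ, r * E = Real.exp (l ^ 3 / 6) ^ 6 →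
      |Real.log (Mstar r E (gPhi (-q))) - Real.exp (l ^ 3 / 6) ^ 6 + g ^ 2 * Real.exp (l ^ 3 / 6) ^ 4 * l| ≤
        (3 * g ^ 2 + 3) * (Real.exp (l ^ 3 / 6) ^ 4 * Real.log l / l ^ 2) := by
  have hq0 : 0 < q := by rw [hq]; positivity
  obtain ⟨l₁, h₁⟩ := converse_l (q := q) (G := g ^ 2) hq0 (by positivity) (by rw [hq]; ring)
  obtain ⟨l₂, h₂⟩ := ach_l hg hq r hr
  obtain ⟨l₃, h₃⟩ := Filter.eventually_atTop.1 (ev_pow_le_exp 6 3)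
  refine ⟨max (max l₁ l₂) (max l₃ 3), ?_⟩
  intro l hl E hrE
  have hl1 : l₁ ≤ l := le_trans (le_trans (le_max_left _ _) (le_max_left _ _)) hl
  have hl2 : l₂ ≤ l := le_trans (le_trans (le_max_right _ _) (le_max_left _ _)) hl
  have hl3 : l₃ ≤ l := le_trans (le_trans (le_max_left _ _) (le_max_right _ _)) hl
  have hl4 : 3 ≤ l := le_trans (le_trans (le_max_right _ _) (le_max_right _ _)) hl
  have hup := fun M h => h₁ l hl1 r E M hr hrE h
  obtain ⟨M, hM1, hMc, hMl⟩ := h₂ l hl2 E hrE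
  have hD6 := h₃ l hl3
  obtain ⟨D, hD⟩ : ∃ D, D = Real.exp (l ^ 3 / 6) := ⟨_, rfl⟩
  simp only [← hD] at hup hMl hD6 hrE ⊢
  have hl0 : 0 < l := by linarith
  have hDone : 1 ≤ D := by rw [hD]; exact Real.one_le_exp (by positivity)
  have hbdd : BddAbove {M | Nonempty (SimoCode r E M (gPhi (-q)))} := by
    refine ⟨⌊l ^ 6 * Real.exp (D ^ 6 - g ^ 2 * D ^ 4 * l + D ^ 4 / l ^ 2)⌋₊, ?_⟩
    intro M' hM'
    exact Nat.le_floor (hup M' hM')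
  have hmem : Mstar r E (gPhi (-q)) ∈ {M | Nonempty (SimoCode r E M (gPhi (-q)))} :=
    Nat.sSup_mem ⟨M, hMc⟩ hbdd
  have hle : M ≤ Mstar r E (gPhi (-q)) := le_csSup hbdd hMc
  have hup' := hup _ hmem
  have hMp : (0:ℝ) < M := by exact_mod_cast hM1
  have hle' : (M:ℝ) ≤ Mstar r E (gPhi (-q)) := by exact_mod_cast hle
  have hlow : Real.log M ≤ Real.log (Mstar r E (gPhi (-q))) := Real.log_le_log hMp hle'
  have hhigh : Real.log (Mstar r E (gPhi (-q))) ≤ 6 * Real.log l + (D ^ 6 - g ^ 2 * D ^ 4 * l + D ^ 4 / l ^ 2) := by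
    have := Real.log_le_log (by linarith) hup'
    rw [Real.log_mul (by positivity) (Real.exp_ne_zero _), Real.log_exp, Real.log_pow] at this
    exact_mod_cast this
  have hlogl : 1 ≤ Real.log l := by
    rw [Real.le_log_iff_exp_le hl0]
    linarith [Real.exp_one_lt_d9]
  have hlogl2 : Real.log l ≤ l := by linarith [Real.log_le_sub_one_of_pos hl0]
  obtain ⟨T, hT⟩ : ∃ T, T = D ^ 4 * Real.log l / l ^ 2 := ⟨_, rfl⟩
  have hT1 : D ^ 4 / l ^ 2 ≤ T := by
    rw [hT]
    apply div_le_div_of_nonneg_right _ (by positivity)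
    have : 0 ≤ D ^ 4 := by positivity
    nlinarith
  have hDD : D ≤ D ^ 4 := le_self_pow₀ hDone (by norm_num)
  have hT3 : 6 * Real.log l ≤ D ^ 4 / l ^ 2 := by
    rw [le_div_iff₀ (by positivity)]
    have : 6 * Real.log l * l ^ 2 ≤ 6 * l * l ^ 2 := by
      apply mul_le_mul_of_nonneg_right _ (by positivity); linarith
    have h2 : 6 * l * l ^ 2 = 6 * l ^ 3 := by ring
    linarith
  rw [← hT] at hMl ⊢
  have hT0 : 0 ≤ T := le_trans (by positivity) hT1
  have hgT : 0 ≤ g ^ 2 * T := by positivity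
  have e : (3 * g ^ 2 + 3) * T = 3 * (g ^ 2 * T) + 3 * T := by ring
  rw [e] at hMl ⊢
  rw [abs_le]
  constructor <;> linarith

lemma Kconst : (12 : ℝ) ^ (-(1 : ℝ) / 3) + ((2 : ℝ) / 3) ^ ((1 : ℝ) / 3) = ((3:ℝ) / 2) ^ ((2:ℝ) / 3) := by
  have h1 : ((2 : ℝ) / 3) ^ ((1 : ℝ) / 3) = 2 * (12 : ℝ) ^ (-(1 : ℝ) / 3) := by
    have : (2:ℝ) / 3 = 2 ^ (3:ℝ) * (12:ℝ)⁻¹ := by norm_num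
    rw [this, Real.mul_rpow (by positivity) (by positivity), ← Real.rpow_mul (by norm_num),
      Real.inv_rpow (by norm_num), ← Real.rpow_neg (by norm_num)]
    norm_num
  have h2 : 3 * (12 : ℝ) ^ (-(1 : ℝ) / 3) = ((3:ℝ) / 2) ^ ((2:ℝ) / 3) := by
    have a1 : (3:ℝ) = (27:ℝ) ^ ((1:ℝ)/3) := by
      rw [show (27:ℝ) = 3 ^ (3:ℝ) by norm_num, ← Real.rpow_mul (by norm_num)]; norm_num
    have a2 : ((3:ℝ) / 2) ^ ((2:ℝ) / 3) = (9/4:ℝ) ^ ((1:ℝ)/3) := by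
      rw [show (9/4:ℝ) = (3/2) ^ (2:ℝ) by norm_num, ← Real.rpow_mul (by norm_num)]; norm_num
    rw [a2, show (9/4:ℝ) = 27 * (12:ℝ)⁻¹ by norm_num, Real.mul_rpow (by norm_num) (by norm_num),
      Real.inv_rpow (by norm_num), ← Real.rpow_neg (by norm_num), ← a1]
    norm_num
  rw [h1, ← h2]; ring

theorem simo_second_order_asymptotics
    (r : ℕ) (hr : 0 < r) (ε : ℝ) (hε : ε ∈ Set.Ioo (0 : ℝ) (1 / 2))
    (Qinv : ℝ) (hQinv : gaussianQ Qinv = ε) :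
    ∃ C > (0 : ℝ), ∃ E₀ > (0 : ℝ), ∀ E ≥ E₀,
      |Real.log (Mstar r E ε) - (r : ℝ) * E +
          ((12 : ℝ) ^ (-(1 : ℝ) / 3) + ((2 : ℝ) / 3) ^ ((1 : ℝ) / 3)) *
            ((r : ℝ) * E * Qinv) ^ ((2 : ℝ) / 3) * (Real.log ((r : ℝ) * E)) ^ ((1 : ℝ) / 3)| ≤
        C * E ^ ((2 : ℝ) / 3) * Real.log (Real.log E) / (Real.log E) ^ ((2 : ℝ) / 3) := by
  rw [gaussianQ_eq] at hQinv
  have hq : 0 < Qinv := by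
    by_contra h
    have h1 : gPhi 0 ≤ gPhi (-Qinv) := gPhi_mono (by linarith)
    rw [gPhi_zero, hQinv] at h1
    linarith [hε.2]
  obtain ⟨g, hgdef⟩ : ∃ g, g = (3 / 2 * Qinv) ^ ((1:ℝ) / 3) := ⟨_, rfl⟩
  have hg : 0 < g := by rw [hgdef]; positivity
  have hg3 : g ^ 3 = 3 / 2 * Qinv := by
    rw [hgdef, ← Real.rpow_natCast, ← Real.rpow_mul (by positivity)]; norm_num
  have hg2 : g ^ 2 = (3 / 2) ^ ((2:ℝ)/3) * Qinv ^ ((2:ℝ)/3) := by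
    rw [hgdef, ← Real.rpow_natCast, ← Real.rpow_mul (by positivity), ← Real.mul_rpow (by norm_num) hq.le]
    norm_num
  obtain ⟨l₀, hl₀⟩ := mstar_l hg (show Qinv = 2 * g ^ 3 / 3 by rw [hg3]; ring) r hr
  have hr1 : (1:ℝ) ≤ r := by exact_mod_cast hr
  refine ⟨(3 * g ^ 2 + 3) * (r:ℝ) ^ ((2:ℝ)/3), by positivity,
    max (Real.exp (|l₀| ^ 3)) (max (Real.exp 2) r), by positivity, ?_⟩
  intro E hE
  have hE1 : Real.exp (|l₀| ^ 3) ≤ E := le_trans (le_max_left _ _) hE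
  have hE2 : Real.exp 2 ≤ E := le_trans (le_trans (le_max_left _ _) (le_max_right _ _)) hE
  have hE3 : (r:ℝ) ≤ E := le_trans (le_trans (le_max_right _ _) (le_max_right _ _)) hE
  have hE0 : 0 < E := lt_of_lt_of_le (Real.exp_pos _) hE2
  obtain ⟨A, hA⟩ : ∃ A, A = (r:ℝ) * E := ⟨_, rfl⟩
  have hAE : E ≤ A := by rw [hA]; nlinarith
  have hA0 : 0 < A := by linarith
  have hlE2 : 2 ≤ Real.log E := (Real.le_log_iff_exp_le hE0).2 hE2
  have hlAE : Real.log E ≤ Real.log A := Real.log_le_log hE0 hAE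
  have hlE1 : |l₀| ^ 3 ≤ Real.log E := (Real.le_log_iff_exp_le hE0).2 hE1
  have hlA0 : 0 < Real.log A := by linarith
  obtain ⟨l, hl⟩ : ∃ l, l = (Real.log A) ^ ((1:ℝ)/3) := ⟨_, rfl⟩
  have hl0 : 0 < l := by rw [hl]; positivity
  have hl3 : l ^ 3 = Real.log A := by
    rw [hl, ← Real.rpow_natCast, ← Real.rpow_mul (by positivity)]; norm_num
  have hl2 : l ^ 2 = (Real.log A) ^ ((2:ℝ)/3) := by
    rw [hl, ← Real.rpow_natCast, ← Real.rpow_mul (by positivity)]; norm_num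
  have hll : l₀ ≤ l := by
    refine le_trans (le_abs_self _) ?_
    apply le_of_pow_le_pow_left₀ (n := 3) (by norm_num) hl0.le
    linarith
  have hD6 : Real.exp (l ^ 3 / 6) ^ 6 = A := by
    rw [← Real.exp_nat_mul, hl3]
    push_cast
    rw [show (6:ℝ) * (Real.log A / 6) = Real.log A by ring, Real.exp_log hA0]
  have hD4 : Real.exp (l ^ 3 / 6) ^ 4 = A ^ ((2:ℝ)/3) := by
    rw [← Real.exp_nat_mul, hl3, Real.rpow_def_of_pos hA0]
    push_cast
    congr 1; ring
  have key := hl₀ l hll E (by rw [hD6, hA])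
  rw [hD6, hD4, hQinv] at key
  have hterm : ((12 : ℝ) ^ (-(1 : ℝ) / 3) + ((2 : ℝ) / 3) ^ ((1 : ℝ) / 3)) *
            ((r : ℝ) * E * Qinv) ^ ((2 : ℝ) / 3) * (Real.log ((r : ℝ) * E)) ^ ((1 : ℝ) / 3) =
      g ^ 2 * A ^ ((2:ℝ)/3) * l := by
    rw [← hA, Kconst, Real.mul_rpow hA0.le hq.le, hg2, ← hl]; ring
  rw [hterm, ← hA]
  refine le_trans key ?_
  have hlogl : Real.log l = Real.log (Real.log A) / 3 := by
    rw [hl, Real.log_rpow hlA0]; ring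
  have hloglog : Real.log (Real.log A) ≤ 2 * Real.log (Real.log E) := by
    have h1 : Real.log A ≤ Real.log E ^ 2 := by
      have : Real.log A = Real.log r + Real.log E := by
        rw [hA, Real.log_mul (by positivity) hE0.ne']
      have h2 : Real.log r ≤ Real.log E := Real.log_le_log (by linarith) hE3
      nlinarith
    have h3 := Real.log_le_log hlA0 h1
    rw [Real.log_pow] at h3
    exact_mod_cast h3
  have hLL0 : 0 ≤ Real.log (Real.log E) := Real.log_nonneg (by linarith)
  have hA23 : A ^ ((2:ℝ)/3) = (r:ℝ) ^ ((2:ℝ)/3) * E ^ ((2:ℝ)/3) := by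
    rw [hA, Real.mul_rpow (by positivity) hE0.le]
  have hden : (Real.log E) ^ ((2:ℝ)/3) ≤ l ^ 2 := by
    rw [hl2]; exact Real.rpow_le_rpow (by linarith) hlAE (by norm_num)
  have hden0 : 0 < (Real.log E) ^ ((2:ℝ)/3) := Real.rpow_pos_of_pos (by linarith) _
  have hlogl' : Real.log l ≤ Real.log (Real.log E) := by rw [hlogl]; linarith
  have hfin : A ^ ((2:ℝ)/3) * Real.log l / l ^ 2 ≤
      A ^ ((2:ℝ)/3) * Real.log (Real.log E) / (Real.log E) ^ ((2:ℝ)/3) := by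
    have hA23p : 0 ≤ A ^ ((2:ℝ)/3) := by positivity
    apply div_le_div₀ (by positivity) (mul_le_mul_of_nonneg_left hlogl' hA23p) hden0 hden
  calc (3 * g ^ 2 + 3) * (A ^ ((2:ℝ)/3) * Real.log l / l ^ 2)
      ≤ (3 * g ^ 2 + 3) * (A ^ ((2:ℝ)/3) * Real.log (Real.log E) / (Real.log E) ^ ((2:ℝ)/3)) :=
        mul_le_mul_of_nonneg_left hfin (by positivity)
    _ = _ := by rw [hA23]; ring
end

section
/- Fix an integer m ≥ 2 and positive reals a₁, …, a_m, and let f = e_{a₁} ⋆ e_{a₂} ⋆ ⋯ ⋆ e_{a_m} be the iterated convolution of the exponential densities e_{a₁}, …, e_{a_m} (so f is the probability density of Σ_{i=1}^m a_i·S_i where S₁,…,S_m are i.i.d. exponential of mean 1). Then f(x) > 0 for all x ∈ (0,∞) and the function x ↦ ln f(x) is strictly concave on (0,∞). -/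
open MeasureTheory

/-- The exponential density of mean `q`: `e_q(x) = q⁻¹ e^{-x/q}` for `x ≥ 0`, `0` otherwise. -/
noncomputable def expDensity (q : ℝ) (x : ℝ) : ℝ :=
  if 0 ≤ x then q⁻¹ * Real.exp (-x / q) else 0

/-- Convolution of two real functions (w.r.t. Lebesgue measure). -/
noncomputable def convFn (f g : ℝ → ℝ) (x : ℝ) : ℝ :=
  ∫ y, f (x - y) * g y

/-- Iterated convolution of exponential densities with means given by the list:
the density of `Σ aᵢ Sᵢ` with `Sᵢ` i.i.d. mean-1 exponentials. -/
noncomputable def expConvList : List ℝ → ℝ → ℝ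
  | [] => fun _ => 0
  | [a] => expDensity a
  | a :: b :: l => convFn (expDensity a) (expConvList (b :: l))

open Set

/-- Regularity package for a log-concave density on the half line. -/
def GoodDens (g : ℝ → ℝ) : Prop :=
  (∀ x, x < 0 → g x = 0) ∧ (∀ x, 0 < x → 0 < g x) ∧ ContinuousOn g (Ici 0) ∧
    ConcaveOn ℝ (Ioi 0) (fun x => Real.log (g x))

lemma four_point {u : ℝ → ℝ} (hu : ConcaveOn ℝ (Ioi 0) u) {t x y : ℝ} (ht : 0 < t)
    (htx : t ≤ x) (hxy : x < y) : u y + u t ≤ u x + u (t + (y - x)) := by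
  have hty : 0 < y - t := by linarith
  have hne : y - t ≠ 0 := hty.ne'
  have h1 := hu.2 (show t ∈ Ioi (0:ℝ) from ht) (show y ∈ Ioi (0:ℝ) from by simp; linarith)
    (div_nonneg (show 0 ≤ y - x by linarith) hty.le)
    (div_nonneg (show 0 ≤ x - t by linarith) hty.le) (by field_simp; ring)
  have h2 := hu.2 (show t ∈ Ioi (0:ℝ) from ht) (show y ∈ Ioi (0:ℝ) from by simp; linarith)
    (div_nonneg (show 0 ≤ x - t by linarith) hty.le)
    (div_nonneg (show 0 ≤ y - x by linarith) hty.le) (by field_simp; ring)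
  simp only [smul_eq_mul] at h1 h2
  have e1 : (y - x) / (y - t) * t + (x - t) / (y - t) * y = x := by field_simp; ring
  have e2 : (x - t) / (y - t) * t + (y - x) / (y - t) * y = t + (y - x) := by field_simp; ring
  rw [e1] at h1
  rw [e2] at h2
  have e3 : (y - x) / (y - t) = 1 - (x - t) / (y - t) := by field_simp; ring
  rw [e3] at h1 h2
  linarith

lemma conv_neg (a : ℝ) (g : ℝ → ℝ) (hg : ∀ x, x < 0 → g x = 0) (x : ℝ) (hx : x < 0) :
    convFn (expDensity a) g x = 0 := by
  unfold convFn
  rw [← integral_zero ℝ ℝ]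
  congr 1
  ext y
  by_cases hy : y < 0
  · simp [hg y hy]
  · have : ¬ (0 ≤ x - y) := by linarith
    simp [expDensity, this]

lemma conv_formula (a : ℝ) (g : ℝ → ℝ) (hg : ∀ x, x < 0 → g x = 0) (x : ℝ) (hx : 0 ≤ x) :
    convFn (expDensity a) g x =
      (a⁻¹ * Real.exp (-x / a)) * ∫ y in (0:ℝ)..x, Real.exp (y / a) * g (max y 0) := by
  unfold convFn
  rw [intervalIntegral.integral_of_le hx, ← integral_Icc_eq_integral_Ioc,
    ← integral_const_mul, ← integral_indicator measurableSet_Icc]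
  congr 1
  ext y
  by_cases hy : y ∈ Icc 0 x
  · rw [indicator_of_mem hy]
    have h1 : 0 ≤ x - y := by linarith [hy.2]
    have h2 : Real.exp (-(x - y) / a) = Real.exp (-x / a) * Real.exp (y / a) := by
      rw [← Real.exp_add]; congr 1; ring
    rw [expDensity, if_pos h1, max_eq_left hy.1, h2]
    ring
  · rw [indicator_of_notMem hy]
    by_cases hy0 : y < 0
    · simp [hg y hy0]
    · have : ¬ (0 ≤ x - y) := fun h => hy ⟨by linarith, by linarith⟩
      simp [expDensity, this]

lemma good_step (a : ℝ) (ha : 0 < a) (g : ℝ → ℝ) (hg : GoodDens g) :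
    GoodDens (convFn (expDensity a) g) ∧
      StrictConcaveOn ℝ (Ioi 0) (fun x => Real.log (convFn (expDensity a) g x)) := by
  obtain ⟨hneg, hpos, hcont, hconc⟩ := hg
  set k : ℝ → ℝ := fun y => Real.exp (y / a) * g (max y 0) with hk
  have kcont : Continuous k := by
    have : Continuous fun y : ℝ => g (max y 0) :=
      hcont.comp_continuous (by fun_prop) (fun y => by simp)
    exact (by fun_prop : Continuous fun y : ℝ => Real.exp (y / a)).mul this
  have kpos : ∀ y, 0 < y → 0 < k y := fun y hy => by
    simp only [hk]
    rw [max_eq_left hy.le]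
    exact mul_pos (Real.exp_pos _) (hpos y hy)
  have kint : ∀ p q, IntervalIntegrable k volume p q := fun p q => kcont.intervalIntegrable p q
  set H : ℝ → ℝ := fun x => ∫ y in (0:ℝ)..x, k y with hH
  have Hder : ∀ x, HasDerivAt H (k x) x := fun x =>
    intervalIntegral.integral_hasDerivAt_right (kint 0 x)
      (kcont.stronglyMeasurableAtFilter _ _) kcont.continuousAt
  have Hcont : Continuous H := continuous_iff_continuousAt.2 fun x => (Hder x).continuousAt
  have Hpos : ∀ x, 0 < x → 0 < H x := fun x hx =>
    intervalIntegral.intervalIntegral_pos_of_pos_on (kint 0 x) (fun y hy => kpos y hy.1) hx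
  have form : ∀ x, 0 ≤ x → convFn (expDensity a) g x = (a⁻¹ * Real.exp (-x / a)) * H x :=
    fun x hx => conv_formula a g hneg x hx
  have cpos : ∀ x : ℝ, 0 < a⁻¹ * Real.exp (-x / a) := fun x => by positivity
  have fpos : ∀ x, 0 < x → 0 < convFn (expDensity a) g x := fun x hx => by
    rw [form x hx.le]; exact mul_pos (cpos x) (Hpos x hx)
  -- four-point inequality for k
  have key : ∀ x y, 0 < x → x < y → ∀ t ∈ Ioo 0 x, k y * k t ≤ k x * k (t + (y - x)) := by
    intro x y hx hxy t ht
    have h := four_point hconc ht.1 ht.2.le hxy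
    have hy : 0 < y := hx.trans hxy
    have hz : 0 < t + (y - x) := by linarith [ht.1]
    have hgg : g y * g t ≤ g x * g (t + (y - x)) := by
      rw [← Real.log_mul (hpos _ hy).ne' (hpos _ ht.1).ne',
        ← Real.log_mul (hpos _ hx).ne' (hpos _ hz).ne'] at h
      exact (Real.log_le_log_iff (mul_pos (hpos _ hy) (hpos _ ht.1))
        (mul_pos (hpos _ hx) (hpos _ hz))).1 h
    simp only [hk]
    rw [max_eq_left hy.le, max_eq_left hx.le, max_eq_left ht.1.le, max_eq_left hz.le]
    have e : Real.exp (x / a) * Real.exp ((t + (y - x)) / a)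
        = Real.exp (y / a) * Real.exp (t / a) := by
      rw [← Real.exp_add, ← Real.exp_add]; congr 1; ring
    calc _ = (Real.exp (y / a) * Real.exp (t / a)) * (g y * g t) := by ring
      _ ≤ (Real.exp (y / a) * Real.exp (t / a)) * (g x * g (t + (y - x))) := by gcongr
      _ = _ := by rw [← e]; ring
  have ratio : ∀ x y, 0 < x → x < y → k y / H y < k x / H x := by
    intro x y hx hxy
    have hy : 0 < y := hx.trans hxy
    rw [div_lt_div_iff₀ (Hpos y hy) (Hpos x hx)]
    have i1 : k y * H x ≤ k x * ∫ t in (0:ℝ)..x, k (t + (y - x)) := by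
      simp only [hH]
      rw [← intervalIntegral.integral_const_mul, ← intervalIntegral.integral_const_mul]
      refine intervalIntegral.integral_mono_on_of_le_Ioo hx.le ((kint 0 x).const_mul _)
        ((Continuous.intervalIntegrable (by fun_prop) _ _)) (key x y hx hxy)
    have i2 : (∫ t in (0:ℝ)..x, k (t + (y - x))) = H y - H (y - x) := by
      rw [intervalIntegral.integral_comp_add_right]
      simp only [hH]
      rw [intervalIntegral.integral_interval_sub_left (kint _ _) (kint _ _)]
      congr 1 <;> ring
    rw [i2] at i1
    have := mul_pos (kpos x hx) (Hpos (y - x) (by linarith))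
    linarith
  have strict : StrictConcaveOn ℝ (Ioi 0)
      (fun x => Real.log (convFn (expDensity a) g x)) := by
    have hd : ∀ x, 0 < x → HasDerivAt (fun x => Real.log (convFn (expDensity a) g x))
        (-1 / a + k x / H x) x := by
      intro x hx
      have h1 : HasDerivAt (fun x => (Real.log a⁻¹ + -x / a) + Real.log (H x))
          (-1 / a + k x / H x) x :=
        (((hasDerivAt_id x).neg.div_const a).const_add _).add ((Hder x).log (Hpos x hx).ne')
      refine h1.congr_of_eventuallyEq ?_
      filter_upwards [Ioi_mem_nhds hx] with z hz
      rw [form z (le_of_lt hz), Real.log_mul (cpos z).ne' (Hpos z hz).ne',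
        Real.log_mul (inv_pos.2 ha).ne' (Real.exp_pos _).ne', Real.log_exp]
    refine StrictAntiOn.strictConcaveOn_of_deriv (convex_Ioi 0)
      (fun x hx => (hd x hx).continuousAt.continuousWithinAt) ?_
    rw [interior_Ioi]
    intro x hx y hy hxy
    rw [(hd x hx).deriv, (hd y hy).deriv]
    linarith [ratio x y hx hxy]
  refine ⟨⟨conv_neg a g hneg, fpos, ?_, strict.concaveOn⟩, strict⟩
  have : Continuous fun x : ℝ => (a⁻¹ * Real.exp (-x / a)) * H x := by fun_prop
  exact this.continuousOn.congr fun x hx => form x hx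

lemma good_exp (a : ℝ) (ha : 0 < a) : GoodDens (expDensity a) := by
  have form : ∀ x, 0 ≤ x → expDensity a x = a⁻¹ * Real.exp (-x / a) := fun x hx => by
    simp [expDensity, hx]
  refine ⟨fun x hx => ?_, fun x hx => ?_, ?_, ?_⟩
  · simp [expDensity, hx]
  · rw [form x hx.le]; positivity
  · have : Continuous fun x : ℝ => a⁻¹ * Real.exp (-x / a) := by fun_prop
    exact this.continuousOn.congr fun x hx => form x hx
  · have e : ∀ x, 0 < x → Real.log (expDensity a x) = Real.log a⁻¹ + -x / a := fun x hx => by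
      rw [form x hx.le, Real.log_mul (inv_pos.2 ha).ne' (Real.exp_pos _).ne', Real.log_exp]
    refine ⟨convex_Ioi 0, fun x hx y hy p q hp hq hpq => ?_⟩
    have hz : p • x + q • y ∈ Ioi (0:ℝ) := convex_Ioi 0 hx hy hp hq hpq
    simp only
    rw [e x hx, e y hy, e _ hz]
    simp only [smul_eq_mul]
    have : q = 1 - p := by linarith
    subst this
    apply le_of_eq
    ring

lemma good_list : ∀ (l : List ℝ) (b : ℝ), (∀ c ∈ b :: l, 0 < c) →
    GoodDens (expConvList (b :: l))
  | [], b, h => good_exp b (h b (by simp))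
  | c :: l, b, h => (good_step b (h b (by simp)) _
      (good_list l c fun d hd => h d (List.mem_cons_of_mem _ hd))).1

theorem strict_log_concavity_of_exp_convolution
    (m : ℕ) (hm : 2 ≤ m) (a : Fin m → ℝ) (ha : ∀ i, 0 < a i) :
    (∀ x : ℝ, 0 < x → 0 < expConvList (List.ofFn a) x) ∧
      StrictConcaveOn ℝ (Set.Ioi (0 : ℝ))
        (fun x => Real.log (expConvList (List.ofFn a) x)) := by
  have hl : ∀ c ∈ List.ofFn a, 0 < c := by
    intro c hc
    obtain ⟨i, rfl⟩ := (List.mem_ofFn' a c).1 hc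
    exact ha i
  have hlen : (List.ofFn a).length = m := List.length_ofFn
  generalize List.ofFn a = L at hl hlen
  match L, hl, hlen with
  | [], _, h => simp at h; omega
  | [b], _, h => simp at h; omega
  | b :: c :: l, hl, _ =>
    have := good_step b (hl b (by simp)) _
      (good_list l c fun d hd => hl d (List.mem_cons_of_mem _ hd))
    exact ⟨this.1.2.1, this.2⟩
end
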